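/- Under the standing hypotheses on H, there exists a C¹, convex and superlinear function α : ℝ → ℝ such that for every c ∈ ℝ and every viscosity solution u : [t₀,∞) × 𝕋 → ℝ of ∂_t u + H(t,x,c+∂_x u) = 0, the function (t,x) ↦ u(t,x) + tα(c) is bounded on [t₀,∞) × 𝕋. -/

import Mathlib

open MeasureTheory Filter Set Topology

noncomputable section

/-- The Hamiltonian vector field `X(t,x,p) = (∂_p H, -∂_x H)` on `𝕋 × ℝ` (lifted to `ℝ × ℝ`). -/
def HamVF (H : ℝ → ℝ → ℝ → ℝ) (t : ℝ) (z : ℝ × ℝ) : ℝ × ℝ :=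
  (deriv (fun p => H t z.1 p) z.2, - deriv (fun x => H t x z.2) z.1)

/-- The standing hypotheses on the Hamiltonian `H`, with the circle `𝕋 = ℝ/ℤ` modelled by
`1`-periodicity in the space variable `x`. -/
structure BurgersHyp (H : ℝ → ℝ → ℝ → ℝ) : Prop where
  smooth : ContDiff ℝ 2 (fun q : ℝ × ℝ × ℝ => H q.1 q.2.1 q.2.2)
  per_t : ∀ t x p, H (t + 1) x p = H t x p
  per_x : ∀ t x p, H t (x + 1) p = H t x p
  convexp : ∀ t x p, 0 < iteratedDeriv 2 (fun q => H t x q) p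
  superlinear : ∀ t x, Tendsto (fun p => H t x p / |p|) (Bornology.cobounded ℝ) atTop
  complete : ∀ t₀ : ℝ, ∀ z₀ : ℝ × ℝ,
    ∃ γ : ℝ → ℝ × ℝ, γ t₀ = z₀ ∧ ∀ t, HasDerivAt γ (HamVF H t (γ t)) t

/-- The Lagrangian associated to `H` by Legendre duality. -/
def Lag (H : ℝ → ℝ → ℝ → ℝ) (t x v : ℝ) : ℝ := sSup (range fun p => p * v - H t x p)

/-- `ξ` is absolutely continuous on `[a,b]` with (a.e.) derivative `g`. -/
def IsAC (ξ g : ℝ → ℝ) (a b : ℝ) : Prop :=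
  IntervalIntegrable g volume a b ∧ ∀ t ∈ Icc a b, ξ t = ξ a + ∫ s in a..t, g s

/-- The set of values over which the Hopf–Lax–Oleinik infimum is taken. -/
def hloSet (H : ℝ → ℝ → ℝ → ℝ) (c a b : ℝ) (u : ℝ → ℝ) (x : ℝ) : Set ℝ :=
  {v | ∃ ξ g : ℝ → ℝ, IsAC ξ g a b ∧ ξ b = x ∧
    IntervalIntegrable (fun s => Lag H s (ξ s) (g s) - c * g s) volume a b ∧
    v = u (ξ a) + ∫ s in a..b, (Lag H s (ξ s) (g s) - c * g s)}

/-- The Hopf–Lax–Oleinik operator `V^c_{a,b}`. -/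
def hlo (H : ℝ → ℝ → ℝ → ℝ) (c a b : ℝ) (u : ℝ → ℝ) (x : ℝ) : ℝ := sInf (hloSet H c a b u x)

/-- Viscosity subsolution of `∂_t u + H(t,x,c+∂_x u) = a` on `D`. -/
def ViscSubSol (H : ℝ → ℝ → ℝ → ℝ) (c a : ℝ) (D : Set (ℝ × ℝ)) (u : ℝ → ℝ → ℝ) : Prop :=
  ∀ φ : ℝ × ℝ → ℝ, ContDiff ℝ 1 φ → ∀ z ∈ D,
    IsLocalMax (fun w : ℝ × ℝ => u w.1 w.2 - φ w) z →
    fderiv ℝ φ z (1, 0) + H z.1 z.2 (c + fderiv ℝ φ z (0, 1)) ≤ a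

/-- Viscosity supersolution of `∂_t u + H(t,x,c+∂_x u) = a` on `D`. -/
def ViscSuperSol (H : ℝ → ℝ → ℝ → ℝ) (c a : ℝ) (D : Set (ℝ × ℝ)) (u : ℝ → ℝ → ℝ) : Prop :=
  ∀ φ : ℝ × ℝ → ℝ, ContDiff ℝ 1 φ → ∀ z ∈ D,
    IsLocalMin (fun w : ℝ × ℝ => u w.1 w.2 - φ w) z →
    a ≤ fderiv ℝ φ z (1, 0) + H z.1 z.2 (c + fderiv ℝ φ z (0, 1))

/-- Viscosity solution (Crandall–Lions) of `∂_t u + H(t,x,c+∂_x u) = a` on `D`. -/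
def ViscSol (H : ℝ → ℝ → ℝ → ℝ) (c a : ℝ) (D : Set (ℝ × ℝ)) (u : ℝ → ℝ → ℝ) : Prop :=
  ViscSubSol H c a D u ∧ ViscSuperSol H c a D u

/-- Viscosity solution of `(HJc)` on `[t₀,∞) × 𝕋`: continuous up to `t₀`, `1`-periodic in `x`,
and a viscosity solution for `t > t₀`. -/
def IsViscSolOn (H : ℝ → ℝ → ℝ → ℝ) (c t₀ : ℝ) (u : ℝ → ℝ → ℝ) : Prop :=
  ContinuousOn (fun z : ℝ × ℝ => u z.1 z.2) (Ici t₀ ×ˢ univ) ∧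
  (∀ t x, u t (x + 1) = u t x) ∧
  ViscSol H c 0 (Ioi t₀ ×ˢ univ) u

/-- `w` is `K`-semi-concave: `∂_xx w ≤ K` in the sense of distributions. -/
def SemiConcaveK (w : ℝ → ℝ) (K : ℝ) : Prop :=
  ConcaveOn ℝ univ (fun x => w x - K * x ^ 2 / 2)

/-- The class `ℰ`: functions that are (locally) the sum of a continuous and a
nonincreasing function. -/
def EClass (f : ℝ → ℝ) : Prop :=
  ∃ g h : ℝ → ℝ, Continuous g ∧ Antitone h ∧ ∀ x, f x = g x + h x

/-- Right limit `f⁻(x)`. -/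
def rlim (f : ℝ → ℝ) (q : ℝ) : ℝ := limUnder (nhdsWithin q (Ioi q)) f

/-- Left limit `f⁺(x)`. -/
def llim (f : ℝ → ℝ) (q : ℝ) : ℝ := limUnder (nhdsWithin q (Iio q)) f

def Gminus (f : ℝ → ℝ) : Set (ℝ × ℝ) := {z | z.2 = rlim f z.1}
def Gplus (f : ℝ → ℝ) : Set (ℝ × ℝ) := {z | z.2 = llim f z.1}

/-- The graph `G(f) = G⁻(f) ∩ G⁺(f)`. -/
def Ggraph (f : ℝ → ℝ) : Set (ℝ × ℝ) := Gminus f ∩ Gplus f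

/-- The closure of the graph, `G⁻(f) ∪ G⁺(f)`. -/
def Gbar (f : ℝ → ℝ) : Set (ℝ × ℝ) := Gminus f ∪ Gplus f

/-- The Jordan curve `H(f) = ⋃_x {x} × [f⁻(x), f⁺(x)]` (one period). -/
def Hset (f : ℝ → ℝ) : Set (ℝ × ℝ) :=
  {z | z.1 ∈ Icc (0:ℝ) 1 ∧ z.2 ∈ Icc (rlim f z.1) (llim f z.1)}

/-- Entropy solution of `∂_t y + ∂_x (H(t,x,y)) = 0` on `[t₀,∞) × 𝕋` (with its own
initial trace at `t₀`): distributional solution satisfying the Oleinik inequalities. -/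
def IsEntropySolOn (H : ℝ → ℝ → ℝ → ℝ) (t₀ : ℝ) (y : ℝ → ℝ → ℝ) : Prop :=
  (∀ t x, t₀ ≤ t → y t (x + 1) = y t x) ∧
  (∀ T, t₀ < T →
    IntegrableOn (fun z : ℝ × ℝ => y z.1 z.2) (Icc t₀ T ×ˢ Icc (0:ℝ) 1) volume ∧
    IntegrableOn (fun z : ℝ × ℝ => H z.1 z.2 (y z.1 z.2)) (Icc t₀ T ×ˢ Icc (0:ℝ) 1) volume) ∧
  (∀ φ : ℝ × ℝ → ℝ, ContDiff ℝ 2 φ → (∀ t x, φ (t, x + 1) = φ (t, x)) →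
    (∃ T, ∀ t x, T ≤ t → φ (t, x) = 0) →
    (∫ z in Ioi t₀ ×ˢ Ioc (0:ℝ) 1,
      (y z.1 z.2 * fderiv ℝ φ z (1, 0) + H z.1 z.2 (y z.1 z.2) * fderiv ℝ φ z (0, 1)))
      + ∫ x in (0:ℝ)..1, y t₀ x * φ (t₀, x) = 0) ∧
  (∃ K : ℝ → ℝ, (∀ t, t₀ < t → 0 < K t) ∧ AntitoneOn K (Ioi t₀) ∧
    ∀ t, t₀ < t → ∀ x δ, 0 < δ → y t (x + δ) - y t x ≤ K t * δ)

/-- `ξ` (with a.e. derivative `g`) is calibrated by `u` on `[a,b]`. -/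
def CalibratedCurve (H : ℝ → ℝ → ℝ → ℝ) (c : ℝ) (u : ℝ → ℝ → ℝ)
    (ξ g : ℝ → ℝ) (a b : ℝ) : Prop :=
  IsAC ξ g a b ∧
  IntervalIntegrable (fun s => Lag H s (ξ s) (g s) - c * g s) volume a b ∧
  u b (ξ b) = u a (ξ a) + ∫ s in a..b, (Lag H s (ξ s) (g s) - c * g s)

/-- `φ t₀ t` is the (lifted) flow of the Hamiltonian vector field of `H` between times
`t₀` and `t`. -/
def IsHamFlow (H : ℝ → ℝ → ℝ → ℝ) (φ : ℝ → ℝ → ℝ × ℝ → ℝ × ℝ) : Prop :=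
  (∀ t₀ z, φ t₀ t₀ z = z) ∧
  (∀ t₀ z t, HasDerivAt (fun s => φ t₀ s z) (HamVF H t (φ t₀ t z)) t) ∧
  (∀ t₀ t, Function.Bijective (φ t₀ t)) ∧
  (∀ t₀ t z, φ t₀ t (z + ((1:ℝ), (0:ℝ))) = φ t₀ t z + ((1:ℝ), (0:ℝ)))

/-- Periodic, measurable, integrable over a period: a representative of an element of
`L¹(𝕋)`. -/
def PerInt (y : ℝ → ℝ) : Prop :=
  (∀ x, y (x + 1) = y x) ∧ Measurable y ∧ IntervalIntegrable y volume 0 1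

/-- `E` is the time-one entropy evolution operator of `H` (extended to `L¹(𝕋)` by
`L¹`-continuity; it is considered up to a.e. equality, and satisfies the Oleinik bound). -/
structure IsEntropyOp (H : ℝ → ℝ → ℝ → ℝ) (E : (ℝ → ℝ) → (ℝ → ℝ)) : Prop where
  sol : ∀ y₀ : ℝ → ℝ, PerInt y₀ → (∃ M, ∀ x, |y₀ x| ≤ M) →
    ∃ y : ℝ → ℝ → ℝ, IsEntropySolOn H 0 y ∧ (∀ x, y 0 x = y₀ x) ∧ (∀ x, E y₀ x = y 1 x)
  maps : ∀ y, PerInt y → PerInt (E y)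
  oleinik : ∀ y, PerInt y → ∃ K, 0 < K ∧ ∀ x δ, 0 < δ → E y (x + δ) - E y x ≤ K * δ
  cont : ∀ y : ℝ → ℝ, PerInt y → ∀ z : ℕ → ℝ → ℝ, (∀ n, PerInt (z n)) →
    Tendsto (fun n => ∫ x in (0:ℝ)..1, |z n x - y x|) atTop (𝓝 0) →
    Tendsto (fun n => ∫ x in (0:ℝ)..1, |E (z n) x - E y x|) atTop (𝓝 0)

/-- Mather's alpha function: `C¹`, convex, superlinear, and every viscosity solution `u`
of `(HJc)` has `u + tα(c)` bounded. -/
def MatherAlpha (H : ℝ → ℝ → ℝ → ℝ) (α : ℝ → ℝ) : Prop :=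
  ContDiff ℝ 1 α ∧ ConvexOn ℝ univ α ∧
  Tendsto (fun c => α c / |c|) (Bornology.cobounded ℝ) atTop ∧
  ∀ c t₀ : ℝ, ∀ u : ℝ → ℝ → ℝ, IsViscSolOn H c t₀ u →
    ∃ M, ∀ t ∈ Ici t₀, ∀ x, |u t x + t * α c| ≤ M

end

section GlobalODE

variable {E : Type*} [NormedAddCommGroup E] [NormedSpace ℝ E]

theorem norm_integral_le_cosh {f : ℝ → E} {M l : ℝ} (hl : 0 < l)
    (hf : ∀ s, ‖f s‖ ≤ M * Real.cosh (l * s)) (t : ℝ) :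
    ‖∫ s in (0:ℝ)..t, f s‖ ≤ M / l * Real.cosh (l * t) := by
  have hM : 0 ≤ M := by
    have h := (norm_nonneg _).trans (hf 0)
    simpa using h
  have hc : Continuous fun s : ℝ => M * Real.cosh (l * s) := by fun_prop
  have h1 : ‖∫ s in (0:ℝ)..t, f s‖ ≤ |∫ s in (0:ℝ)..t, M * Real.cosh (l * s)| :=
    intervalIntegral.norm_integral_le_abs_of_norm_le (Eventually.of_forall fun s => hf s)
      (hc.intervalIntegrable _ _)
  have h2 : ∫ s in (0:ℝ)..t, M * Real.cosh (l * s) = M / l * Real.sinh (l * t) := by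
    have := intervalIntegral.integral_eq_sub_of_hasDerivAt
      (f := fun s => M / l * Real.sinh (l * s)) (f' := fun s => M * Real.cosh (l * s))
      (a := 0) (b := t) (fun s _ => by
        have h := ((hasDerivAt_id s).const_mul l).sinh.const_mul (M / l)
        refine h.congr_deriv ?_
        simp only [id]
        field_simp) (hc.intervalIntegrable _ _)
    simpa using this
  rw [h2, abs_mul, abs_of_nonneg (by positivity : 0 ≤ M / l)] at h1
  refine h1.trans (mul_le_mul_of_nonneg_left ?_ (by positivity))
  rw [abs_le]
  constructor
  · have := Real.cosh_add_sinh (l * t); have := Real.exp_pos (l * t); linarith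
  · have := Real.cosh_sub_sinh (l * t); have := Real.exp_pos (-(l * t)); linarith

theorem dist_solutions_le_forward {v : ℝ → E → E} {K : ℝ} (hK : 0 ≤ K)
    (hlip : ∀ t z w, ‖v t z - v t w‖ ≤ K * ‖z - w‖) {f g : ℝ → E}
    (hf : ∀ t, HasDerivAt f (v t (f t)) t) (hg : ∀ t, HasDerivAt g (v t (g t)) t)
    {s t : ℝ} (hst : s ≤ t) : ‖f t - g t‖ ≤ ‖f s - g s‖ * Real.exp (K * (t - s)) := by
  have hL : ∀ t, LipschitzWith K.toNNReal (v t) := fun t =>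
    LipschitzWith.of_dist_le_mul fun z w => by
      rw [Real.coe_toNNReal _ hK, dist_eq_norm, dist_eq_norm]; exact hlip t z w
  have := dist_le_of_trajectories_ODE (v := v) (K := K.toNNReal) (f := f) (g := g) (a := s) (b := t)
    (δ := ‖f s - g s‖)
    hL
    (fun t _ => (hf t).continuousAt.continuousWithinAt)
    (fun t _ => (hf t).hasDerivWithinAt)
    (fun t _ => (hg t).continuousAt.continuousWithinAt)
    (fun t _ => (hg t).hasDerivWithinAt) (by rw [dist_eq_norm]) t ⟨hst, le_rfl⟩
  rwa [dist_eq_norm, Real.coe_toNNReal _ hK] at this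

theorem dist_solutions_le {v : ℝ → E → E} {K : ℝ} (hK : 0 ≤ K)
    (hlip : ∀ t z w, ‖v t z - v t w‖ ≤ K * ‖z - w‖) {f g : ℝ → E}
    (hf : ∀ t, HasDerivAt f (v t (f t)) t) (hg : ∀ t, HasDerivAt g (v t (g t)) t)
    (s t : ℝ) : ‖f t - g t‖ ≤ ‖f s - g s‖ * Real.exp (K * |t - s|) := by
  rcases le_total s t with h | h
  · rw [abs_of_nonneg (by linarith)]
    exact dist_solutions_le_forward hK hlip hf hg h
  · rw [abs_of_nonpos (by linarith)]
    have hr : ∀ {f : ℝ → E}, (∀ t, HasDerivAt f (v t (f t)) t) →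
        ∀ t, HasDerivAt (fun r => f (-r)) (-v (-t) (f (-t))) t := by
      intro f hf t
      have := (hf (-t)).scomp t (hasDerivAt_neg t)
      simpa [Function.comp_def] using this
    have := dist_solutions_le_forward (v := fun t z => -v (-t) z) hK
      (fun t z w => by
        have := hlip (-t) z w
        rwa [neg_sub_neg, norm_sub_rev]) (hr hf) (hr hg) (neg_le_neg h)
    simp only [neg_neg] at this
    convert this using 3
    ring

variable [CompleteSpace E]

theorem exists_global_solution_zero {v : ℝ → E → E} {K V : ℝ} (hK : 0 ≤ K)
    (hv : Continuous (fun q : ℝ × E => v q.1 q.2))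
    (hlip : ∀ t z w, ‖v t z - v t w‖ ≤ K * ‖z - w‖) (hV : ∀ t, ‖v t 0‖ ≤ V) (z₀ : E) :
    ∃ γ : ℝ → E, γ 0 = z₀ ∧ ∀ t, HasDerivAt γ (v t (γ t)) t := by
  set l : ℝ := 2 * K + 1 with hl
  have hl0 : 0 < l := by positivity
  have hco : Continuous fun s : ℝ => Real.cosh (l * s) := by fun_prop
  have hcp : ∀ s : ℝ, 0 < Real.cosh (l * s) := fun s => Real.cosh_pos _
  have hc1 : ∀ s : ℝ, 1 ≤ Real.cosh (l * s) := fun s => Real.one_le_cosh _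
  have hic : Continuous fun s : ℝ => (Real.cosh (l * s))⁻¹ := hco.inv₀ fun s => (hcp s).ne'
  have hcont : ∀ y : BoundedContinuousFunction ℝ E,
      Continuous fun s => v s (Real.cosh (l * s) • y s) := fun y =>
    hv.comp (continuous_id.prodMk (hco.smul y.continuous))
  have hV0 : 0 ≤ V := (norm_nonneg _).trans (hV 0)
  have hbd : ∀ (y : BoundedContinuousFunction ℝ E) s,
      ‖v s (Real.cosh (l * s) • y s)‖ ≤ (V + K * ‖y‖) * Real.cosh (l * s) := by
    intro y s
    have h1 := hlip s (Real.cosh (l * s) • y s) 0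
    have h2 : ‖v s (Real.cosh (l * s) • y s)‖ ≤ ‖v s (Real.cosh (l * s) • y s) - v s 0‖ + ‖v s 0‖ := by
      simpa using norm_add_le (v s (Real.cosh (l * s) • y s) - v s 0) (v s 0)
    rw [sub_zero, norm_smul, Real.norm_of_nonneg (hcp s).le] at h1
    have h3 : ‖y s‖ ≤ ‖y‖ := y.norm_coe_le_norm s
    have h4 : K * (Real.cosh (l * s) * ‖y s‖) ≤ K * (Real.cosh (l * s) * ‖y‖) := by
      have := hcp s
      gcongr
    have h5 := hV s
    have h6 : V ≤ V * Real.cosh (l * s) := le_mul_of_one_le_right hV0 (hc1 s)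
    nlinarith
  let T : BoundedContinuousFunction ℝ E → BoundedContinuousFunction ℝ E := fun y =>
    BoundedContinuousFunction.ofNormedAddCommGroup
      (fun t => (Real.cosh (l * t))⁻¹ • (z₀ + ∫ s in (0:ℝ)..t, v s (Real.cosh (l * s) • y s)))
      (hic.smul (continuous_const.add
        (intervalIntegral.continuous_primitive (fun a b => (hcont y).intervalIntegrable a b) 0)))
      (‖z₀‖ + (V + K * ‖y‖) / l) (by
        intro t
        have h1 := norm_integral_le_cosh hl0 (hbd y) t
        rw [norm_smul, norm_inv, Real.norm_of_nonneg (hcp t).le, inv_mul_le_iff₀ (hcp t)]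
        have h2 := norm_add_le z₀ (∫ s in (0:ℝ)..t, v s (Real.cosh (l * s) • y s))
        have h3 : ‖z₀‖ ≤ Real.cosh (l * t) * ‖z₀‖ := le_mul_of_one_le_left (norm_nonneg _) (hc1 t)
        nlinarith)
  have hT : ∀ y t, T y t = (Real.cosh (l * t))⁻¹ •
      (z₀ + ∫ s in (0:ℝ)..t, v s (Real.cosh (l * s) • y s)) := fun _ _ => rfl
  have hcontr : ContractingWith (Real.toNNReal (K / l)) T := by
    refine ⟨?_, LipschitzWith.of_dist_le_mul fun y y' => ?_⟩
    · rw [← NNReal.coe_lt_coe, Real.coe_toNNReal _ (by positivity), NNReal.coe_one,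
        div_lt_one hl0]
      linarith
    · rw [Real.coe_toNNReal _ (by positivity), dist_eq_norm, dist_eq_norm,
        BoundedContinuousFunction.norm_le (by positivity)]
      intro t
      rw [BoundedContinuousFunction.sub_apply, hT, hT, ← smul_sub, add_sub_add_left_eq_sub,
        ← intervalIntegral.integral_sub ((hcont y).intervalIntegrable _ _)
          ((hcont y').intervalIntegrable _ _), norm_smul, norm_inv,
        Real.norm_of_nonneg (hcp t).le, inv_mul_le_iff₀ (hcp t)]
      have h1 := norm_integral_le_cosh (E := E) (M := K * ‖y - y'‖)
        (f := fun s => v s (Real.cosh (l * s) • y s) - v s (Real.cosh (l * s) • y' s)) hl0 (by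
        intro s
        refine (hlip s _ _).trans ?_
        rw [← smul_sub, norm_smul, Real.norm_of_nonneg (hcp s).le]
        have h3 : ‖y s - y' s‖ ≤ ‖y - y'‖ := (y - y').norm_coe_le_norm s
        have := hcp s
        calc K * (Real.cosh (l * s) * ‖y s - y' s‖) ≤ K * (Real.cosh (l * s) * ‖y - y'‖) := by gcongr
          _ = _ := by ring) t
      calc _ ≤ _ := h1
        _ = _ := by ring
  obtain ⟨y, hy⟩ : ∃ y, T y = y := ⟨_, hcontr.fixedPoint_isFixedPt⟩
  have hyt : ∀ t, Real.cosh (l * t) • y t = z₀ + ∫ s in (0:ℝ)..t, v s (Real.cosh (l * s) • y s) := by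
    intro t
    conv_lhs => rw [← hy, hT]
    rw [smul_inv_smul₀ (hcp t).ne']
  refine ⟨fun t => Real.cosh (l * t) • y t, by simpa using hyt 0, fun t => ?_⟩
  have h1 := ((hcont y).integral_hasStrictDerivAt 0 t).hasDerivAt.const_add z₀
  exact h1.congr_of_eventuallyEq (Eventually.of_forall hyt)

theorem exists_global_solution {v : ℝ → E → E} {K V : ℝ} (hK : 0 ≤ K)
    (hv : Continuous (fun q : ℝ × E => v q.1 q.2))
    (hlip : ∀ t z w, ‖v t z - v t w‖ ≤ K * ‖z - w‖) (hV : ∀ t, ‖v t 0‖ ≤ V) (t₀ : ℝ) (z₀ : E) :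
    ∃ γ : ℝ → E, γ t₀ = z₀ ∧ ∀ t, HasDerivAt γ (v t (γ t)) t := by
  obtain ⟨γ, h0, h1⟩ := exists_global_solution_zero (v := fun t => v (t + t₀)) hK
    (hv.comp ((continuous_fst.add continuous_const).prodMk continuous_snd))
    (fun t => hlip _) (fun t => hV _) z₀
  refine ⟨fun t => γ (t - t₀), by simpa using h0, fun t => ?_⟩
  have := (h1 (t - t₀)).comp_sub_const t t₀
  simpa using this

end GlobalODE

theorem abs_image_sub_sub_mul_le {f f' : ℝ → ℝ} {x y A B : ℝ} (hf : ∀ z, HasDerivAt f (f' z) z)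
    (h : ∀ z ∈ uIcc x y, |f' z - A| ≤ B) : |f y - f x - A * (y - x)| ≤ B * |y - x| := by
  have := (convex_uIcc x y).norm_image_sub_le_of_norm_hasDerivWithin_le (f := fun z => f z - A * z)
    (f' := fun z => f' z - A) (C := B) (x := x) (y := y)
    (fun z _ => by
      have := (hf z).fun_sub ((hasDerivAt_id z).const_mul A)
      simpa using this.hasDerivWithinAt)
    (fun z hz => h z hz) left_mem_uIcc right_mem_uIcc
  simp only [Real.norm_eq_abs] at this
  convert this using 2
  ring

/-- A Hamiltonian on `ℝ × ℝ × ℝ`, periodic in time and position, with Lipschitz gradient,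
uniformly convex in the momentum, together with the constants which control its minimizing orbits
for cohomology classes in `[-K, K]`. -/
structure TameHam where
  G : ℝ → ℝ → ℝ → ℝ
  Gx : ℝ → ℝ → ℝ → ℝ
  Gp : ℝ → ℝ → ℝ → ℝ
  C : ℝ
  m : ℝ
  K : ℝ
  C₀ : ℝ
  C₁ : ℝ
  R₁ : ℝ
  one_le_C : 1 ≤ C
  m_pos : 0 < m
  hasDerivAt_x : ∀ t x p, HasDerivAt (fun y => G t y p) (Gx t x p) x
  hasDerivAt_p : ∀ t x p, HasDerivAt (fun q => G t x q) (Gp t x p) p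
  cont_G : Continuous fun q : ℝ × ℝ × ℝ => G q.1 q.2.1 q.2.2
  cont_Gx : Continuous fun q : ℝ × ℝ × ℝ => Gx q.1 q.2.1 q.2.2
  cont_Gp : Continuous fun q : ℝ × ℝ × ℝ => Gp q.1 q.2.1 q.2.2
  lip_x : ∀ t x y p q, |Gx t y q - Gx t x p| ≤ C * (|y - x| + |q - p|)
  lip_p : ∀ t x y p q, |Gp t y q - Gp t x p| ≤ C * (|y - x| + |q - p|)
  mono : ∀ t x p q, p ≤ q → m * (q - p) ≤ Gp t x q - Gp t x p
  per_t : ∀ t x p, G (t + 1) x p = G t x p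
  per_x : ∀ t x p, G t (x + 1) p = G t x p
  K_nonneg : 0 ≤ K
  C₀_nonneg : 0 ≤ C₀
  C₁_nonneg : 0 ≤ C₁
  mul_sub_le : ∀ v, |v| ≤ 1 → ∀ t x q, q * v - G t x q ≤ C₀
  G_le : ∀ e, |e| ≤ K + 1 → ∀ t x, G t x e ≤ C₁
  snd_le : ∀ γ : ℝ → ℝ × ℝ,
    (∀ t, HasDerivAt γ (Gp t (γ t).1 (γ t).2, -Gx t (γ t).1 (γ t).2) t) →
    ∀ t, |Gp t (γ t).1 (γ t).2| ≤ C₀ + C₁ + K → ∀ s ∈ Icc t (t + 1), |(γ s).2| ≤ R₁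

namespace TameHam

variable (h : TameHam)

theorem C_pos : 0 < h.C := zero_lt_one.trans_le h.one_le_C

/-- The Hamiltonian vector field. -/
def VF (t : ℝ) (z : ℝ × ℝ) : ℝ × ℝ := (h.Gp t z.1 z.2, -h.Gx t z.1 z.2)

/-- Globally defined solutions of the Hamiltonian equations. -/
def IsOrbit (γ : ℝ → ℝ × ℝ) : Prop := ∀ t, HasDerivAt γ (h.VF t (γ t)) t

/-- The Lagrangian density `p ẋ - G` of the action. -/
def dens (t : ℝ) (z : ℝ × ℝ) : ℝ := z.2 * h.Gp t z.1 z.2 - h.G t z.1 z.2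

/-- The action of a curve in phase space. -/
noncomputable def act (γ : ℝ → ℝ × ℝ) (s t : ℝ) : ℝ := ∫ r in s..t, h.dens r (γ r)

theorem Gx_add_one_t (t x p : ℝ) : h.Gx (t + 1) x p = h.Gx t x p := by
  have h1 := h.hasDerivAt_x (t + 1) x p
  simp only [h.per_t] at h1
  exact h1.unique (h.hasDerivAt_x t x p)

theorem Gp_add_one_t (t x p : ℝ) : h.Gp (t + 1) x p = h.Gp t x p := by
  have h1 := h.hasDerivAt_p (t + 1) x p
  simp only [h.per_t] at h1
  exact h1.unique (h.hasDerivAt_p t x p)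

theorem Gx_add_one_x (t x p : ℝ) : h.Gx t (x + 1) p = h.Gx t x p := by
  have h1 := (h.hasDerivAt_x t (x + 1) p).comp_add_const x 1
  simp only [h.per_x] at h1
  exact h1.unique (h.hasDerivAt_x t x p)

theorem Gp_add_one_x (t x p : ℝ) : h.Gp t (x + 1) p = h.Gp t x p := by
  have h1 := h.hasDerivAt_p t (x + 1) p
  simp only [h.per_x] at h1
  exact h1.unique (h.hasDerivAt_p t x p)

theorem per_int {f : ℝ → ℝ} (hf : ∀ x, f (x + 1) = f x) (k : ℤ) (x : ℝ) : f (x + k) = f x := by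
  have : Function.Periodic f 1 := hf
  simpa using this.int_mul k x

theorem VF_add_int (k l : ℤ) (t : ℝ) (z : ℝ × ℝ) :
    h.VF (t + k) (z.1 + l, z.2) = h.VF t z := by
  have h1 := per_int (f := fun s => h.Gp s (z.1 + l) z.2) (fun s => h.Gp_add_one_t _ _ _) k t
  have h2 := per_int (f := fun s => h.Gp t s z.2) (fun s => h.Gp_add_one_x _ _ _) l z.1
  have h3 := per_int (f := fun s => h.Gx s (z.1 + l) z.2) (fun s => h.Gx_add_one_t _ _ _) k t
  have h4 := per_int (f := fun s => h.Gx t s z.2) (fun s => h.Gx_add_one_x _ _ _) l z.1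
  simp only [VF, h1, h2, h3, h4]

theorem dens_add_int (k l : ℤ) (t : ℝ) (z : ℝ × ℝ) :
    h.dens (t + k) (z.1 + l, z.2) = h.dens t z := by
  have h0 := congrArg Prod.fst (h.VF_add_int k l t z)
  have h1 := per_int (f := fun s => h.G s (z.1 + l) z.2) (fun s => h.per_t _ _ _) k t
  have h2 := per_int (f := fun s => h.G t s z.2) (fun s => h.per_x _ _ _) l z.1
  simp only [VF] at h0 h1 h2
  simp only [dens, h0, h1, h2]

theorem continuous_VF : Continuous fun q : ℝ × ℝ × ℝ => h.VF q.1 q.2 :=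
  h.cont_Gp.prodMk h.cont_Gx.neg

theorem continuous_dens : Continuous fun q : ℝ × ℝ × ℝ => h.dens q.1 q.2 :=
  ((continuous_snd.comp continuous_snd).mul h.cont_Gp).sub h.cont_G

theorem VF_lip (t : ℝ) (z w : ℝ × ℝ) : ‖h.VF t z - h.VF t w‖ ≤ 2 * h.C * ‖z - w‖ := by
  have h1 := h.lip_p t w.1 z.1 w.2 z.2
  have h2 := h.lip_x t w.1 z.1 w.2 z.2
  have h3 : |z.1 - w.1| ≤ ‖z - w‖ := norm_fst_le (z - w)
  have h4 : |z.2 - w.2| ≤ ‖z - w‖ := norm_snd_le (z - w)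
  have h5 : h.C * (|z.1 - w.1| + |z.2 - w.2|) ≤ 2 * h.C * ‖z - w‖ := by
    have := h.C_pos
    nlinarith
  rw [Prod.norm_def, max_le_iff]
  constructor
  · exact h1.trans h5
  · rw [Real.norm_eq_abs]
    simp only [VF, Prod.snd_sub]
    rw [neg_sub_neg, abs_sub_comm]
    exact h2.trans h5

/-- A continuous function, periodic in time and position, is bounded on sets of bounded momentum. -/
theorem exists_bound_of_periodic {f : ℝ × ℝ × ℝ → ℝ} (hf : Continuous f)
    (ht : ∀ t x p, f (t + 1, x, p) = f (t, x, p)) (hx : ∀ t x p, f (t, x + 1, p) = f (t, x, p))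
    (R : ℝ) : ∃ B, ∀ t x p, |p| ≤ R → |f (t, x, p)| ≤ B := by
  obtain ⟨B, hB⟩ := (isCompact_Icc (a := (0:ℝ)) (b := 1)).prod
    ((isCompact_Icc (a := (0:ℝ)) (b := 1)).prod (isCompact_Icc (a := -R) (b := R)))
    |>.exists_bound_of_continuousOn hf.continuousOn
  refine ⟨B, fun t x p hp => ?_⟩
  have h1 := per_int (f := fun s => f (s, x, p)) (fun s => ht _ _ _) (-⌊t⌋) t
  have h2 := per_int (f := fun s => f (t + (-⌊t⌋ : ℤ), s, p)) (fun s => hx _ _ _) (-⌊x⌋) x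
  rw [← h1, ← h2]
  refine hB _ ⟨⟨?_, ?_⟩, ⟨?_, ?_⟩, abs_le.mp hp⟩ <;> push_cast
  · linarith [Int.floor_le t]
  · linarith [Int.lt_floor_add_one t]
  · linarith [Int.floor_le x]
  · linarith [Int.lt_floor_add_one x]

theorem exists_orbit (t₀ : ℝ) (z₀ : ℝ × ℝ) : ∃ γ, h.IsOrbit γ ∧ γ t₀ = z₀ := by
  obtain ⟨B, hB⟩ := exists_bound_of_periodic h.cont_Gp
    (fun t x p => h.Gp_add_one_t t x p) (fun t x p => h.Gp_add_one_x t x p) 0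
  obtain ⟨B', hB'⟩ := exists_bound_of_periodic h.cont_Gx
    (fun t x p => h.Gx_add_one_t t x p) (fun t x p => h.Gx_add_one_x t x p) 0
  obtain ⟨γ, h1, h2⟩ := exists_global_solution (v := h.VF) (K := 2 * h.C) (V := max B B')
    (by linarith [h.C_pos]) h.continuous_VF h.VF_lip (fun t => by
      rw [Prod.norm_def]
      refine max_le_max (hB t 0 0 (by simp)) ?_
      have := hB' t 0 0 (by simp)
      simpa [VF] using this) t₀ z₀
  exact ⟨γ, h2, h1⟩

variable {h}

theorem IsOrbit.norm_sub_le {γ η : ℝ → ℝ × ℝ} (hγ : h.IsOrbit γ) (hη : h.IsOrbit η) (s t : ℝ) :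
    ‖γ t - η t‖ ≤ ‖γ s - η s‖ * Real.exp (2 * h.C * |t - s|) :=
  dist_solutions_le (by linarith [h.C_pos]) h.VF_lip hγ hη s t

theorem IsOrbit.eq {γ η : ℝ → ℝ × ℝ} (hγ : h.IsOrbit γ) (hη : h.IsOrbit η) {s : ℝ}
    (hs : γ s = η s) : γ = η := by
  funext t
  have := hγ.norm_sub_le hη s t
  rw [hs, sub_self, norm_zero, zero_mul] at this
  exact sub_eq_zero.mp (norm_le_zero_iff.mp this)

theorem IsOrbit.continuous {γ : ℝ → ℝ × ℝ} (hγ : h.IsOrbit γ) : Continuous γ :=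
  continuous_iff_continuousAt.mpr fun t => (hγ t).continuousAt

theorem IsOrbit.hasDerivAt_fst {γ : ℝ → ℝ × ℝ} (hγ : h.IsOrbit γ) (t : ℝ) :
    HasDerivAt (fun r => (γ r).1) (h.Gp t (γ t).1 (γ t).2) t :=
  (hasFDerivAt_fst (𝕜 := ℝ) (p := γ t)).comp_hasDerivAt t (hγ t)

theorem IsOrbit.hasDerivAt_snd {γ : ℝ → ℝ × ℝ} (hγ : h.IsOrbit γ) (t : ℝ) :
    HasDerivAt (fun r => (γ r).2) (-h.Gx t (γ t).1 (γ t).2) t :=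
  (hasFDerivAt_snd (𝕜 := ℝ) (p := γ t)).comp_hasDerivAt t (hγ t)

theorem IsOrbit.shift {γ : ℝ → ℝ × ℝ} (hγ : h.IsOrbit γ) (k l : ℤ) :
    h.IsOrbit fun t => ((γ (t + k)).1 + l, (γ (t + k)).2) := by
  intro t
  have h1 := (hγ.hasDerivAt_fst (t + k)).comp_add_const t (k : ℝ)
  have h2 := (hγ.hasDerivAt_snd (t + k)).comp_add_const t (k : ℝ)
  have := (h1.add_const (l : ℝ)).prodMk h2
  convert this using 1
  have h3 := h.VF_add_int (-k) l (t + k) (γ (t + k))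
  simp only [Int.cast_neg, add_neg_cancel_right] at h3
  rw [h3]; rfl

theorem IsOrbit.continuous_dens {γ : ℝ → ℝ × ℝ} (hγ : h.IsOrbit γ) :
    Continuous fun r => h.dens r (γ r) :=
  h.continuous_dens.comp (continuous_id.prodMk hγ.continuous)

theorem IsOrbit.act_add {γ : ℝ → ℝ × ℝ} (hγ : h.IsOrbit γ) (r s t : ℝ) :
    h.act γ r s + h.act γ s t = h.act γ r t :=
  intervalIntegral.integral_add_adjacent_intervals
    (hγ.continuous_dens.intervalIntegrable _ _) (hγ.continuous_dens.intervalIntegrable _ _)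

@[simp] theorem act_self (γ : ℝ → ℝ × ℝ) (s : ℝ) : h.act γ s s = 0 :=
  intervalIntegral.integral_same

theorem act_shift (γ : ℝ → ℝ × ℝ) (k l : ℤ) (s t : ℝ) :
    h.act (fun t => ((γ (t + k)).1 + l, (γ (t + k)).2)) s t = h.act γ (s + k) (t + k) := by
  unfold act
  rw [← intervalIntegral.integral_comp_add_right]
  refine intervalIntegral.integral_congr fun r _ => ?_
  have h3 := h.dens_add_int (-k) l (r + k) (γ (r + k))
  simpa only [Int.cast_neg, add_neg_cancel_right] using h3

theorem IsOrbit.hasDerivAt_act {γ : ℝ → ℝ × ℝ} (hγ : h.IsOrbit γ) (s t : ℝ) :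
    HasDerivAt (fun r => h.act γ s r) (h.dens t (γ t)) t :=
  (hγ.continuous_dens.integral_hasStrictDerivAt s t).hasDerivAt

variable (h)

theorem taylor_le (t x p δ η : ℝ) : h.G t (x + δ) (p + η) ≤
    h.G t x p + h.Gx t x p * δ + h.Gp t x p * η + 2 * h.C * (δ ^ 2 + η ^ 2) := by
  have h1 := abs_image_sub_sub_mul_le (f := fun y => h.G t y (p + η))
    (f' := fun y => h.Gx t y (p + η)) (x := x) (y := x + δ) (A := h.Gx t x p)
    (B := h.C * (|δ| + |η|)) (fun z => h.hasDerivAt_x t z (p + η)) (fun z hz => by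
      refine (h.lip_x t x z p (p + η)).trans ?_
      have := abs_sub_left_of_mem_uIcc hz
      rw [add_sub_cancel_left] at this ⊢
      have := h.C_pos
      gcongr)
  have h2 := abs_image_sub_sub_mul_le (f := fun q => h.G t x q)
    (f' := fun q => h.Gp t x q) (x := p) (y := p + η) (A := h.Gp t x p)
    (B := h.C * |η|) (fun z => h.hasDerivAt_p t x z) (fun z hz => by
      refine (h.lip_p t x x p z).trans ?_
      have := abs_sub_left_of_mem_uIcc hz
      rw [add_sub_cancel_left] at this
      have := h.C_pos
      simp only [sub_self, abs_zero, zero_add]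
      gcongr)
  simp only [add_sub_cancel_left] at h1 h2
  have h3 := (le_abs_self _).trans h1
  have h4 := (le_abs_self _).trans h2
  have h5 : (|δ| + |η|) * |δ| + |η| * |η| ≤ 2 * (δ ^ 2 + η ^ 2) := by
    rw [← sq_abs δ, ← sq_abs η]
    nlinarith [sq_nonneg (|δ| - |η|), sq_nonneg |δ|, sq_nonneg |η|]
  have h6 := mul_le_mul_of_nonneg_left h5 h.C_pos.le
  linarith

theorem convex_le (t x p q : ℝ) : h.G t x p + h.Gp t x p * (q - p) ≤ h.G t x q := by
  rcases lt_trichotomy p q with hpq | rfl | hpq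
  · obtain ⟨z, hz, h1⟩ := exists_hasDerivAt_eq_slope (fun q => h.G t x q) (fun q => h.Gp t x q) hpq
      (fun z _ => (h.hasDerivAt_p t x z).continuousAt.continuousWithinAt)
      (fun z _ => h.hasDerivAt_p t x z)
    rw [eq_div_iff (by linarith)] at h1
    have h2 := h.mono t x p z hz.1.le
    have h3 : 0 ≤ h.m * (z - p) := mul_nonneg h.m_pos.le (by linarith [hz.1])
    nlinarith
  · simp
  · obtain ⟨z, hz, h1⟩ := exists_hasDerivAt_eq_slope (fun q => h.G t x q) (fun q => h.Gp t x q) hpq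
      (fun z _ => (h.hasDerivAt_p t x z).continuousAt.continuousWithinAt)
      (fun z _ => h.hasDerivAt_p t x z)
    rw [eq_div_iff (by linarith)] at h1
    have h2 := h.mono t x z p hz.2.le
    have h3 : 0 ≤ h.m * (p - z) := mul_nonneg h.m_pos.le (by linarith [hz.2])
    nlinarith

theorem dens_ge (e t : ℝ) (z : ℝ × ℝ) :
    e * h.Gp t z.1 z.2 - h.G t z.1 e ≤ h.dens t z := by
  have := h.convex_le t z.1 z.2 e
  unfold dens
  nlinarith

end TameHam

theorem le_of_hasDerivAt_nonneg {F F' : ℝ → ℝ} {a b : ℝ} (hab : a ≤ b)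
    (hF : ∀ t, HasDerivAt F (F' t) t) (h : ∀ t ∈ Icc a b, 0 ≤ F' t) : F a ≤ F b := by
  have : MonotoneOn F (Icc a b) := monotoneOn_of_deriv_nonneg (convex_Icc a b)
    (fun t _ => (hF t).continuousAt.continuousWithinAt)
    (fun t _ => (hF t).differentiableAt.differentiableWithinAt)
    (fun t ht => by rw [(hF t).deriv]; exact h t (interior_subset ht))
  exact this (left_mem_Icc.mpr hab) (right_mem_Icc.mpr hab) hab

namespace TameHam

variable {h : TameHam}

/-- Verification inequality: over short times the action of an orbit is minimal, with quantitative
correction terms at the endpoints. -/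
theorem IsOrbit.verification {γ : ℝ → ℝ × ℝ} (hγ : h.IsOrbit γ) {y y' l : ℝ → ℝ} {a b T : ℝ}
    (hab : a ≤ b) (hbT : b ≤ T) (hT : 10 * h.C * (T - a) ≤ 1) (hy : ∀ t, HasDerivAt y (y' t) t)
    (hl : Continuous l) (hyl : ∀ t ∈ Icc a b, ∀ q, q * y' t - h.G t (y t) q ≤ l t) :
    h.act γ a b + ((γ b).2 * (y b - (γ b).1) - (γ a).2 * (y a - (γ a).1))
      + (5 * h.C * (T - b) * (y b - (γ b).1) ^ 2 - 5 * h.C * (T - a) * (y a - (γ a).1) ^ 2)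
      + h.C * ∫ t in a..b, (y t - (γ t).1) ^ 2 ≤ ∫ t in a..b, l t := by
  have hC := h.C_pos
  have hyc : Continuous y := continuous_iff_continuousAt.mpr fun t => (hy t).continuousAt
  have hdc : Continuous fun t => (y t - (γ t).1) ^ 2 :=
    (hyc.sub (continuous_fst.comp hγ.continuous)).pow 2
  have hd : ∀ t, HasDerivAt (fun t => y t - (γ t).1) (y' t - h.Gp t (γ t).1 (γ t).2) t :=
    fun t => (hy t).fun_sub (hγ.hasDerivAt_fst t)
  have hF := fun t => ((((hl.integral_hasStrictDerivAt a t).hasDerivAt.fun_sub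
    (hγ.hasDerivAt_act a t)).fun_sub ((hγ.hasDerivAt_snd t).fun_mul (hd t))).fun_sub
    ((((hasDerivAt_id t).const_sub T).const_mul (5 * h.C)).fun_mul ((hd t).fun_pow 2))).fun_sub
    ((hdc.integral_hasStrictDerivAt a t).hasDerivAt.const_mul h.C)
  have key := le_of_hasDerivAt_nonneg hab hF (fun t ht => by
    simp only [id]
    set δ := y t - (γ t).1 with hδ
    set θ := 10 * h.C * (T - t) with hθ
    have hθ0 : 0 ≤ θ := by
      have : 0 ≤ T - t := by linarith [ht.2]
      positivity
    have hθ1 : θ ≤ 1 := by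
      refine le_trans ?_ hT
      have := ht.1
      rw [hθ]; gcongr
    have h1 := hyl t ht ((γ t).2 + θ * δ)
    have h2 := h.taylor_le t (γ t).1 (γ t).2 δ (θ * δ)
    rw [show (γ t).1 + δ = y t by rw [hδ]; ring] at h2
    have h3 : θ ^ 2 * δ ^ 2 ≤ δ ^ 2 := by
      have : θ ^ 2 ≤ 1 := by nlinarith
      nlinarith [sq_nonneg δ]
    have h4 : h.C * (θ ^ 2 * δ ^ 2) ≤ h.C * δ ^ 2 := mul_le_mul_of_nonneg_left h3 hC.le
    have h5 : 5 * h.C * (T - t) = θ / 2 := by rw [hθ]; ring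
    simp only [dens]
    rw [h5]
    norm_num
    nlinarith)
  simp only [id, intervalIntegral.integral_same, act_self] at key
  linarith

/-- A time scale on which orbits are minimizing and any two positions are joined by an orbit. -/
noncomputable def τ (h : TameHam) : ℝ := min (1 / (10 * h.C)) (h.m / (16 * h.C ^ 2))

theorem τ_pos (h : TameHam) : 0 < h.τ := by
  have := h.C_pos
  have := h.m_pos
  unfold τ
  positivity

theorem τ_le_one (h : TameHam) : 10 * h.C * h.τ ≤ 1 := by
  have := h.C_pos
  have h1 : h.τ ≤ 1 / (10 * h.C) := min_le_left _ _
  calc 10 * h.C * h.τ ≤ 10 * h.C * (1 / (10 * h.C)) := by gcongr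
    _ = 1 := by field_simp

theorem τ_le_m (h : TameHam) : 16 * h.C ^ 2 * h.τ ≤ h.m := by
  have := h.C_pos
  have h1 : h.τ ≤ h.m / (16 * h.C ^ 2) := min_le_right _ _
  calc 16 * h.C ^ 2 * h.τ ≤ 16 * h.C ^ 2 * (h.m / (16 * h.C ^ 2)) := by gcongr
    _ = h.m := by field_simp

theorem IsOrbit.joining_aux {γ η : ℝ → ℝ × ℝ} (hγ : h.IsOrbit γ) (hη : h.IsOrbit η) {s t : ℝ}
    (hst : s ≤ t) (ht : t ≤ s + h.τ) (hs : (γ s).1 = (η s).1) (hp : (γ s).2 ≤ (η s).2) :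
    h.m / 4 * (t - s) * ((η s).2 - (γ s).2) ≤ (η t).1 - (γ t).1 ∧
      ‖η t - γ t‖ ≤ 2 * ((η s).2 - (γ s).2) := by
  have hC := h.C_pos
  have hm := h.m_pos
  set e := (η s).2 - (γ s).2 with he
  have he0 : 0 ≤ e := by linarith
  have hns : ‖η s - γ s‖ = e := by
    rw [Prod.norm_def]
    simp [hs, ← he, he0, abs_of_nonneg he0]
  have hb : ∀ r ∈ Icc s t, ‖η r - γ r‖ ≤ 2 * e := by
    intro r hr
    have h1 := hη.norm_sub_le hγ s r
    rw [hns, abs_of_nonneg (by linarith [hr.1])] at h1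
    refine h1.trans ?_
    have h2 : 2 * h.C * (r - s) ≤ 1 / 5 := by
      have : 2 * h.C * (r - s) ≤ 2 * h.C * h.τ := by
        have := hr.2
        gcongr
        linarith
      linarith [h.τ_le_one]
    have h3 : Real.exp (2 * h.C * (r - s)) ≤ 2 := by
      refine (Real.exp_le_exp.mpr h2).trans ?_
      have := Real.exp_one_lt_d9
      have h4 : Real.exp (1 / 5) ^ 5 < 2 ^ 5 := by
        rw [← Real.exp_nat_mul]; norm_num; linarith
      exact (lt_of_pow_lt_pow_left₀ 5 (by norm_num) h4).le
    nlinarith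
  have hb1 : ∀ r ∈ Icc s t, |(η r).1 - (γ r).1| ≤ 2 * e := fun r hr =>
    (norm_fst_le (η r - γ r)).trans (hb r hr)
  have hb2 : ∀ r ∈ Icc s t, |(η r).2 - (γ r).2| ≤ 2 * e := fun r hr =>
    (norm_snd_le (η r - γ r)).trans (hb r hr)
  have hp' : ∀ r ∈ Icc s t, e / 2 ≤ (η r).2 - (γ r).2 := by
    intro r hr
    have h1 := le_of_hasDerivAt_nonneg (F := fun r => (η r).2 - (γ r).2 + 4 * h.C * e * r) hr.1
      (fun r => ((hη.hasDerivAt_snd r).fun_sub (hγ.hasDerivAt_snd r)).fun_add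
        ((hasDerivAt_id r).const_mul (4 * h.C * e))) (fun q hq => by
        have hq' : q ∈ Icc s t := ⟨hq.1, hq.2.trans hr.2⟩
        have h2 := (abs_le.mp (h.lip_x q (γ q).1 (η q).1 (γ q).2 (η q).2)).2
        have h3 : h.C * (|(η q).1 - (γ q).1| + |(η q).2 - (γ q).2|) ≤ h.C * (4 * e) := by
          have := hb1 q hq'
          have := hb2 q hq'
          gcongr
          linarith
        linarith)
    simp only [← he] at h1
    have h4 : 4 * h.C * (r - s) ≤ 4 * h.C * h.τ := by
      have := hr.2
      gcongr
      linarith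
    have h5 := h.τ_le_one
    nlinarith
  refine ⟨?_, hb t ⟨hst, le_rfl⟩⟩
  have hx : ∀ r ∈ Icc s t, |(η r).1 - (γ r).1| ≤ 4 * h.C * e * (r - s) := by
    intro r hr
    have h1 := (convex_Icc s r).norm_image_sub_le_of_norm_hasDerivWithin_le
      (f := fun q => (η q).1 - (γ q).1) (C := 4 * h.C * e) (x := s) (y := r)
      (fun q _ => ((hη.hasDerivAt_fst q).fun_sub (hγ.hasDerivAt_fst q)).hasDerivWithinAt)
      (fun q hq => by
        have hq' : q ∈ Icc s t := ⟨hq.1, hq.2.trans hr.2⟩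
        refine (h.lip_p q (γ q).1 (η q).1 (γ q).2 (η q).2).trans ?_
        have := hb1 q hq'
        have := hb2 q hq'
        have : h.C * (|(η q).1 - (γ q).1| + |(η q).2 - (γ q).2|) ≤ h.C * (4 * e) := by
          gcongr
          linarith
        linarith) ⟨le_rfl, hr.1⟩ ⟨hr.1, le_rfl⟩
    simp only [hs, sub_self, sub_zero, Real.norm_eq_abs] at h1
    rwa [abs_of_nonneg (by linarith [hr.1] : 0 ≤ r - s)] at h1
  have h1 := le_of_hasDerivAt_nonneg (F := fun r => (η r).1 - (γ r).1 - h.m / 4 * e * r) hst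
    (fun r => ((hη.hasDerivAt_fst r).fun_sub (hγ.hasDerivAt_fst r)).fun_sub
      ((hasDerivAt_id r).const_mul (h.m / 4 * e))) (fun q hq => by
      have h2 := h.mono q (η q).1 (γ q).2 (η q).2 (by linarith [hp' q hq])
      have h3 := (abs_le.mp (h.lip_p q (γ q).1 (η q).1 (γ q).2 (γ q).2)).1
      simp only [sub_self, abs_zero, add_zero] at h3
      have h4 := hx q hq
      have h5 : h.C * |(η q).1 - (γ q).1| ≤ h.C * (4 * h.C * e * h.τ) := by
        have : q - s ≤ h.τ := by linarith [hq.2]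
        have : 4 * h.C * e * (q - s) ≤ 4 * h.C * e * h.τ := by gcongr
        gcongr
        linarith
      have h6 : h.m * (e / 2) ≤ h.m * ((η q).2 - (γ q).2) := by
        have := hp' q hq
        gcongr
      have h7 := mul_le_mul_of_nonneg_right h.τ_le_m he0
      linarith)
  simp only [hs, sub_self, zero_sub] at h1
  linarith

theorem IsOrbit.joining {γ η : ℝ → ℝ × ℝ} (hγ : h.IsOrbit γ) (hη : h.IsOrbit η) {s t : ℝ}
    (hst : s ≤ t) (ht : t ≤ s + h.τ) (hs : (γ s).1 = (η s).1) :
    h.m / 4 * (t - s) * |(η s).2 - (γ s).2| ≤ |(η t).1 - (γ t).1| ∧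
      ‖η t - γ t‖ ≤ 2 * |(η s).2 - (γ s).2| := by
  rcases le_total (γ s).2 (η s).2 with hp | hp
  · obtain ⟨h1, h2⟩ := hγ.joining_aux hη hst ht hs hp
    rw [abs_of_nonneg (by linarith)]
    exact ⟨h1.trans (le_abs_self _), h2⟩
  · obtain ⟨h1, h2⟩ := hη.joining_aux hγ hst ht hs.symm hp
    rw [abs_sub_comm (η s).2, abs_sub_comm (η t).1, norm_sub_rev, abs_of_nonneg (by linarith)]
    exact ⟨h1.trans (le_abs_self _), h2⟩

/-- The orbit with prescribed value at a given time. -/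
noncomputable def flow (h : TameHam) (s : ℝ) (z : ℝ × ℝ) : ℝ → ℝ × ℝ := (h.exists_orbit s z).choose

theorem flow_isOrbit (s : ℝ) (z : ℝ × ℝ) : h.IsOrbit (h.flow s z) :=
  (h.exists_orbit s z).choose_spec.1

@[simp] theorem flow_self (s : ℝ) (z : ℝ × ℝ) : h.flow s z s = z :=
  (h.exists_orbit s z).choose_spec.2

theorem IsOrbit.eq_flow {γ : ℝ → ℝ × ℝ} (hγ : h.IsOrbit γ) (s : ℝ) : h.flow s (γ s) = γ :=
  (flow_isOrbit s _).eq hγ (s := s) (by simp)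

theorem continuous_flow (s : ℝ) : Continuous fun q : (ℝ × ℝ) × ℝ => h.flow s q.1 q.2 := by
  rw [continuous_iff_continuousAt]
  rintro ⟨z, t⟩
  rw [ContinuousAt, tendsto_iff_norm_sub_tendsto_zero]
  have h1 : ∀ q : (ℝ × ℝ) × ℝ, ‖h.flow s q.1 q.2 - h.flow s z t‖ ≤
      ‖q.1 - z‖ * Real.exp (2 * h.C * |q.2 - s|) + ‖h.flow s z q.2 - h.flow s z t‖ := by
    intro q
    have := (flow_isOrbit (h := h) s q.1).norm_sub_le (flow_isOrbit s z) s q.2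
    simp only [flow_self] at this
    have h2 := norm_sub_le_norm_sub_add_norm_sub (h.flow s q.1 q.2) (h.flow s z q.2) (h.flow s z t)
    linarith
  refine squeeze_zero (fun _ => norm_nonneg _) h1 ?_
  have hc : Continuous fun q : (ℝ × ℝ) × ℝ =>
      ‖q.1 - z‖ * Real.exp (2 * h.C * |q.2 - s|) + ‖h.flow s z q.2 - h.flow s z t‖ := by
    have := (flow_isOrbit (h := h) s z).continuous
    fun_prop
  have := hc.tendsto (z, t)
  simpa using this

theorem continuous_act_flow (s t : ℝ) : Continuous fun z => h.act (h.flow s z) s t := by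
  unfold act
  refine intervalIntegral.continuous_parametric_intervalIntegral_of_continuous' ?_ s t
  exact h.continuous_dens.comp (continuous_snd.prodMk (continuous_flow s))

theorem exists_joining {s t : ℝ} (hst : s < t) (ht : t ≤ s + h.τ) (x y : ℝ) :
    ∃ γ, h.IsOrbit γ ∧ (γ s).1 = x ∧ (γ t).1 = y := by
  have hc : Continuous fun p : ℝ => (h.flow s (x, p) t).1 :=
    continuous_fst.comp ((continuous_flow s).comp
      ((continuous_const.prodMk continuous_id).prodMk continuous_const))
  have hk : 0 < h.m / 4 * (t - s) := mul_pos (by linarith [h.m_pos]) (by linarith)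
  have hmono : ∀ p q, p ≤ q → h.m / 4 * (t - s) * (q - p) ≤
      (h.flow s (x, q) t).1 - (h.flow s (x, p) t).1 := by
    intro p q hpq
    have := ((flow_isOrbit (h := h) s (x, p)).joining_aux (flow_isOrbit s (x, q)) hst.le ht
      (by simp) (by simpa using hpq)).1
    simpa using this
  have hsurj : Function.Surjective fun p : ℝ => (h.flow s (x, p) t).1 := by
    refine hc.surjective ?_ ?_
    · refine tendsto_atTop_mono' atTop (f₁ := fun p => h.m / 4 * (t - s) * p +
        (h.flow s (x, 0) t).1) ?_ ?_
      · filter_upwards [eventually_ge_atTop 0] with p hp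
        have := hmono 0 p hp
        linarith
      · exact tendsto_atTop_add_const_right _ _ (tendsto_id.const_mul_atTop hk)
    · refine tendsto_atBot_mono' atBot (f₁ := fun p => h.m / 4 * (t - s) * p +
        (h.flow s (x, 0) t).1) ?_ ?_
      · filter_upwards [eventually_le_atBot 0] with p hp
        have := hmono p 0 hp
        linarith
      · exact tendsto_atBot_add_const_right _ _ (tendsto_id.const_mul_atBot hk)
  obtain ⟨p, hp⟩ := hsurj y
  exact ⟨h.flow s (x, p), flow_isOrbit _ _, by simp, hp⟩

theorem IsOrbit.eq_of_endpoints {γ η : ℝ → ℝ × ℝ} (hγ : h.IsOrbit γ) (hη : h.IsOrbit η) {s t : ℝ}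
    (hst : s < t) (ht : t ≤ s + h.τ) (hs : (γ s).1 = (η s).1) (ht' : (γ t).1 = (η t).1) :
    γ = η := by
  have h1 := (hγ.joining hη hst.le ht hs).1
  rw [ht', sub_self, abs_zero] at h1
  have hk : 0 < h.m / 4 * (t - s) := mul_pos (by linarith [h.m_pos]) (by linarith)
  have h2 : |(η s).2 - (γ s).2| ≤ 0 := by
    by_contra! hc
    have := mul_pos hk hc
    linarith
  exact hγ.eq hη (s := s) (Prod.ext hs (sub_eq_zero.mp (abs_nonpos_iff.mp h2)).symm)

/-- Straightening a corner: a broken orbit over a short time has larger action than the orbit with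
the same endpoints, strictly unless it is not broken. -/
theorem IsOrbit.straighten {γ η₁ η₂ : ℝ → ℝ × ℝ} (hγ : h.IsOrbit γ) (h1 : h.IsOrbit η₁)
    (h2 : h.IsOrbit η₂) {r s t : ℝ} (hrs : r ≤ s) (hst : s ≤ t) (ht : t ≤ r + h.τ)
    (hs : (η₁ s).1 = (η₂ s).1) (hr : (γ r).1 = (η₁ r).1) (ht' : (γ t).1 = (η₂ t).1) :
    h.act γ r t ≤ h.act η₁ r s + h.act η₂ s t ∧
      (r < s → s < t → h.act γ r t = h.act η₁ r s + h.act η₂ s t → γ = η₁ ∧ γ = η₂) := by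
  have hC := h.C_pos
  have hcu : ∀ {η : ℝ → ℝ × ℝ}, h.IsOrbit η → ∀ t ∈ (univ : Set ℝ), ∀ q,
      q * h.Gp t (η t).1 (η t).2 - h.G t (η t).1 q ≤ h.dens t (η t) := fun {η} hη t _ q => by
    have := h.dens_ge q t (η t)
    linarith
  have hT : 10 * h.C * (t - r) ≤ 1 := by
    refine le_trans ?_ h.τ_le_one
    gcongr
    linarith
  have hT' : 10 * h.C * (t - s) ≤ 1 := by
    refine le_trans ?_ hT
    gcongr
  have e1 := hγ.verification hrs hst hT (fun t => h1.hasDerivAt_fst t) h1.continuous_dens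
    (fun t _ => hcu h1 t trivial)
  have e2 := hγ.verification hst le_rfl hT' (fun t => h2.hasDerivAt_fst t) h2.continuous_dens
    (fun t _ => hcu h2 t trivial)
  have e3 := hγ.act_add r s t
  have i1 : 0 ≤ ∫ q in r..s, ((η₁ q).1 - (γ q).1) ^ 2 :=
    intervalIntegral.integral_nonneg hrs fun q _ => sq_nonneg _
  have i2 : 0 ≤ ∫ q in s..t, ((η₂ q).1 - (γ q).1) ^ 2 :=
    intervalIntegral.integral_nonneg hst fun q _ => sq_nonneg _
  have i1' := mul_nonneg hC.le i1
  have i2' := mul_nonneg hC.le i2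
  change _ ≤ h.act η₁ r s at e1
  change _ ≤ h.act η₂ s t at e2
  rw [hs, hr] at e1
  rw [ht'] at e2
  norm_num at e1 e2
  refine ⟨by linarith, fun hrs' hst' heq => ?_⟩
  have key : ∀ {η : ℝ → ℝ × ℝ}, h.IsOrbit η → ∀ {a b : ℝ}, a < b → b ≤ a + h.τ →
      ∫ q in a..b, ((η q).1 - (γ q).1) ^ 2 = 0 → γ = η := by
    intro η hη a b hab hb h0
    have hc : Continuous fun q => ((η q).1 - (γ q).1) ^ 2 :=
      ((continuous_fst.comp hη.continuous).sub (continuous_fst.comp hγ.continuous)).pow 2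
    have hz : ∀ q ∈ Icc a b, (γ q).1 = (η q).1 := by
      by_contra! hne
      obtain ⟨q, hq, hne⟩ := hne
      have := intervalIntegral.integral_pos hab hc.continuousOn (fun q _ => sq_nonneg _)
        ⟨q, hq, by have := sub_ne_zero.mpr hne.symm; positivity⟩
      linarith
    exact hγ.eq_of_endpoints hη hab hb (hz a ⟨le_rfl, hab.le⟩) (hz b ⟨hab.le, le_rfl⟩)
  constructor
  · refine key h1 hrs' (by linarith) ?_
    have : h.C * ∫ q in r..s, ((η₁ q).1 - (γ q).1) ^ 2 = 0 := by linarith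
    exact (mul_eq_zero.mp this).resolve_left hC.ne'
  · refine key h2 hst' (by linarith) ?_
    have : h.C * ∫ q in s..t, ((η₂ q).1 - (γ q).1) ^ 2 = 0 := by linarith
    exact (mul_eq_zero.mp this).resolve_left hC.ne'

end TameHam

namespace TameHam

variable {h : TameHam}

theorem τ_le (h : TameHam) : h.τ ≤ 1 / 10 := by
  have h1 := h.τ_le_one
  have h2 := h.one_le_C
  have h3 := h.τ_pos
  nlinarith

theorem IsOrbit.act_le_of_endpoint {γ η : ℝ → ℝ × ℝ} (hγ : h.IsOrbit γ) (hη : h.IsOrbit η)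
    {s t : ℝ} (hst : s ≤ t) (ht : t ≤ s + h.τ) (hs : (γ s).1 = (η s).1) :
    h.act η s t ≤ h.act γ s t + (η t).2 * ((η t).1 - (γ t).1) := by
  have hC := h.C_pos
  have hT : 10 * h.C * (t - s) ≤ 1 := by
    refine le_trans ?_ h.τ_le_one
    gcongr
    linarith
  have e1 := hη.verification hst le_rfl hT (fun t => hγ.hasDerivAt_fst t) hγ.continuous_dens
    (fun t _ q => by have := h.dens_ge q t (γ t); linarith)
  have i1 : 0 ≤ ∫ q in s..t, ((γ q).1 - (η q).1) ^ 2 :=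
    intervalIntegral.integral_nonneg hst fun q _ => sq_nonneg _
  have i1' := mul_nonneg hC.le i1
  change _ ≤ h.act γ s t at e1
  rw [hs] at e1
  norm_num at e1
  linarith

/-- `Chain h s x t y v`: a broken orbit from position `x` at time `s` to position `y` at time `t`
has action `v`. -/
inductive Chain (h : TameHam) (s x : ℝ) : ℝ → ℝ → ℝ → Prop
  | refl : Chain h s x s x 0
  | step {t y v t' : ℝ} {γ : ℝ → ℝ × ℝ} (hc : Chain h s x t y v) (hγ : h.IsOrbit γ) (ht : t ≤ t')
      (hy : (γ t).1 = y) : Chain h s x t' (γ t').1 (v + h.act γ t t')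

namespace Chain

variable {s x t y v r z w : ℝ}

theorem le (hc : Chain h s x t y v) : s ≤ t := by
  induction hc with
  | refl => exact le_rfl
  | step _ _ ht _ ih => exact ih.trans ht

theorem trans (h1 : Chain h s x t y v) (h2 : Chain h t y r z w) : Chain h s x r z (v + w) := by
  induction h2 with
  | refl => simpa using h1
  | step _ hγ ht hy ih =>
    rw [← add_assoc]
    exact ih.step hγ ht hy

theorem of_orbit {γ : ℝ → ℝ × ℝ} (hγ : h.IsOrbit γ) (hst : s ≤ t) :
    Chain h s (γ s).1 t (γ t).1 (h.act γ s t) := by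
  simpa using (refl (h := h)).step hγ hst rfl

theorem split (hc : Chain h s x t y v) (hsr : s ≤ r) (hrt : r ≤ t) :
    ∃ z v₁ v₂, Chain h s x r z v₁ ∧ Chain h r z t y v₂ ∧ v = v₁ + v₂ := by
  induction hc with
  | refl =>
    obtain rfl := le_antisymm hsr hrt
    exact ⟨_, 0, 0, refl, refl, by simp⟩
  | @step t₀ y₀ v₀ t' γ hc hγ ht hy ih =>
    rcases le_total r t₀ with hr | hr
    · obtain ⟨z, v₁, v₂, h1, h2, rfl⟩ := ih hr
      exact ⟨z, v₁, _, h1, h2.step hγ ht hy, by ring⟩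
    · refine ⟨_, _, _, hc.step hγ hr hy, of_orbit hγ hrt, ?_⟩
      rw [add_assoc, hγ.act_add]

theorem shift (hc : Chain h s x t y v) (k l : ℤ) : Chain h (s + k) (x + l) (t + k) (y + l) v := by
  induction hc with
  | refl => exact refl
  | @step t₀ y₀ v₀ t' γ hc hγ ht hy ih =>
    have h1 := ih.step (hγ.shift (-k) l) (t' := t' + k) (by linarith) (by simp [hy])
    rw [act_shift] at h1
    simpa using h1

theorem eq_of_eq (hc : Chain h s x t y v) (hts : t = s) : y = x ∧ v = 0 := by
  induction hc with
  | refl => exact ⟨rfl, rfl⟩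
  | step hc hγ ht hy ih =>
    subst hts
    obtain rfl := le_antisymm ht hc.le
    obtain ⟨rfl, rfl⟩ := ih rfl
    exact ⟨hy, by simp⟩

theorem lower_orbit {γ : ℝ → ℝ × ℝ} (hγ : h.IsOrbit γ) (hst : s ≤ t) {e : ℝ}
    (he : |e| ≤ h.K + 1) : e * ((γ t).1 - (γ s).1) - h.C₁ * (t - s) ≤ h.act γ s t := by
  have := le_of_hasDerivAt_nonneg hst (F := fun r => h.act γ s r - (e * (γ r).1 - h.C₁ * r))
    (fun r => (hγ.hasDerivAt_act s r).fun_sub (((hγ.hasDerivAt_fst r).const_mul e).fun_sub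
      ((hasDerivAt_id r).const_mul h.C₁))) (fun r _ => by
      have h1 := h.dens_ge e r (γ r)
      have h2 := h.G_le e he r (γ r).1
      linarith)
  simp only [act_self] at this
  linarith

theorem lower (hc : Chain h s x t y v) {e : ℝ} (he : |e| ≤ h.K + 1) :
    e * (y - x) - h.C₁ * (t - s) ≤ v := by
  induction hc with
  | refl => simp
  | @step t₀ y₀ v₀ t' γ hc hγ ht hy ih =>
    have := lower_orbit hγ ht he
    rw [hy] at this
    linarith

theorem act_le {γ : ℝ → ℝ × ℝ} (hγ : h.IsOrbit γ) (hc : Chain h s x t y v) (ht : t ≤ s + h.τ)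
    (hs : (γ s).1 = x) (hy : (γ t).1 = y) : h.act γ s t ≤ v := by
  induction hc generalizing γ with
  | refl => simp
  | @step t₀ y₀ v₀ t' η hc hη ht' hy' ih =>
    rcases hc.le.eq_or_lt with heq | hlt
    · obtain ⟨rfl, rfl⟩ := hc.eq_of_eq heq.symm
      subst heq
      have := (hγ.straighten hγ hη le_rfl ht' ht (hs.trans hy'.symm) rfl hy).1
      simp only [act_self] at this
      linarith
    · obtain ⟨ζ, hζ, h1, h2⟩ := exists_joining hlt (ht'.trans ht) x y₀
      have h3 := ih hζ (ht'.trans ht) h1 h2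
      have := (hγ.straighten hζ hη hc.le ht' ht (h2.trans hy'.symm) (hs.trans h1.symm) hy).1
      linarith

/-- Along a straight line of slope at most one the action grows at most linearly. -/
theorem exists_straight {d : ℝ} (hd : |d| ≤ 1) (n : ℕ) : ∀ {s t x : ℝ}, s ≤ t →
    t - s ≤ n * h.τ → ∃ v, Chain h s x t (x + d * (t - s)) v ∧ v ≤ h.C₀ * (t - s) := by
  induction n with
  | zero =>
    intro s t x hst ht
    obtain rfl : s = t := le_antisymm hst (by simpa using ht)
    exact ⟨0, by simpa using refl, by simp⟩
  | succ n ih =>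
    intro s t x hst ht
    have hτ := h.τ_pos
    have hC := h.C_pos
    push_cast at ht
    obtain ⟨v, hv, hv'⟩ := ih (s := s) (t := max s (t - h.τ)) (x := x) (le_max_left _ _) (by
      rw [sub_le_iff_le_add]
      refine max_le ?_ (by linarith)
      have : 0 ≤ n * h.τ := by positivity
      linarith)
    set r := max s (t - h.τ) with hr
    have hrt : r ≤ t := max_le hst (by linarith)
    rcases hrt.eq_or_lt with heq | hlt
    · rw [heq] at hv hv'; exact ⟨v, hv, hv'⟩
    have hrt' : t ≤ r + h.τ := by have := le_max_right s (t - h.τ); linarith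
    obtain ⟨γ, hγ, h1, h2⟩ := exists_joining hlt hrt' (x + d * (r - s)) (x + d * (t - s))
    refine ⟨v + h.act γ r t, by simpa only [h2] using hv.step hγ hrt h1, ?_⟩
    have hT : 10 * h.C * (t - r) ≤ 1 := by
      refine le_trans ?_ h.τ_le_one
      gcongr
      linarith
    have e1 := hγ.verification hrt le_rfl hT (y := fun q => x + d * (q - s)) (y' := fun _ => d)
      (l := fun _ => h.C₀) (fun q => by
        have := (((hasDerivAt_id q).sub_const s).const_mul d).const_add x
        simpa using this) continuous_const (fun q _ p => h.mul_sub_le d hd _ _ _)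
    have i1 : 0 ≤ ∫ q in r..t, (x + d * (q - s) - (γ q).1) ^ 2 :=
      intervalIntegral.integral_nonneg hrt fun q _ => sq_nonneg _
    have i1' := mul_nonneg hC.le i1
    rw [h1, h2] at e1
    norm_num at e1
    linarith

theorem exists_of_abs_le (hst : s ≤ t) (hxy : |y - x| ≤ t - s) :
    ∃ v, Chain h s x t y v ∧ v ≤ h.C₀ * (t - s) := by
  obtain ⟨n, hn⟩ := exists_nat_ge ((t - s) / h.τ)
  rw [div_le_iff₀ h.τ_pos] at hn
  rcases hst.eq_or_lt with rfl | hlt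
  · obtain rfl : y = x := by simpa [sub_eq_zero] using hxy
    exact ⟨0, refl, by simp⟩
  have hp : 0 < t - s := by linarith
  obtain ⟨v, hv, hv'⟩ := exists_straight (h := h) (d := (y - x) / (t - s)) (x := x) (by
    rw [abs_div, abs_of_pos hp, div_le_one hp]; exact hxy) n hst hn
  refine ⟨v, ?_, hv'⟩
  rwa [div_mul_cancel₀ _ hp.ne', add_sub_cancel] at hv

end Chain

end TameHam

section Liminf

variable {u v : ℕ → ℝ} {d B B' : ℝ}

theorem isBoundedUnder_ge_of_abs (hu : ∀ᶠ k in atTop, |u k| ≤ B) :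
    IsBoundedUnder (· ≥ ·) atTop u :=
  ⟨-B, by simpa using hu.mono fun k hk => (abs_le.mp hk).1⟩

theorem isCoboundedUnder_ge_of_abs (hu : ∀ᶠ k in atTop, |u k| ≤ B) :
    IsCoboundedUnder (· ≥ ·) atTop u :=
  IsBoundedUnder.isCoboundedUnder_ge ⟨B, by simpa using hu.mono fun k hk => (abs_le.mp hk).2⟩

theorem liminf_le_liminf_add (hu : ∀ᶠ k in atTop, |u k| ≤ B) (hv : ∀ᶠ k in atTop, |v k| ≤ B')
    (h : ∀ᶠ k in atTop, u k ≤ v k + d) : liminf u atTop ≤ liminf v atTop + d := by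
  by_contra! hlt
  obtain ⟨b, hb1, hb2⟩ := exists_between hlt
  have h1 := eventually_lt_of_lt_liminf hb2 (isBoundedUnder_ge_of_abs hu)
  have h2 := frequently_lt_of_liminf_lt (isCoboundedUnder_ge_of_abs hv)
    (show liminf v atTop < b - d by linarith)
  obtain ⟨k, hk1, hk2, hk3⟩ := (h2.and_eventually (h1.and h)).exists
  linarith

end Liminf

/-- A quasi-additive sequence stays at bounded distance from a linear one. -/
theorem exists_abs_sub_mul_le {f : ℕ → ℝ} {B : ℝ} (hf : ∀ i j, |f (i + j) - f i - f j| ≤ B) :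
    ∃ ρ : ℝ, ∀ n : ℕ, |f n - n * ρ| ≤ B := by
  have hup : Subadditive fun n => f n + B := fun i j => by
    have := (abs_le.mp (hf i j)).2; linarith
  have hlo : Subadditive fun n => -f n + B := fun i j => by
    have := (abs_le.mp (hf i j)).1; linarith
  have hgrow : ∀ n : ℕ, |f n| ≤ (n + 1) * (|f 1| + B + |f 0|) := by
    have hB : 0 ≤ B := (abs_nonneg _).trans (hf 0 0)
    intro n
    induction n with
    | zero => have := abs_nonneg (f 1); simp; linarith
    | succ n ih =>
      have h1 := hf n 1
      have h2 : |f (n + 1)| ≤ |f (n + 1) - f n - f 1| + |f n| + |f 1| := by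
        have := abs_add_three (f (n + 1) - f n - f 1) (f n) (f 1)
        rwa [show f (n + 1) - f n - f 1 + f n + f 1 = f (n + 1) by ring] at this
      have := abs_nonneg (f 0)
      push_cast
      nlinarith
  have hB : 0 ≤ B := (abs_nonneg _).trans (hf 0 0)
  set A := |f 1| + B + |f 0| with hA
  have hA0 : 0 ≤ A := by positivity
  have hdiv : ∀ n : ℕ, |f n / n| ≤ 2 * A := by
    intro n
    rcases n.eq_zero_or_pos with rfl | hn
    · simp; linarith
    have hn1 : (1:ℝ) ≤ n := by exact_mod_cast hn
    have hn' : (0:ℝ) < n := by linarith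
    rw [abs_div, abs_of_pos hn', div_le_iff₀ hn']
    refine (hgrow n).trans ?_
    nlinarith
  have hb1 : BddBelow (range fun n : ℕ => (f n + B) / n) := by
    refine ⟨-(2 * A), ?_⟩
    rintro _ ⟨n, rfl⟩
    have h1 := (abs_le.mp (hdiv n)).1
    have : 0 ≤ B / n := by positivity
    simp only [add_div]
    linarith
  have hb2 : BddBelow (range fun n : ℕ => (-f n + B) / n) := by
    refine ⟨-(2 * A), ?_⟩
    rintro _ ⟨n, rfl⟩
    have h1 := (abs_le.mp (hdiv n)).2
    have : 0 ≤ B / n := by positivity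
    simp only [add_div, neg_div]
    linarith
  have t1 := hup.tendsto_lim hb1
  have t2 := hlo.tendsto_lim hb2
  have hsum : hup.lim + hlo.lim = 0 := by
    have h1 := t1.add t2
    have h2 : Tendsto (fun n : ℕ => (f n + B) / n + (-f n + B) / n) atTop (𝓝 0) := by
      have := tendsto_const_div_atTop_nhds_zero_nat (2 * B)
      refine this.congr fun n => ?_
      rw [← add_div]; congr 1; ring
    exact tendsto_nhds_unique h1 h2
  refine ⟨hup.lim, fun n => ?_⟩
  rcases n.eq_zero_or_pos with rfl | hn
  · have := hf 0 0
    simpa using this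
  have hn' : (0:ℝ) < n := by exact_mod_cast hn
  have h1 := hup.lim_le_div hb1 hn.ne'
  have h2 := hlo.lim_le_div hb2 hn.ne'
  rw [le_div_iff₀ hn'] at h1 h2
  rw [show hlo.lim = -hup.lim by linarith] at h2
  rw [abs_le]; constructor <;> linarith

namespace TameHam

variable {h : TameHam}

theorem exists_zero_momentum_bound (h : TameHam) : ∃ B, ∀ s t x, s ≤ t → t ≤ s + h.τ →
    ‖h.flow s (x, 0) t - (x, 0)‖ ≤ B := by
  obtain ⟨A, hA⟩ := exists_bound_of_periodic h.cont_Gp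
    (fun t x p => h.Gp_add_one_t t x p) (fun t x p => h.Gp_add_one_x t x p) 0
  obtain ⟨A', hA'⟩ := exists_bound_of_periodic h.cont_Gx
    (fun t x p => h.Gx_add_one_t t x p) (fun t x p => h.Gx_add_one_x t x p) 0
  have hV : ∀ t x, ‖h.VF t (x, 0)‖ ≤ max A A' := fun t x => by
    rw [Prod.norm_def]
    refine max_le_max (hA t x 0 (by simp)) ?_
    have := hA' t x 0 (by simp)
    simpa [VF] using this
  have hm : 0 ≤ max A A' := (norm_nonneg _).trans (hV 0 0)
  refine ⟨gronwallBound 0 (2 * h.C) (max A A') h.τ, fun s t x hst ht => ?_⟩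
  have ho := flow_isOrbit (h := h) s (x, 0)
  have h1 := norm_le_gronwallBound_of_norm_deriv_right_le (a := s) (b := t) (δ := 0)
    (K := 2 * h.C) (ε := max A A') (f := fun r => h.flow s (x, 0) r - (x, 0))
    (f' := fun r => h.VF r (h.flow s (x, 0) r))
    (ho.continuous.sub continuous_const).continuousOn
    (fun r _ => ((ho r).sub_const _).hasDerivWithinAt) (by simp) (fun r _ => by
      have h2 := h.VF_lip r (h.flow s (x, 0) r) (x, 0)
      have h3 := norm_le_norm_add_norm_sub' (h.VF r (h.flow s (x, 0) r)) (h.VF r (x, 0))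
      have := hV r x
      linarith) t ⟨hst, le_rfl⟩
  refine h1.trans (gronwallBound_mono le_rfl hm (by linarith [h.C_pos]) (by linarith))

theorem exists_momentum_bound (h : TameHam) (D : ℝ) : ∃ P, 0 ≤ P ∧ ∀ γ, h.IsOrbit γ → ∀ t,
    |(γ t).1 - (γ (t - h.τ)).1| ≤ D → |(γ t).2| ≤ P ∧ |(γ (t - h.τ)).2| ≤ P := by
  obtain ⟨B, hB⟩ := h.exists_zero_momentum_bound
  have hk : 0 < h.m / 4 * h.τ := mul_pos (by linarith [h.m_pos]) h.τ_pos
  refine ⟨|2 * ((D + B) / (h.m / 4 * h.τ)) + B|, abs_nonneg _, fun γ hγ t hD => ?_⟩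
  set s := t - h.τ with hs
  have hτ := h.τ_pos
  have ho := flow_isOrbit (h := h) s ((γ s).1, 0)
  have h1 := ho.joining hγ (s := s) (t := t) (by linarith) (by linarith) (by simp)
  have h2 := hB s t (γ s).1 (by linarith) (by linarith)
  have h3 : |(h.flow s ((γ s).1, 0) t).1 - (γ s).1| ≤ B := (norm_fst_le _).trans h2
  have h4 : |(h.flow s ((γ s).1, 0) t).2| ≤ B := by
    have := (norm_snd_le _).trans h2
    simpa using this
  have h5 := (norm_snd_le _).trans h1.2
  rw [show t - s = h.τ by rw [hs]; ring] at h1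
  simp only [flow_self, sub_zero, Prod.snd_sub, Real.norm_eq_abs] at h1 h5
  have h6 : |(γ t).1 - (h.flow s ((γ s).1, 0) t).1| ≤ D + B := by
    have := abs_sub_le (γ t).1 (γ s).1 (h.flow s ((γ s).1, 0) t).1
    rw [abs_sub_comm (γ s).1] at this
    linarith
  have h7 : |(γ s).2| ≤ (D + B) / (h.m / 4 * h.τ) := by
    rw [le_div_iff₀ hk]; linarith [h1.1]
  have hB0 : 0 ≤ B := (abs_nonneg _).trans h3
  have h0 := (abs_nonneg _).trans h7
  have h9 := le_abs_self (2 * ((D + B) / (h.m / 4 * h.τ)) + B)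
  refine ⟨le_trans ?_ h9, by linarith⟩
  have h8 := abs_add_le ((γ t).2 - (h.flow s ((γ s).1, 0) t).2) (h.flow s ((γ s).1, 0) t).2
  rw [sub_add_cancel] at h8
  linarith

/-- `u` is dominated by the action on the times `I`, and `u - c x` is periodic. -/
structure Dom (h : TameHam) (c : ℝ) (I : Set ℝ) (u : ℝ → ℝ → ℝ) : Prop where
  abs_c_le : |c| ≤ h.K
  upper : IsUpperSet I
  le_act : ∀ γ, h.IsOrbit γ → ∀ s ∈ I, ∀ t, s ≤ t → u t (γ t).1 ≤ u s (γ s).1 + h.act γ s t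
  per : ∀ t ∈ I, ∀ x, u t (x + 1) = u t x + c

namespace Dom

variable {c : ℝ} {I : Set ℝ} {u : ℝ → ℝ → ℝ}

theorem le_chain (hu : Dom h c I u) {s t x y v : ℝ} (hs : s ∈ I) (hc : Chain h s x t y v) :
    u t y ≤ u s x + v := by
  induction hc with
  | refl => simp
  | @step t₀ y₀ v₀ t' γ hc hγ ht hy ih =>
    have := hu.le_act γ hγ t₀ (hu.upper hc.le hs) t' ht
    rw [hy] at this
    linarith

theorem per_int (hu : Dom h c I u) {t : ℝ} (ht : t ∈ I) (x : ℝ) (k : ℤ) :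
    u t (x + k) = u t x + c * k := by
  have := TameHam.per_int (f := fun x => u t x - c * x) (fun x => by rw [hu.per t ht]; ring) k x
  linarith

theorem straight (hu : Dom h c I u) {s t x y : ℝ} (hs : s ∈ I) (hst : s ≤ t)
    (hxy : |y - x| ≤ t - s) : u t y ≤ u s x + h.C₀ * (t - s) := by
  obtain ⟨v, hv, hv'⟩ := Chain.exists_of_abs_le (h := h) hst hxy
  linarith [hu.le_chain hs hv]

theorem le_add_one (hu : Dom h c I u) {s : ℝ} (hs : s ∈ I) (x y : ℝ) :
    u (s + 1) y - c * y ≤ u s x - c * x + (h.C₀ + h.K) := by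
  set k : ℤ := -⌊y - x⌋ with hk
  have h1 : |y + k - x| ≤ 1 := by
    have h1 := Int.floor_le (y - x)
    have h2 := Int.lt_floor_add_one (y - x)
    rw [hk, abs_le]; push_cast; constructor <;> linarith
  have h2 := hu.straight (x := x) (y := y + k) hs (by linarith : s ≤ s + 1) (by simpa using h1)
  rw [hu.per_int (hu.upper (by linarith) hs)] at h2
  have h3 : |c * (y + k - x)| ≤ h.K * 1 := by
    rw [abs_mul]; exact mul_le_mul hu.abs_c_le h1 (abs_nonneg _) h.K_nonneg
  have h4 := (abs_le.mp h3).1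
  linarith

/-- Nearly optimal chains over a short time have bounded displacement. -/
theorem abs_sub_le (hu : Dom h c I u) {t D x y v : ℝ} (ht : t - h.τ ∈ I)
    (hD : ∀ x y, u (t - h.τ) x - c * x ≤ u (t - h.τ) y - c * y + D)
    (hv : Chain h (t - h.τ) x t y v) (hv' : u (t - h.τ) x + v ≤ u t y + 1) :
    |y - x| ≤ D + (h.C₀ + h.C₁) * h.τ + 1 := by
  have hτ := h.τ_pos
  set s := t - h.τ with hs
  have hst : s < t := by linarith
  have e1 := hu.straight (x := y) (y := y) ht hst.le (by simpa using hst.le)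
  have e2 := hD y x
  have e3 : ∀ e, |e - c| ≤ 1 → (e - c) * (y - x) ≤ D + (h.C₀ + h.C₁) * h.τ + 1 := by
    intro e he
    have e4 := hv.lower (e := e) (by
      have := abs_add_le (e - c) c
      rw [sub_add_cancel] at this
      linarith [hu.abs_c_le])
    rw [show t - s = h.τ by rw [hs]; ring] at e1 e4
    linarith
  rw [abs_le]
  constructor
  · have := e3 (c - 1) (by norm_num)
    linarith
  · have := e3 (c + 1) (by norm_num)
    linarith

/-- Local Lipschitz regularity in space for a dominated function which is nearly attained. -/
theorem exists_lip (h : TameHam) (D : ℝ) : ∃ L, 0 ≤ L ∧ ∀ (c : ℝ) (I : Set ℝ) (u : ℝ → ℝ → ℝ),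
    Dom h c I u → ∀ t, t - h.τ ∈ I →
    (∀ x y, u (t - h.τ) x - c * x ≤ u (t - h.τ) y - c * y + D) →
    ∀ y, (∀ ε > 0, ∃ x v, Chain h (t - h.τ) x t y v ∧ u (t - h.τ) x + v < u t y + ε) →
    ∀ y', |y' - y| ≤ 1 → u t y' ≤ u t y + L * |y' - y| := by
  have hτ := h.τ_pos
  obtain ⟨P, hP0, hP⟩ := h.exists_momentum_bound (D + (h.C₀ + h.C₁) * h.τ + 1 + 1)
  refine ⟨P, hP0, fun c I u hu t ht hD y hy y' hy' => le_of_forall_pos_le_add fun ε hε => ?_⟩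
  set s := t - h.τ with hs
  have hst : s < t := by linarith
  obtain ⟨x, v, hv, hv'⟩ := hy (min ε 1) (by positivity)
  obtain ⟨γ, hγ, h1, h2⟩ := exists_joining hst (by linarith : t ≤ s + h.τ) x y
  obtain ⟨η, hη, h3, h4⟩ := exists_joining hst (by linarith : t ≤ s + h.τ) x y'
  have h5 := hv.act_le hγ (by linarith) h1 h2
  have h6 := hγ.act_le_of_endpoint hη hst.le (by linarith) (h1.trans h3.symm)
  have h7 := hu.le_act η hη s ht t hst.le
  have h8 : |y - x| ≤ D + (h.C₀ + h.C₁) * h.τ + 1 :=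
    hu.abs_sub_le ht hD hv (by linarith [min_le_right ε 1])
  have h9 : |(η t).2| ≤ P := (hP η hη t (by
    rw [← hs, h3, h4]
    have := _root_.abs_sub_le y' y x
    linarith)).1
  rw [h2, h4] at h6
  rw [h3, h4] at h7
  have h10 : (η t).2 * (y' - y) ≤ P * |y' - y| := by
    refine (le_abs_self _).trans ?_
    rw [abs_mul]; gcongr
  have := min_le_left ε 1
  linarith

end Dom

end TameHam

namespace TameHam

variable {h : TameHam}

/-- Calibration of an orbit on `[s, t]`. -/
def Cal (h : TameHam) (u : ℝ → ℝ → ℝ) (γ : ℝ → ℝ × ℝ) (s t : ℝ) : Prop :=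
  u t (γ t).1 = u s (γ s).1 + h.act γ s t

section Cal

variable {c : ℝ} {I : Set ℝ} {u : ℝ → ℝ → ℝ}

theorem Cal.trans {γ : ℝ → ℝ × ℝ} (hγ : h.IsOrbit γ) {r s t : ℝ} (h1 : Cal h u γ r s)
    (h2 : Cal h u γ s t) : Cal h u γ r t := by
  unfold Cal at *
  rw [← hγ.act_add r s t]
  linarith

theorem Dom.cal_sub (hu : Dom h c I u) {γ : ℝ → ℝ × ℝ} (hγ : h.IsOrbit γ) {s t s' t' : ℝ}
    (hs : s ∈ I) (hc : Cal h u γ s t) (h1 : s ≤ s') (h2 : s' ≤ t') (h3 : t' ≤ t) :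
    Cal h u γ s' t' := by
  have hs' := hu.upper h1 hs
  have ht' := hu.upper h2 hs'
  have e1 := hu.le_act γ hγ s hs s' h1
  have e2 := hu.le_act γ hγ s' hs' t' h2
  have e3 := hu.le_act γ hγ t' ht' t h3
  have e4 := hγ.act_add s s' t'
  have e5 := hγ.act_add s t' t
  unfold Cal at *
  linarith

/-- Calibrated orbits cannot cross. -/
theorem Dom.crossing (hu : Dom h c I u) {γ η : ℝ → ℝ × ℝ} (hγ : h.IsOrbit γ) (hη : h.IsOrbit η)
    {s r t : ℝ} (hs : s ∈ I) (hsr : s < r) (hrt : r < t) (h1 : Cal h u γ s r)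
    (h2 : Cal h u η r t) (heq : (γ r).1 = (η r).1) : γ = η := by
  have hτ := h.τ_pos
  have a1 : max s (r - h.τ / 2) < r := max_lt hsr (by linarith)
  have a2 : r < min t (r + h.τ / 2) := lt_min hrt (by linarith)
  have hs' : max s (r - h.τ / 2) ∈ I := hu.upper (le_max_left _ _) hs
  have e1 := hu.cal_sub hγ hs h1 (le_max_left s (r - h.τ / 2)) a1.le le_rfl
  have e2 := hu.cal_sub hη (hu.upper hsr.le hs) h2 le_rfl a2.le (min_le_left t (r + h.τ / 2))
  have hlen : min t (r + h.τ / 2) ≤ max s (r - h.τ / 2) + h.τ := by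
    have := min_le_right t (r + h.τ / 2)
    have := le_max_right s (r - h.τ / 2)
    linarith
  set s' := max s (r - h.τ / 2)
  set t' := min t (r + h.τ / 2)
  obtain ⟨ζ, hζ, b1, b2⟩ := exists_joining (a1.trans a2) hlen (γ s').1 (η t').1
  obtain ⟨c1, c2⟩ := hζ.straighten hγ hη a1.le a2.le hlen heq b1 b2
  have e3 := hu.le_act ζ hζ s' hs' t' (a1.trans a2).le
  unfold Cal at e1 e2
  rw [b1, b2] at e3
  rw [heq] at e1
  obtain ⟨d1, d2⟩ := c2 a1 a2 (by linarith)
  exact d1.symm.trans d2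

end Cal

/-- The value function with initial datum `c x` at time `0`. -/
noncomputable def val (h : TameHam) (c t y : ℝ) : ℝ :=
  sInf {v | ∃ x w, Chain h 0 x t y w ∧ v = c * x + w}

section Val

variable {c : ℝ}

theorem le_of_chain (hc : |c| ≤ h.K) {t x y w : ℝ} (hw : Chain h 0 x t y w) : c * y - h.C₁ * t ≤ c * x + w := by
  have := hw.lower (e := c) (by linarith)
  linarith

theorem val_le (hc : |c| ≤ h.K) {t x y w : ℝ} (hw : Chain h 0 x t y w) : h.val c t y ≤ c * x + w := by
  refine csInf_le ⟨c * y - h.C₁ * t, ?_⟩ ⟨x, w, hw, rfl⟩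
  rintro _ ⟨x, w, hw, rfl⟩
  exact le_of_chain hc hw

theorem exists_chain_lt (h : TameHam) (c : ℝ) {t : ℝ} (ht : 0 ≤ t) (y : ℝ) {ε : ℝ} (hε : 0 < ε) :
    ∃ x w, Chain h 0 x t y w ∧ c * x + w < h.val c t y + ε := by
  have hne : {v | ∃ x w, Chain h 0 x t y w ∧ v = c * x + w}.Nonempty := by
    obtain ⟨γ, hγ, h1⟩ := h.exists_orbit t (y, 0)
    have := Chain.of_orbit hγ ht
    rw [h1] at this
    exact ⟨_, _, _, this, rfl⟩
  obtain ⟨_, ⟨x, w, hw, rfl⟩, hlt⟩ := Real.lt_sInf_add_pos hne hε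
  exact ⟨x, w, hw, hlt⟩

theorem val_le_add (hc : |c| ≤ h.K) {s t x y v : ℝ} (hs : 0 ≤ s) (hv : Chain h s x t y v) :
    h.val c t y ≤ h.val c s x + v := by
  refine le_of_forall_pos_le_add fun ε hε => ?_
  obtain ⟨z, w, hw, hlt⟩ := h.exists_chain_lt c hs x hε
  linarith [val_le hc (hw.trans hv)]

theorem exists_chain_split (hc : |c| ≤ h.K) {s t : ℝ} (hs : 0 ≤ s) (hst : s ≤ t) (y : ℝ) {ε : ℝ} (hε : 0 < ε) :
    ∃ x v, Chain h s x t y v ∧ h.val c s x + v < h.val c t y + ε := by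
  obtain ⟨z, w, hw, hlt⟩ := h.exists_chain_lt c (hs.trans hst) y hε
  obtain ⟨x, v₁, v₂, h1, h2, rfl⟩ := hw.split hs hst
  refine ⟨x, v₂, h2, ?_⟩
  linarith [val_le hc h1]

theorem dom_val (hc : |c| ≤ h.K) : Dom h c (Ici 0) (h.val c) where
  abs_c_le := hc
  upper := isUpperSet_Ici 0
  le_act γ hγ s hs t hst := val_le_add hc hs (Chain.of_orbit hγ hst)
  per := by
    have key : ∀ (k : ℤ) t, 0 ≤ t → ∀ x, h.val c t (x + k) ≤ h.val c t x + c * k := by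
      intro k t ht x
      refine le_of_forall_pos_le_add fun ε hε => ?_
      obtain ⟨z, w, hw, hlt⟩ := h.exists_chain_lt c ht x hε
      have := hw.shift 0 k
      simp only [Int.cast_zero, add_zero] at this
      linarith [val_le hc this]
    intro t ht x
    have h1 := key 1 t ht x
    have h2 := key (-1) t ht (x + 1)
    push_cast at h1 h2
    rw [add_neg_cancel_right] at h2
    linarith

theorem val_zero (hc : |c| ≤ h.K) (y : ℝ) : h.val c 0 y = c * y := by
  refine le_antisymm ?_ (le_of_forall_pos_le_add fun ε hε => ?_)
  · simpa using val_le hc (Chain.refl (h := h) (s := 0) (x := y))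
  · obtain ⟨z, w, hw, hlt⟩ := h.exists_chain_lt c le_rfl y hε
    obtain ⟨rfl, rfl⟩ := hw.eq_of_eq rfl
    linarith

theorem val_osc (hc : |c| ≤ h.K) {t : ℝ} (ht : 1 ≤ t) (x y : ℝ) :
    h.val c t x - c * x ≤ h.val c t y - c * y + (h.C₀ + h.C₁ + h.K) := by
  refine le_of_forall_pos_le_add fun ε hε => ?_
  obtain ⟨z, v, hv, hlt⟩ := exists_chain_split hc (by linarith : 0 ≤ t - 1) (by linarith : t - 1 ≤ t) y hε
  have h1 := hv.lower (e := c) (by linarith)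
  have h2 := (dom_val hc).le_add_one (s := t - 1) (by simpa using ht) z x
  rw [sub_add_cancel] at h2
  linarith

theorem val_osc_nat (hc : |c| ≤ h.K) (n : ℕ) (x y : ℝ) :
    h.val c n x - c * x ≤ h.val c n y - c * y + (h.C₀ + h.C₁ + h.K) := by
  rcases n.eq_zero_or_pos with rfl | hn
  · have := h.C₀_nonneg
    have := h.C₁_nonneg
    have := h.K_nonneg
    rw [Nat.cast_zero, val_zero hc, val_zero hc]; linarith
  · exact val_osc hc (by exact_mod_cast hn) x y

theorem val_quasi (hc : |c| ≤ h.K) (i j : ℕ) :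
    |h.val c ((i + j : ℕ) : ℝ) 0 - h.val c i 0 - h.val c j 0| ≤ h.C₀ + h.C₁ + h.K := by
  push_cast
  have hi : (0:ℝ) ≤ i := i.cast_nonneg
  have hj : (0:ℝ) ≤ j := j.cast_nonneg
  rw [abs_le]
  constructor
  · have : ∀ ε > 0, h.val c i 0 + h.val c j 0 ≤
        h.val c (i + j) 0 + (h.C₀ + h.C₁ + h.K) + ε := by
      intro ε hε
      obtain ⟨x, v, hv, hlt⟩ := exists_chain_split hc hi (by linarith : (i:ℝ) ≤ i + j) 0 hε
      have h1 := hv.shift (-i) 0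
      simp only [Int.cast_neg, Int.cast_natCast, Int.cast_zero, add_zero, add_neg_cancel] at h1
      rw [show (i : ℝ) + j + -i = j by ring] at h1
      have h2 := val_le hc h1
      have h3 := val_osc_nat hc i 0 x
      linarith
    have := le_of_forall_pos_le_add this
    linarith
  · have : ∀ ε > 0, h.val c (i + j) 0 ≤
        h.val c i 0 + h.val c j 0 + (h.C₀ + h.C₁ + h.K) + ε := by
      intro ε hε
      obtain ⟨x, v, hv, hlt⟩ := h.exists_chain_lt c hj 0 hε
      have h1 := hv.shift i 0
      simp only [Int.cast_natCast, Int.cast_zero, add_zero, zero_add] at h1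
      rw [add_comm (j : ℝ)] at h1
      have h2 := val_le_add hc hi h1
      have h3 := val_osc_nat hc i x 0
      linarith
    have := le_of_forall_pos_le_add this
    linarith

theorem exists_rate (hc : |c| ≤ h.K) : ∃ a B, ∀ t, 1 ≤ t → ∀ y, |h.val c t y - c * y + a * t| ≤ B := by
  obtain ⟨ρ, hρ⟩ := exists_abs_sub_mul_le (f := fun n : ℕ => h.val c n 0) (val_quasi hc)
  have hC₀ := h.C₀_nonneg
  have hC₁ := h.C₁_nonneg
  have hK := h.K_nonneg
  refine ⟨-ρ, h.C₀ + h.C₁ + |ρ| + 2 * (h.C₀ + h.C₁ + h.K), fun t ht y => ?_⟩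
  set n := ⌊t⌋₊ with hn
  have h1 : (n : ℝ) ≤ t := Nat.floor_le (by linarith)
  have h2 : t < n + 1 := Nat.lt_floor_add_one t
  have h3 := abs_le.mp (hρ n)
  have h4 : |ρ * (t - n)| ≤ |ρ| := by
    rw [abs_mul, abs_of_nonneg (by linarith : 0 ≤ t - n)]
    exact mul_le_of_le_one_right (abs_nonneg _) (by linarith)
  have h5 := abs_le.mp h4
  have h6 : h.C₀ * (t - n) ≤ h.C₀ := mul_le_of_le_one_right hC₀ (by linarith)
  have h7 : h.C₁ * (t - n) ≤ h.C₁ := mul_le_of_le_one_right hC₁ (by linarith)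
  rw [abs_le]
  constructor
  · have : ∀ ε > 0, h.val c n 0 ≤ h.val c t y - c * y + h.C₁ + (h.C₀ + h.C₁ + h.K) + ε := by
      intro ε hε
      obtain ⟨x, v, hv, hlt⟩ := exists_chain_split hc n.cast_nonneg h1 y hε
      have e1 := hv.lower (e := c) (by linarith)
      have e2 := val_osc_nat hc n 0 x
      linarith
    have := le_of_forall_pos_le_add this
    linarith
  · have e1 := (dom_val hc).straight (s := n) (t := t) (x := y) (y := y) (mem_Ici.mpr n.cast_nonneg) h1
      (by simpa using h1)
    have e2 := val_osc_nat hc n y 0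
    linarith

end Val

/-- A solution of the weak KAM problem at cohomology class `c` with critical value `a`
(the linear part `c x` is included in `w`). -/
structure WeakKAM (h : TameHam) (c a : ℝ) (w : ℝ → ℝ → ℝ) : Prop where
  dom : Dom h c univ w
  time : ∀ t x, w (t + 1) x = w t x - a
  cal : ∀ t y, ∃ γ, h.IsOrbit γ ∧ (γ t).1 = y ∧ ∀ s ≤ t, Cal h w γ s t

theorem exists_calibrated {c : ℝ} {w : ℝ → ℝ → ℝ} (hw : Dom h c univ w)
    (hstep : ∀ t y, ∃ γ, h.IsOrbit γ ∧ (γ t).1 = y ∧ Cal h w γ (t - h.τ) t) (t y : ℝ) :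
    ∃ γ, h.IsOrbit γ ∧ (γ t).1 = y ∧ ∀ s ≤ t, Cal h w γ s t := by
  have hτ := h.τ_pos
  obtain ⟨γ, hγ, hy, hcal⟩ := hstep t y
  refine ⟨γ, hγ, hy, ?_⟩
  have key : ∀ n : ℕ, Cal h w γ (t - (n + 1) * h.τ) t := by
    intro n
    induction n with
    | zero => simpa using hcal
    | succ n ih =>
      obtain ⟨η, hη, hηy, hηc⟩ := hstep (t - (n + 1) * h.τ) (γ (t - (n + 1) * h.τ)).1
      have h1 : 0 < (n + 1) * h.τ := by positivity
      have := hw.crossing hη hγ (mem_univ _) (by linarith) (by linarith) hηc ih hηy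
      subst this
      refine Cal.trans hη ?_ ih
      convert hηc using 1
      push_cast; ring
  intro s hs
  obtain ⟨n, hn⟩ := exists_nat_ge ((t - s) / h.τ)
  rw [div_le_iff₀ hτ] at hn
  exact hw.cal_sub hγ (mem_univ _) (key n) (by linarith) hs le_rfl

theorem exists_weakKAM (h : TameHam) {c : ℝ} (hc : |c| ≤ h.K) : ∃ a w, WeakKAM h c a w := by
  obtain ⟨a, B, hB⟩ := exists_rate hc
  have hτ := h.τ_pos
  set w : ℝ → ℝ → ℝ := fun t x => liminf (fun k : ℕ => h.val c (t + k) x + a * k) atTop with hw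
  have hev : ∀ t r : ℝ, ∀ᶠ k : ℕ in atTop, r ≤ t + k := fun t r => by
    filter_upwards [eventually_ge_atTop ⌈r - t⌉₊] with k hk
    have := Nat.ceil_le.mp hk
    linarith
  have hbd' : ∀ t x, ∀ᶠ k : ℕ in atTop,
      |h.val c (t + k) x + a * k - (c * x - a * t)| ≤ B := fun t x => by
    filter_upwards [hev t 1] with k hk
    have := hB _ hk x
    convert this using 2
    ring
  have hbd : ∀ t x, ∀ᶠ k : ℕ in atTop, |h.val c (t + k) x + a * k| ≤ B + |c * x - a * t| :=
    fun t x => by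
    filter_upwards [hbd' t x] with k hk
    have := abs_add_le (h.val c (t + k) x + a * k - (c * x - a * t)) (c * x - a * t)
    rw [sub_add_cancel] at this
    linarith
  have hdom : Dom h c univ w := by
    refine ⟨hc, isUpperSet_univ, fun γ hγ s _ t hst => ?_, fun t _ x => le_antisymm ?_ ?_⟩
    · refine liminf_le_liminf_add (hbd _ _) (hbd _ _) ?_
      filter_upwards [hev s 0] with k hk
      have := (Chain.of_orbit hγ hst).shift k 0
      simp only [Int.cast_natCast, Int.cast_zero, add_zero] at this
      linarith [val_le_add hc hk this]
    · refine liminf_le_liminf_add (hbd _ _) (hbd _ _) ?_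
      filter_upwards [hev t 0] with k hk
      linarith [(dom_val hc).per _ hk x]
    · have := liminf_le_liminf_add (d := -c) (hbd t x) (hbd t (x + 1)) (by
        filter_upwards [hev t 0] with k hk
        linarith [(dom_val hc).per _ hk x])
      linarith
  obtain ⟨L, hL0, hL⟩ := Dom.exists_lip h (h.C₀ + h.C₁ + h.K)
  obtain ⟨P, hP0, hP⟩ := h.exists_momentum_bound
    (h.C₀ + h.C₁ + h.K + (h.C₀ + h.C₁) * h.τ + 1)
  refine ⟨a, w, hdom, fun t x => ?_, exists_calibrated hdom fun t y => ?_⟩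
  · have h1 : (fun k : ℕ => h.val c (t + 1 + k) x + a * k) =
        fun k : ℕ => (fun k : ℕ => h.val c (t + k) x + a * k - a) (k + 1) := by
      funext k
      push_cast
      rw [show t + 1 + (k : ℝ) = t + (k + 1) by ring]
      ring
    simp only [hw]
    rw [h1, liminf_nat_add (fun k : ℕ => h.val c (t + k) x + a * k - a) 1]
    have hbda : ∀ᶠ k : ℕ in atTop, |h.val c (t + k) x + a * k - a| ≤
        B + |c * x - a * t| + |a| := (hbd t x).mono fun k hk => (abs_sub _ _).trans (by linarith)
    refine le_antisymm ?_ ?_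
    · exact liminf_le_liminf_add (d := -a) hbda (hbd t x) (Eventually.of_forall fun k => by linarith)
    · have := liminf_le_liminf_add (d := a) (hbd t x) hbda (Eventually.of_forall fun k => by linarith)
      linarith
  · set s := t - h.τ with hs
    have hst : s < t := by linarith
    have hk : ∀ n : ℕ, ∃ (k : ℕ) (z : ℝ × ℝ), n ≤ k ∧ 2 ≤ s + k ∧ (h.flow s z t).1 = y ∧
        |z.1 - y| ≤ h.C₀ + h.C₁ + h.K + (h.C₀ + h.C₁) * h.τ + 1 ∧ |z.2| ≤ P ∧
        h.val c (s + k) z.1 + a * k + h.act (h.flow s z) s t < w t y + 2 * (1 / ((n : ℝ) + 1)) := by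
      intro n
      have hε : 0 < 1 / ((n : ℝ) + 1) := by positivity
      have hε1 : 1 / ((n : ℝ) + 1) ≤ 1 := by
        rw [div_le_one (by positivity)]; linarith [n.cast_nonneg (α := ℝ)]
      have hfr := frequently_lt_of_liminf_lt (isCoboundedUnder_ge_of_abs (hbd t y))
        (show w t y < w t y + 1 / ((n : ℝ) + 1) by linarith)
      obtain ⟨k, hk1, hk2, hk3⟩ :=
        (hfr.and_eventually ((eventually_ge_atTop n).and (hev s 2))).exists
      obtain ⟨x, v, hv, hlt⟩ := exists_chain_split hc (by linarith : 0 ≤ s + k)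
        (by linarith : s + k ≤ t + k) y hε
      have hsk : s + k = t + k - h.τ := by rw [hs]; ring
      have hdx := (dom_val hc).abs_sub_le (t := t + k) (x := x) (y := y) (v := v)
        (by rw [← hsk]; exact (by linarith : (0:ℝ) ≤ s + k))
        (by rw [← hsk]; exact val_osc hc (by linarith))
        (by rw [← hsk]; exact hv) (by rw [← hsk]; linarith)
      have hv' := hv.shift (-k) 0
      simp only [Int.cast_neg, Int.cast_natCast, Int.cast_zero, add_zero,
        add_neg_cancel_right] at hv'
      obtain ⟨γ, hγ, h1, h2⟩ := exists_joining hst (by linarith : t ≤ s + h.τ) x y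
      have h3 := hv'.act_le hγ (by linarith) h1 h2
      have h4 := (hP γ hγ t (by rw [← hs, h1, h2]; exact hdx)).2
      refine ⟨k, γ s, hk2, hk3, ?_, ?_, h4, ?_⟩
      · rw [hγ.eq_flow, h2]
      · rw [h1, abs_sub_comm]; exact hdx
      · rw [hγ.eq_flow, h1]; linarith
    choose k z hk1 hk2 hk3 hk4 hk5 hk6 using hk
    have hcomp : IsCompact (Icc (y - (h.C₀ + h.C₁ + h.K + (h.C₀ + h.C₁) * h.τ + 1))
        (y + (h.C₀ + h.C₁ + h.K + (h.C₀ + h.C₁) * h.τ + 1)) ×ˢ Icc (-P) P) :=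
      isCompact_Icc.prod isCompact_Icc
    obtain ⟨z₀, -, φ, hφ, hlim⟩ := hcomp.tendsto_subseq (x := z) (fun n =>
      ⟨by have := abs_le.mp (hk4 n); constructor <;> linarith, abs_le.mp (hk5 n)⟩)
    have hflow : Continuous fun z => (h.flow s z t).1 := continuous_fst.comp
      ((continuous_flow s).comp (continuous_id.prodMk continuous_const))
    have hend : (h.flow s z₀ t).1 = y := by
      have := (hflow.tendsto z₀).comp hlim
      refine tendsto_nhds_unique this ?_
      simp only [Function.comp_def, hk3]
      exact tendsto_const_nhds
    refine ⟨h.flow s z₀, flow_isOrbit s z₀, hend, ?_⟩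
    refine le_antisymm (hdom.le_act _ (flow_isOrbit s z₀) s trivial t hst.le) ?_
    rw [hend, flow_self]
    refine le_of_forall_pos_le_add fun ε hε => ?_
    have hact := ((continuous_act_flow (h := h) s t).tendsto z₀).comp hlim
    have hz1 : Tendsto (fun n => |z₀.1 - (z (φ n)).1|) atTop (𝓝 0) := by
      have := ((continuous_const (y := z₀.1)).sub continuous_fst).abs.tendsto z₀ |>.comp hlim
      simpa [Function.comp_def] using this
    have h2n : Tendsto (fun n => 1 / ((φ n : ℝ) + 1)) atTop (𝓝 0) :=
      tendsto_one_div_add_atTop_nhds_zero_nat.comp hφ.tendsto_atTop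
    have hlim2 : Tendsto (fun n => w t y + 2 * (1 / ((φ n : ℝ) + 1)) + L * |z₀.1 - (z (φ n)).1|
        + ε - h.act (h.flow s (z (φ n))) s t) atTop
        (𝓝 (w t y + 2 * 0 + L * 0 + ε - h.act (h.flow s z₀) s t)) :=
      (((tendsto_const_nhds.add (h2n.const_mul 2)).add (hz1.const_mul L)).add
        tendsto_const_nhds).sub hact
    have hlast : w s z₀.1 ≤ w t y + 2 * 0 + L * 0 + ε - h.act (h.flow s z₀) s t := by
      refine ge_of_tendsto hlim2 ?_
      have hlo := eventually_lt_of_lt_liminf (show w s z₀.1 - ε < w s z₀.1 by linarith)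
        (isBoundedUnder_ge_of_abs (hbd s z₀.1))
      have hkt : Tendsto (fun n => k (φ n)) atTop atTop :=
        tendsto_atTop_mono (fun n => (hφ.id_le n).trans (hk1 (φ n))) tendsto_id
      filter_upwards [hkt.eventually hlo, hz1.eventually (ge_mem_nhds zero_lt_one)] with n hn hn1
      have e1 := hk6 (φ n)
      have e2 := hL c (Ici 0) (h.val c) (dom_val hc) (s + k (φ n))
        (by have := hk2 (φ n); have := h.τ_le; change (0:ℝ) ≤ _; linarith)
        (val_osc hc (by have := hk2 (φ n); have := h.τ_le; linarith)) (z (φ n)).1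
        (fun ε hε => exists_chain_split hc
          (by have := hk2 (φ n); have := h.τ_le; linarith) (by linarith) _ hε) z₀.1 hn1
      linarith
    linarith

end TameHam

theorem sub_le_mul_of_sub_le_add_sq {f : ℝ → ℝ} {R K : ℝ}
    (hf : ∀ x y, f y - f x ≤ R * |y - x| + K * (y - x) ^ 2) (x y : ℝ) :
    f y - f x ≤ R * |y - x| := by
  have key : ∀ (δ : ℝ) (n : ℕ), f (x + n * δ) - f x ≤ n * (R * |δ| + K * δ ^ 2) := by
    intro δ n
    induction n with
    | zero => simp
    | succ n ih =>
      have := hf (x + n * δ) (x + (n + 1 : ℕ) * δ)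
      push_cast at this ⊢
      rw [show x + ((n : ℝ) + 1) * δ - (x + n * δ) = δ by ring] at this
      linarith
  have hlim : Tendsto (fun n : ℕ => R * |y - x| + K * (y - x) ^ 2 * (1 / ((n : ℝ) + 1))) atTop
      (𝓝 (R * |y - x| + K * (y - x) ^ 2 * 0)) :=
    tendsto_const_nhds.add (tendsto_one_div_add_atTop_nhds_zero_nat.const_mul _)
  rw [mul_zero, add_zero] at hlim
  refine ge_of_tendsto hlim (Eventually.of_forall fun n => ?_)
  have h0 : (0 : ℝ) < (n : ℝ) + 1 := by positivity
  have := key ((y - x) / ((n : ℝ) + 1)) (n + 1)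
  push_cast at this
  rw [mul_div_cancel₀ _ h0.ne', add_sub_cancel, abs_div, abs_of_pos h0] at this
  refine this.trans (le_of_eq ?_)
  field_simp

namespace TameHam

variable {h : TameHam} {c a : ℝ} {w : ℝ → ℝ → ℝ}

theorem Dom.snd_le (hw : Dom h c univ w) {γ : ℝ → ℝ × ℝ} (hγ : h.IsOrbit γ) {t : ℝ}
    (hcal : Cal h w γ (t - 1) t) : |(γ t).2| ≤ h.R₁ := by
  have h1 := hw.le_add_one (mem_univ (t - 1)) (γ (t - 1)).1 (γ t).1
  rw [sub_add_cancel] at h1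
  have hc := abs_le.mp hw.abs_c_le
  have h2 := Chain.lower_orbit hγ (by linarith : t - 1 ≤ t) (e := c + 1)
    (abs_le.mpr ⟨by linarith, by linarith⟩)
  have h3 := Chain.lower_orbit hγ (by linarith : t - 1 ≤ t) (e := c - 1)
    (abs_le.mpr ⟨by linarith, by linarith⟩)
  unfold Cal at hcal
  obtain ⟨r, hr, hr'⟩ := exists_hasDerivAt_eq_slope (fun r => (γ r).1)
    (fun r => h.Gp r (γ r).1 (γ r).2) (by linarith : t - 1 < t)
    (fun r _ => (hγ.hasDerivAt_fst r).continuousAt.continuousWithinAt)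
    (fun r _ => hγ.hasDerivAt_fst r)
  rw [sub_sub_cancel, div_one] at hr'
  refine h.snd_le γ hγ r ?_ t ⟨hr.2.le, by linarith [hr.1]⟩
  rw [hr', abs_le]
  constructor <;> linarith

theorem WeakKAM.exists_cal (hw : WeakKAM h c a w) (t y : ℝ) : ∃ γ, h.IsOrbit γ ∧ (γ t).1 = y ∧
    (∀ s r, s ≤ r → r ≤ t → Cal h w γ s r) ∧ ∀ s ≤ t, |(γ s).2| ≤ h.R₁ := by
  obtain ⟨γ, hγ, hy, hcal⟩ := hw.cal t y
  have hc : ∀ s r, s ≤ r → r ≤ t → Cal h w γ s r := fun s r hsr hrt =>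
    hw.dom.cal_sub hγ (mem_univ s) (hcal s (hsr.trans hrt)) le_rfl hsr hrt
  exact ⟨γ, hγ, hy, hc, fun s hs => hw.dom.snd_le hγ (hc _ _ (by linarith) hs)⟩

theorem WeakKAM.sub_le_snd (hw : WeakKAM h c a w) (t x y : ℝ) :
    w t y - w t x ≤ h.R₁ * |y - x| := by
  have hτ := h.τ_pos
  have hm := h.m_pos
  refine sub_le_mul_of_sub_le_add_sq (f := w t) (K := 8 / (h.m * h.τ)) (fun x y => ?_) x y
  obtain ⟨γ, hγ, rfl, hcal, hR⟩ := hw.exists_cal t x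
  obtain ⟨η, hη, h1, h2⟩ := exists_joining (by linarith : t - h.τ < t) (by linarith)
    (γ (t - h.τ)).1 y
  have h3 := hγ.act_le_of_endpoint hη (by linarith : t - h.τ ≤ t) (by linarith) h1.symm
  have h4 := hγ.joining hη (by linarith : t - h.τ ≤ t) (by linarith) h1.symm
  have h5 := hw.dom.le_act η hη (t - h.τ) trivial t (by linarith)
  have h6 := hcal (t - h.τ) t (by linarith) le_rfl
  have h7 := hR t le_rfl
  unfold Cal at h6
  rw [h1, h2] at h5
  rw [h2] at h3 h4
  rw [sub_sub_cancel] at h4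
  have h8 : |(η t).2 - (γ t).2| ≤ ‖η t - γ t‖ := norm_snd_le (η t - γ t)
  have h9 : |(η t).2 - (γ t).2| ≤ 8 / (h.m * h.τ) * |y - (γ t).1| := by
    rw [div_mul_eq_mul_div, le_div_iff₀ (by positivity)]
    have := mul_le_mul_of_nonneg_right (h8.trans h4.2) (by positivity : 0 ≤ h.m * h.τ)
    linarith [h4.1]
  have h10 : (η t).2 * (y - (γ t).1) ≤ |(η t).2| * |y - (γ t).1| := by
    rw [← abs_mul]; exact le_abs_self _
  have h11 : |(η t).2| ≤ h.R₁ + 8 / (h.m * h.τ) * |y - (γ t).1| := by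
    have := abs_add_le ((η t).2 - (γ t).2) (γ t).2
    rw [sub_add_cancel] at this
    linarith
  have h12 := mul_le_mul_of_nonneg_right h11 (abs_nonneg (y - (γ t).1))
  rw [← sq_abs (y - (γ t).1)]
  linarith

theorem WeakKAM.abs_sub_le_snd (hw : WeakKAM h c a w) (t x y : ℝ) :
    |w t y - w t x| ≤ h.R₁ * |y - x| := by
  have h1 := hw.sub_le_snd t x y
  have h2 := hw.sub_le_snd t y x
  rw [abs_sub_comm x y] at h2
  rw [abs_le]
  constructor <;> linarith

theorem WeakKAM.R₁_nonneg (hw : WeakKAM h c a w) : 0 ≤ h.R₁ := by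
  simpa using (abs_nonneg _).trans (hw.abs_sub_le_snd 0 0 1)

theorem exists_speed (h : TameHam) : ∃ V, 0 ≤ V ∧ ∀ t x p, |p| ≤ h.R₁ → |h.Gp t x p| ≤ V := by
  obtain ⟨V, hV⟩ := exists_bound_of_periodic h.cont_Gp
    (fun t x p => h.Gp_add_one_t t x p) (fun t x p => h.Gp_add_one_x t x p) h.R₁
  exact ⟨max V 0, le_max_right _ _, fun t x p hp => (hV t x p hp).trans (le_max_left _ _)⟩

theorem IsOrbit.abs_fst_sub_le {γ : ℝ → ℝ × ℝ} (hγ : h.IsOrbit γ) {V s t : ℝ} (hst : s ≤ t)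
    (hV : ∀ r ∈ Icc s t, |h.Gp r (γ r).1 (γ r).2| ≤ V) : |(γ t).1 - (γ s).1| ≤ V * (t - s) := by
  have := (convex_Icc s t).norm_image_sub_le_of_norm_hasDerivWithin_le (f := fun r => (γ r).1)
    (fun r _ => (hγ.hasDerivAt_fst r).hasDerivWithinAt) hV (left_mem_Icc.mpr hst)
    (right_mem_Icc.mpr hst)
  simpa [abs_of_nonneg (sub_nonneg.mpr hst)] using this

theorem exists_lipschitz (h : TameHam) : ∃ L, 0 ≤ L ∧ ∀ c a w, WeakKAM h c a w →
    ∀ s t x y, |w t y - w s x| ≤ L * (|t - s| + |y - x|) := by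
  obtain ⟨V, hV0, hV⟩ := h.exists_speed
  have hC₀ := h.C₀_nonneg
  have hC₁ := h.C₁_nonneg
  have hK := h.K_nonneg
  refine ⟨h.C₀ + h.C₁ + (V + 1) * (|h.R₁| + h.K), by positivity, fun c a w hw => ?_⟩
  have hR := hw.R₁_nonneg
  rw [abs_of_nonneg hR]
  set L := h.C₀ + h.C₁ + (V + 1) * (h.R₁ + h.K) with hL
  have ht : ∀ s t y, s ≤ t → |w t y - w s y| ≤ L * (t - s) := by
    intro s t y hst
    have h0 : 0 ≤ t - s := by linarith
    have h1 := hw.dom.straight (x := y) (y := y) (mem_univ s) hst (by simpa using hst)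
    obtain ⟨γ, hγ, rfl, hcal, hp⟩ := hw.exists_cal t y
    have h2 := hcal s t hst le_rfl
    have h3 := Chain.lower_orbit hγ hst (e := c) (by linarith [hw.dom.abs_c_le])
    have h4 := hγ.abs_fst_sub_le hst fun r hr => hV r (γ r).1 _ (hp r hr.2)
    have h5 := (abs_le.mp (hw.abs_sub_le_snd s (γ s).1 (γ t).1)).2
    have h6 : -(h.K * (V * (t - s))) ≤ c * ((γ t).1 - (γ s).1) := by
      refine (abs_le.mp ?_).1
      rw [abs_mul]
      exact mul_le_mul hw.dom.abs_c_le h4 (abs_nonneg _) hK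
    have h7 := mul_le_mul_of_nonneg_left h4 hR
    unfold Cal at h2
    have e1 : 0 ≤ h.C₀ * (t - s) := by positivity
    have e2 : 0 ≤ h.C₁ * (t - s) := by positivity
    have e3 : 0 ≤ V * (h.R₁ + h.K) * (t - s) := by positivity
    have e4 : 0 ≤ (h.R₁ + h.K) * (t - s) := by positivity
    rw [hL, abs_le]
    constructor <;> linarith
  intro s t x y
  have h1 : |w t y - w s y| ≤ L * |t - s| := by
    rcases le_total s t with hst | hst
    · rw [abs_of_nonneg (by linarith : 0 ≤ t - s)]; exact ht s t y hst
    · rw [abs_sub_comm, abs_sub_comm t s, abs_of_nonneg (by linarith : 0 ≤ s - t)]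
      exact ht t s y hst
  have h2 := hw.abs_sub_le_snd s x y
  have h3 : h.R₁ * |y - x| ≤ L * |y - x| := by
    gcongr
    rw [hL]
    nlinarith [mul_nonneg hV0 (add_nonneg hR hK)]
  have := abs_sub_le (w t y) (w s y) (w s x)
  linarith

end TameHam

namespace TameHam

variable {h : TameHam} {c a : ℝ} {u w : ℝ → ℝ → ℝ}

/-- Two backward calibrated orbits of the same function stay at a bounded distance. -/
theorem Dom.abs_sub_sub_le (hu : Dom h c univ u) {γ η : ℝ → ℝ × ℝ} (hγ : h.IsOrbit γ)
    (hη : h.IsOrbit η) {s t : ℝ} (hst : s ≤ t) (h1 : Cal h u γ s t) (h2 : Cal h u η s t) :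
    |((γ t).1 - (η t).1) - ((γ s).1 - (η s).1)| ≤ 1 := by
  by_contra! hlt
  set d : ℝ → ℝ := fun r => (γ r).1 - (η r).1 with hd
  have hdc : Continuous d := (continuous_fst.comp hγ.continuous).sub (continuous_fst.comp hη.continuous)
  change 1 < |d t - d s| at hlt
  have hk : ∃ k : ℤ, ∃ r ∈ Ioo s t, d r = k ∧ d s ≠ k := by
    rcases lt_or_ge (d s) (d t) with hlt' | hge
    · rw [abs_of_pos (by linarith)] at hlt
      refine ⟨⌊d s⌋ + 1, ?_⟩
      have e1 := Int.lt_floor_add_one (d s)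
      have e2 := Int.floor_le (d s)
      obtain ⟨r, hr, hr'⟩ := intermediate_value_Ioo hst hdc.continuousOn
        (show ((⌊d s⌋ + 1 : ℤ) : ℝ) ∈ Ioo (d s) (d t) by push_cast; constructor <;> linarith)
      exact ⟨r, hr, hr', by push_cast; linarith⟩
    · rw [abs_of_nonpos (by linarith)] at hlt
      refine ⟨⌊d t⌋ + 1, ?_⟩
      have e1 := Int.lt_floor_add_one (d t)
      have e2 := Int.floor_le (d t)
      obtain ⟨r, hr, hr'⟩ := intermediate_value_Ioo' hst hdc.continuousOn
        (show ((⌊d t⌋ + 1 : ℤ) : ℝ) ∈ Ioo (d t) (d s) by push_cast; constructor <;> linarith)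
      exact ⟨r, hr, hr', by push_cast; linarith⟩
  obtain ⟨k, r, hr, hrk, hsk⟩ := hk
  have h3 := hu.cal_sub hγ (mem_univ s) h1 le_rfl hr.1.le hr.2.le
  have h4 : Cal h u (fun t => ((η (t + (0 : ℤ))).1 + k, (η (t + (0 : ℤ))).2)) r t := by
    have := hu.cal_sub hη (mem_univ s) h2 hr.1.le hr.2.le le_rfl
    unfold Cal at this ⊢
    rw [act_shift, hu.per_int (mem_univ _), hu.per_int (mem_univ _)]
    simp only [Int.cast_zero, add_zero]
    linarith
  have h5 := hu.crossing hγ (hη.shift 0 k) (mem_univ s) hr.1 hr.2 h3 h4 (by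
    simp only [hd] at hrk
    simp only [Int.cast_zero, add_zero]
    linarith)
  apply hsk
  have h6 := congrArg Prod.fst (congrFun h5 s)
  simp only [Int.cast_zero, add_zero] at h6
  simp only [hd]
  linarith

theorem WeakKAM.time_int (hw : WeakKAM h c a w) (k : ℤ) (t x : ℝ) : w (t + k) x = w t x - a * k := by
  have := TameHam.per_int (f := fun t => w t x + a * t) (fun t => by rw [hw.time]; ring) k t
  linarith

/-- Backward calibrated orbits have a rotation number. -/
theorem WeakKAM.exists_rotation (hw : WeakKAM h c a w) {γ : ℝ → ℝ × ℝ} (hγ : h.IsOrbit γ)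
    (hcal : ∀ s r, s ≤ r → r ≤ 0 → Cal h w γ s r) :
    ∃ ρ : ℝ, ∀ n : ℕ, |(γ 0).1 - (γ (-n)).1 - n * ρ| ≤ 1 := by
  refine exists_abs_sub_mul_le (f := fun n : ℕ => (γ 0).1 - (γ (-n)).1) fun i j => ?_
  have hi : -(i : ℝ) ≤ 0 := by simp
  have hj : -(j : ℝ) ≤ 0 := by simp
  have h2 : Cal h w (fun t => ((γ (t + (-j : ℤ))).1 + (0 : ℤ), (γ (t + (-j : ℤ))).2)) (-i) 0 := by
    have := hcal (-i + (-j : ℤ)) (0 + (-j : ℤ)) (by linarith) (by push_cast; linarith)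
    unfold Cal at this ⊢
    rw [act_shift]
    rw [hw.time_int, hw.time_int] at this
    simp only [Int.cast_zero, add_zero]
    linarith
  have := hw.dom.abs_sub_sub_le hγ (hγ.shift (-j) 0) hi (hcal _ _ hi le_rfl) h2
  simp only [Int.cast_neg, Int.cast_natCast, Int.cast_zero, add_zero, zero_add] at this
  push_cast
  rw [abs_sub_comm] at this
  convert this using 2
  rw [show -((i : ℝ) + j) = -i + -j by ring]
  ring

theorem nonpos_of_forall_nat_mul_le {x B : ℝ} (hx : ∀ n : ℕ, n * x ≤ B) : x ≤ 0 := by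
  by_contra! hpos
  obtain ⟨n, hn⟩ := exists_nat_gt (B / x)
  rw [div_lt_iff₀ hpos] at hn
  linarith [hx n]

theorem WeakKAM.exists_osc (hw : WeakKAM h c a w) : ∃ B, ∀ x, |w 0 x - c * x| ≤ B := by
  obtain ⟨L, hL0, hL⟩ := h.exists_lipschitz
  refine ⟨|w 0 0| + L + |c|, fun x => ?_⟩
  have h1 := hw.dom.per_int (mem_univ 0) x (-⌊x⌋)
  have h2 := hL c a w hw 0 0 0 (x + (-⌊x⌋ : ℤ))
  push_cast at h1 h2
  have e1 := Int.floor_le x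
  have e2 := Int.lt_floor_add_one x
  have h3 : |x + -(⌊x⌋ : ℝ)| ≤ 1 := by rw [abs_le]; constructor <;> linarith
  simp only [sub_zero, abs_zero, zero_add] at h2
  have h4 : |c * (x + -(⌊x⌋ : ℝ))| ≤ |c| := by
    rw [abs_mul]; exact mul_le_of_le_one_right (abs_nonneg _) h3
  have h5 : L * |x + -(⌊x⌋ : ℝ)| ≤ L := mul_le_of_le_one_right hL0 h3
  have : w 0 x - c * x = w 0 0 + (w 0 (x + -(⌊x⌋ : ℝ)) - w 0 0) - c * (x + -(⌊x⌋ : ℝ)) := by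
    linarith
  rw [this]
  refine (abs_sub _ _).trans ?_
  have := abs_add_le (w 0 0) (w 0 (x + -(⌊x⌋ : ℝ)) - w 0 0)
  linarith

/-- The rotation number is a subgradient of the critical value. -/
theorem WeakKAM.subgradient (hw : WeakKAM h c a w) {c' a' : ℝ} {w' : ℝ → ℝ → ℝ}
    (hw' : WeakKAM h c' a' w') {γ : ℝ → ℝ × ℝ} (hγ : h.IsOrbit γ)
    (hcal : ∀ s r, s ≤ r → r ≤ 0 → Cal h w' γ s r) {ρ : ℝ}
    (hρ : ∀ n : ℕ, |(γ 0).1 - (γ (-n)).1 - n * ρ| ≤ 1) : a' + (c - c') * ρ ≤ a := by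
  obtain ⟨B, hB⟩ := hw.exists_osc
  obtain ⟨B', hB'⟩ := hw'.exists_osc
  suffices a' + (c - c') * ρ - a ≤ 0 by linarith
  refine nonpos_of_forall_nat_mul_le (B := 2 * B + 2 * B' + |c - c'|) fun n => ?_
  have hn : -(n : ℝ) ≤ 0 := by simp
  have h1 := hw.dom.le_act γ hγ (-n) trivial 0 hn
  have h2 := hcal _ _ hn le_rfl
  have h3 := hw.time_int n (-n) (γ (-n)).1
  have h4 := hw'.time_int n (-n) (γ (-n)).1
  unfold Cal at h2
  simp only [Int.cast_natCast, neg_add_cancel] at h3 h4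
  have e1 := abs_le.mp (hB (γ 0).1)
  have e2 := abs_le.mp (hB (γ (-n)).1)
  have e3 := abs_le.mp (hB' (γ 0).1)
  have e4 := abs_le.mp (hB' (γ (-n)).1)
  have h5 : |(c - c') * ((γ 0).1 - (γ (-n)).1 - n * ρ)| ≤ |c - c'| := by
    rw [abs_mul]; exact mul_le_of_le_one_right (abs_nonneg _) (hρ n)
  have e5 := (abs_le.mp h5).1
  linarith

theorem exists_ultrafilter_lim {ι : Type*} (U : Ultrafilter ι) {f : ι → ℝ} {B : ℝ}
    (hf : ∀ᶠ i in (U : Filter ι), |f i| ≤ B) : ∃ x, Tendsto f U (𝓝 x) := by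
  have h1 : ↑(U.map f) ≤ 𝓟 (Icc (-B) B) := by
    rw [le_principal_iff, Ultrafilter.coe_map, mem_map]
    filter_upwards [hf] with i hi using abs_le.mp hi
  obtain ⟨x, -, hx⟩ := isCompact_Icc.ultrafilter_le_nhds (U.map f) h1
  exact ⟨x, hx⟩

theorem tendsto_rotation {A ρ : ℝ → ℝ} {W : ℝ → ℝ → ℝ → ℝ} {Γ : ℝ → ℝ → ℝ × ℝ}
    (hW : ∀ c, |c| ≤ h.K → WeakKAM h c (A c) (W c)) (hΓ : ∀ c, |c| ≤ h.K → h.IsOrbit (Γ c))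
    (hΓ0 : ∀ c, |c| ≤ h.K → (Γ c 0).1 = 0)
    (hcal : ∀ c, |c| ≤ h.K → ∀ s r, s ≤ r → r ≤ 0 → Cal h (W c) (Γ c) s r)
    (hp : ∀ c, |c| ≤ h.K → |(Γ c 0).2| ≤ h.R₁)
    (hρ : ∀ c, |c| ≤ h.K → ∀ n : ℕ, |(Γ c 0).1 - (Γ c (-n)).1 - n * ρ c| ≤ 1) :
    ContinuousOn ρ {c | |c| ≤ h.K} := by
  intro c₀ hc₀
  obtain ⟨L, hL0, hL⟩ := h.exists_lipschitz
  rw [ContinuousWithinAt, tendsto_iff_ultrafilter]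
  intro U hU
  have hUK : ∀ᶠ c in (U : Filter ℝ), |c| ≤ h.K := hU (eventually_mem_nhdsWithin)
  have hUc : Tendsto id (U : Filter ℝ) (𝓝 c₀) := tendsto_id'.mpr (hU.trans nhdsWithin_le_nhds)
  have hlimW : ∀ t x, ∃ l, Tendsto (fun c => W c t x - W c 0 0) U (𝓝 l) := fun t x =>
    exists_ultrafilter_lim U (B := L * (|t| + |x|)) <| hUK.mono fun c hc => by
      simpa using hL _ _ _ (hW c hc) 0 t 0 x
  choose v hv using hlimW
  obtain ⟨p, hpl⟩ := exists_ultrafilter_lim U (hUK.mono hp)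
  set η := h.flow 0 (0, p) with hη
  have hηo : h.IsOrbit η := flow_isOrbit _ _
  have hz : Tendsto (fun c => Γ c 0) U (𝓝 (0, p)) := by
    refine Tendsto.prodMk_nhds ?_ hpl
    exact tendsto_const_nhds.congr' (hUK.mono fun c hc => (hΓ0 c hc).symm)
  have hΓl : ∀ s, Tendsto (fun c => Γ c s) U (𝓝 (η s)) := fun s => by
    have : Continuous fun z => h.flow 0 z s :=
      (continuous_flow 0).comp (continuous_id.prodMk continuous_const)
    refine ((this.tendsto _).comp hz).congr' (hUK.mono fun c hc => ?_)
    simp only [Function.comp_apply, (hΓ c hc).eq_flow]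
  have hvdom : Dom h c₀ univ v := by
    refine ⟨hc₀, isUpperSet_univ, fun γ hγ s _ t hst => ?_, fun t _ x => ?_⟩
    · refine le_of_tendsto_of_tendsto (hv _ _) ((hv _ _).add_const _) (hUK.mono fun c hc => ?_)
      linarith [(hW c hc).dom.le_act γ hγ s trivial t hst]
    · refine tendsto_nhds_unique (hv _ _) (((hv t x).add hUc).congr' (hUK.mono fun c hc => ?_))
      have := (hW c hc).dom.per t trivial x
      simp only [id]
      linarith
  have hvcal : ∀ s ≤ 0, Cal h v η s 0 := fun s hs => by
    have hact : Tendsto (fun c => h.act (Γ c) s 0) U (𝓝 (h.act η s 0)) := by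
      have h1 : Tendsto (fun c => h.act (h.flow s (Γ c s)) s 0) U
          (𝓝 (h.act (h.flow s (η s)) s 0)) :=
        ((continuous_act_flow (h := h) s 0).tendsto (η s)).comp (hΓl s)
      rw [hηo.eq_flow] at h1
      exact h1.congr' (hUK.mono fun c hc => by rw [(hΓ c hc).eq_flow])
    have h2 : Tendsto (fun c => W c s (Γ c s).1 - W c 0 0) U (𝓝 (v s (η s).1)) := by
      have h3 : Tendsto (fun c => L * |(Γ c s).1 - (η s).1|) U (𝓝 0) := by
        have := (((continuous_fst.tendsto _).comp (hΓl s)).sub_const (η s).1).abs.const_mul L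
        simpa [Function.comp_def] using this
      have h4 : Tendsto (fun c => W c s (Γ c s).1 - W c s (η s).1) U (𝓝 0) := by
        refine squeeze_zero_norm' (hUK.mono fun c hc => ?_) h3
        simpa using hL _ _ _ (hW c hc) s s (η s).1 (Γ c s).1
      have := h4.add (hv s (η s).1)
      rw [zero_add] at this
      refine this.congr fun c => by ring
    have h0 : Tendsto (fun c => W c 0 (Γ c 0).1 - W c 0 0) U (𝓝 (v 0 (η 0).1)) := by
      have : (η 0).1 = 0 := by rw [hη, flow_self]
      rw [this]
      exact (hv 0 0).congr' (hUK.mono fun c hc => by simp only [hΓ0 c hc])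
    refine tendsto_nhds_unique h0 ((h2.add hact).congr' (hUK.mono fun c hc => ?_))
    have := hcal c hc s 0 hs le_rfl
    unfold Cal at this
    linarith
  set k := W c₀ 0 0 - v 0 0 with hk
  set u : ℝ → ℝ → ℝ := fun t x => min (W c₀ t x) (v t x + k) with hu
  have hudom : Dom h c₀ univ u := by
    refine ⟨hc₀, isUpperSet_univ, fun γ hγ s _ t hst => ?_, fun t _ x => ?_⟩
    · simp only [hu]
      rw [← min_add_add_right]
      refine min_le_min ((hW c₀ hc₀).dom.le_act γ hγ s trivial t hst) ?_
      linarith [hvdom.le_act γ hγ s trivial t hst]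
    · simp only [hu]
      rw [(hW c₀ hc₀).dom.per t trivial x, hvdom.per t trivial x, ← min_add_add_right]
      congr 1; ring
  have hη0 : (η 0).1 = 0 := by rw [hη, flow_self]
  have hu0 : u 0 0 = W c₀ 0 0 := by simp only [hu, hk]; rw [add_sub_cancel, min_self]
  have hucal1 : ∀ s ≤ 0, Cal h u η s 0 := fun s hs => by
    refine le_antisymm (hudom.le_act η hηo s trivial 0 hs) ?_
    have h1 := hvcal s hs
    unfold Cal at h1
    rw [hη0] at h1
    rw [hη0, hu0]
    have : u s (η s).1 ≤ v s (η s).1 + k := min_le_right _ _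
    linarith
  have hucal2 : ∀ s ≤ 0, Cal h u (Γ c₀) s 0 := fun s hs => by
    refine le_antisymm (hudom.le_act _ (hΓ c₀ hc₀) s trivial 0 hs) ?_
    have h1 := hcal c₀ hc₀ s 0 hs le_rfl
    unfold Cal at h1
    rw [hΓ0 c₀ hc₀] at h1 ⊢
    rw [hu0]
    have : u s (Γ c₀ s).1 ≤ W c₀ s (Γ c₀ s).1 := min_le_left _ _
    linarith
  rw [Metric.tendsto_nhds]
  intro ε hε
  obtain ⟨n, hn⟩ := exists_nat_gt (4 / ε)
  have hn0 : (0 : ℝ) < n := (by positivity : 0 < 4 / ε).trans hn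
  rw [div_lt_iff₀ hε] at hn
  have hns : -(n : ℝ) ≤ 0 := by linarith
  have h1 := hudom.abs_sub_sub_le hηo (hΓ c₀ hc₀) hns (hucal1 _ hns) (hucal2 _ hns)
  have h2 : Tendsto (fun c => (Γ c (-n)).1) U (𝓝 (η (-n)).1) :=
    (continuous_fst.tendsto _).comp (hΓl (-n))
  filter_upwards [hUK, Metric.tendsto_nhds.mp h2 1 one_pos] with c hc h3
  rw [Real.dist_eq] at h3 ⊢
  have h4 := hρ c hc n
  have h5 := hρ c₀ hc₀ n
  rw [hΓ0 c₀ hc₀] at h1 h5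
  rw [hΓ0 c hc] at h4
  rw [hη0] at h1
  have h6 : n * |ρ c - ρ c₀| < n * ε := by
    rw [← abs_of_pos hn0, ← abs_mul, abs_of_pos hn0]
    rw [abs_le] at h1 h4 h5
    rw [abs_lt] at h3
    refine lt_of_le_of_lt (abs_le.mpr ⟨?_, ?_⟩) hn <;> linarith
  exact lt_of_mul_lt_mul_left h6 hn0.le

/-- The critical value is locally convex and `C¹`. -/
theorem exists_critical (h : TameHam) : ∃ A ρ : ℝ → ℝ, (∀ c, |c| ≤ h.K → ∃ w, WeakKAM h c (A c) w) ∧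
    ContinuousOn ρ {c | |c| ≤ h.K} ∧
    ∀ c c', |c| ≤ h.K → |c'| ≤ h.K → A c' + (c - c') * ρ c' ≤ A c := by
  have h1 : ∀ c, ∃ a w, |c| ≤ h.K → WeakKAM h c a w := fun c => by
    by_cases hc : |c| ≤ h.K
    · obtain ⟨a, w, hw⟩ := h.exists_weakKAM hc
      exact ⟨a, w, fun _ => hw⟩
    · exact ⟨0, 0, fun hc' => absurd hc' hc⟩
  choose A W hW using h1
  have h2 : ∀ c, ∃ γ, |c| ≤ h.K → h.IsOrbit γ ∧ (γ 0).1 = 0 ∧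
      (∀ s r, s ≤ r → r ≤ 0 → Cal h (W c) γ s r) ∧ |(γ 0).2| ≤ h.R₁ := fun c => by
    by_cases hc : |c| ≤ h.K
    · obtain ⟨γ, e1, e2, e3, e4⟩ := (hW c hc).exists_cal 0 0
      exact ⟨γ, fun _ => ⟨e1, e2, e3, e4 0 le_rfl⟩⟩
    · exact ⟨0, fun hc' => absurd hc' hc⟩
  choose Γ hΓ using h2
  have h3 : ∀ c, ∃ ρ : ℝ, |c| ≤ h.K → ∀ n : ℕ, |(Γ c 0).1 - (Γ c (-n)).1 - n * ρ| ≤ 1 := fun c => by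
    by_cases hc : |c| ≤ h.K
    · obtain ⟨ρ, hρ⟩ := (hW c hc).exists_rotation (hΓ c hc).1 (hΓ c hc).2.2.1
      exact ⟨ρ, fun _ => hρ⟩
    · exact ⟨0, fun hc' => absurd hc' hc⟩
  choose ρ hρ using h3
  refine ⟨A, ρ, fun c hc => ⟨W c, hW c hc⟩, ?_, fun c c' hc hc' => ?_⟩
  · exact tendsto_rotation hW (fun c hc => (hΓ c hc).1) (fun c hc => (hΓ c hc).2.1)
      (fun c hc => (hΓ c hc).2.2.1) (fun c hc => (hΓ c hc).2.2.2) hρ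
  · exact (hW c hc).subgradient (hW c' hc') (hΓ c' hc').1 (hΓ c' hc').2.2.1 (hρ c' hc')

end TameHam

theorem fderiv_apply_fst {φ : ℝ × ℝ → ℝ} {t x d : ℝ} (hφ : DifferentiableAt ℝ φ (t, x))
    (hd : HasDerivAt (fun r => φ (r, x)) d t) : fderiv ℝ φ (t, x) (1, 0) = d :=
  (hφ.hasFDerivAt.comp_hasDerivAt t ((hasDerivAt_id t).prodMk (hasDerivAt_const t x))).unique hd

theorem fderiv_apply_snd {φ : ℝ × ℝ → ℝ} {t x d : ℝ} (hφ : DifferentiableAt ℝ φ (t, x))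
    (hd : HasDerivAt (fun r => φ (t, r)) d x) : fderiv ℝ φ (t, x) (0, 1) = d :=
  (hφ.hasFDerivAt.comp_hasDerivAt x ((hasDerivAt_const x t).prodMk (hasDerivAt_id x))).unique hd

/-- Minimum point in the doubling of variables. -/
theorem exists_doubling_min {u w : ℝ → ℝ → ℝ} {g : ℝ → ℝ} {t₀ T L ε : ℝ} (hT : t₀ ≤ T)
    (hu : ContinuousOn (fun z : ℝ × ℝ => u z.1 z.2) (Ici t₀ ×ˢ univ))
    (hup : ∀ t x, u t (x + 1) = u t x) (hwp : ∀ t x, w t (x + 1) = w t x)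
    (hw : ∀ s t x y, |w t y - w s x| ≤ L * (|t - s| + |y - x|)) (hg : Continuous g)
    (hL : 0 ≤ L) (hε : 0 < ε) (hε1 : 2 * L * ε < 1) :
    ∃ t ∈ Icc t₀ T, ∃ x ∈ Icc (0 : ℝ) 1, ∃ s y, |t - s| + |x - y| ≤ 2 * L * ε ∧
      ∀ t' ∈ Icc t₀ T, ∀ x' s' y', u t x - w s y + ((t - s) ^ 2 + (x - y) ^ 2) / ε + g t ≤
        u t' x' - w s' y' + ((t' - s') ^ 2 + (x' - y') ^ 2) / ε + g t' := by
  set Φ : ℝ × ℝ × ℝ × ℝ → ℝ := fun q =>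
    u q.1 q.2.1 - w q.2.2.1 q.2.2.2 + ((q.1 - q.2.2.1) ^ 2 + (q.2.1 - q.2.2.2) ^ 2) / ε + g q.1
  set Q : Set (ℝ × ℝ × ℝ × ℝ) :=
    Icc t₀ T ×ˢ (Icc 0 1 ×ˢ (Icc (t₀ - 1) (T + 1) ×ˢ Icc (-1) 2))
  have hwc : Continuous fun z : ℝ × ℝ => w z.1 z.2 := by
    rw [continuous_iff_continuousAt]
    intro z
    refine tendsto_iff_dist_tendsto_zero.mpr ?_
    have h1 : Tendsto (fun z' : ℝ × ℝ => L * (|z'.1 - z.1| + |z'.2 - z.2|)) (𝓝 z) (𝓝 0) := by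
      have : Continuous fun z' : ℝ × ℝ => L * (|z'.1 - z.1| + |z'.2 - z.2|) := by fun_prop
      simpa using this.tendsto z
    exact squeeze_zero (fun _ => dist_nonneg) (fun z' => hw _ _ _ _) h1
  have hΦ : ContinuousOn Φ Q := by
    refine ContinuousOn.add (ContinuousOn.add (ContinuousOn.sub ?_ ?_) ?_) ?_
    · exact hu.comp (f := fun q : ℝ × ℝ × ℝ × ℝ => (q.1, q.2.1)) (by fun_prop)
        (fun q hq => ⟨hq.1.1, trivial⟩)
    · exact (hwc.comp (by fun_prop : Continuous fun q : ℝ × ℝ × ℝ × ℝ =>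
        (q.2.2.1, q.2.2.2))).continuousOn
    · fun_prop
    · exact (hg.comp continuous_fst).continuousOn
  have hQ : IsCompact Q :=
    isCompact_Icc.prod (isCompact_Icc.prod (isCompact_Icc.prod isCompact_Icc))
  obtain ⟨⟨t, x, s, y⟩, ⟨ht, hx, hs, hy⟩, hmin⟩ := hQ.exists_isMinOn
    ⟨(t₀, 0, t₀, 0), ⟨le_rfl, hT⟩, by simp, ⟨by simp, by linarith⟩, by simp⟩ hΦ
  have hdiag : ∀ t x s y, 2 * L * ε ≤ |t - s| + |x - y| →
      Φ (t, x, t, x) ≤ Φ (t, x, s, y) := by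
    intro t x s y hd
    have h1 := (abs_le.mp (hw t s x y)).2
    have h2 : L * (|t - s| + |x - y|) ≤ ((t - s) ^ 2 + (x - y) ^ 2) / ε := by
      rw [le_div_iff₀ hε, ← sq_abs (t - s), ← sq_abs (x - y)]
      nlinarith [sq_nonneg (|t - s| - |x - y|), abs_nonneg (t - s), abs_nonneg (x - y)]
    rw [abs_sub_comm s t, abs_sub_comm y x] at h1
    simp only [Φ]
    simp
    linarith
  have hnear : ∀ t' ∈ Icc t₀ T, ∀ x' s' y', |t' - s'| + |x' - y'| ≤ 1 →
      Φ (t, x, s, y) ≤ Φ (t', x', s', y') := by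
    intro t' ht' x' s' y' hd
    have e1 := abs_nonneg (t' - s')
    have e2 := abs_nonneg (x' - y')
    have e3 := abs_le.mp (show |t' - s'| ≤ 1 by linarith)
    have e4 := abs_le.mp (show |x' - y'| ≤ 1 by linarith)
    have e5 := Int.floor_le x'
    have e6 := Int.lt_floor_add_one x'
    have h1 := hmin (a := (t', x' + (-⌊x'⌋ : ℤ), s', y' + (-⌊x'⌋ : ℤ))) (by
      push_cast
      refine ⟨ht', ⟨?_, ?_⟩, ⟨?_, ?_⟩, ⟨?_, ?_⟩⟩ <;> simp only <;> linarith [ht'.1, ht'.2])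
    simp only [mem_ofPred_eq, Φ] at h1
    rw [TameHam.per_int (hup t'), TameHam.per_int (hwp s')] at h1
    simpa [Φ] using h1
  have hall : ∀ t' ∈ Icc t₀ T, ∀ x' s' y', Φ (t, x, s, y) ≤ Φ (t', x', s', y') := by
    intro t' ht' x' s' y'
    rcases le_total (|t' - s'| + |x' - y'|) 1 with hd | hd
    · exact hnear t' ht' x' s' y' hd
    · exact (hnear t' ht' x' t' x' (by simp)).trans (hdiag _ _ _ _ (by linarith))
  refine ⟨t, ht, x, hx, s, y, ?_, hall⟩
  have h1 := hall t ht x t x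
  have h2 := (abs_le.mp (hw t s x y)).2
  rw [abs_sub_comm s t, abs_sub_comm y x] at h2
  simp only [Φ] at h1
  have h3 : ((t - s) ^ 2 + (x - y) ^ 2) / ε ≤ L * (|t - s| + |x - y|) := by
    simp at h1
    linarith
  rw [div_le_iff₀ hε, ← sq_abs (t - s), ← sq_abs (x - y)] at h3
  by_contra! hlt
  nlinarith [sq_nonneg (|t - s| - |x - y|), abs_nonneg (t - s), abs_nonneg (x - y),
    (by positivity : 0 ≤ 2 * L * ε)]

/-- Comparison principle between a supersolution and a Lipschitz subsolution. -/
theorem le_sub_of_viscosity {H : ℝ → ℝ → ℝ → ℝ}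
    (hH : Continuous fun q : ℝ × ℝ × ℝ => H q.1 q.2.1 q.2.2) {c t₀ L m₀ : ℝ} {u w : ℝ → ℝ → ℝ}
    (hu : ContinuousOn (fun z : ℝ × ℝ => u z.1 z.2) (Ici t₀ ×ˢ univ))
    (hup : ∀ t x, u t (x + 1) = u t x) (hsup : ViscSuperSol H c 0 (Ioi t₀ ×ˢ univ) u)
    (hwp : ∀ t x, w t (x + 1) = w t x) (hL : 0 ≤ L)
    (hw : ∀ s t x y, |w t y - w s x| ≤ L * (|t - s| + |y - x|))
    (hsub : ViscSubSol H c 0 univ w) (hm : ∀ x, m₀ ≤ u t₀ x - w t₀ x) :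
    ∀ t, t₀ ≤ t → ∀ x, m₀ ≤ u t x - w t x := by
  intro t₁ ht₁ x₁
  by_contra! hlt
  have ht₁' : t₀ < t₁ := ht₁.lt_of_ne fun h => by
    rw [← h] at hlt; exact absurd (hm x₁) (not_le.mpr hlt)
  set T := t₁ + 1 with hT
  obtain ⟨δ, hδ, hδ'⟩ : ∃ δ > 0, u t₁ x₁ - w t₁ x₁ + 2 * δ < m₀ :=
    ⟨(m₀ - (u t₁ x₁ - w t₁ x₁)) / 3, by linarith, by linarith⟩
  obtain ⟨B, hB⟩ : ∃ B, ∀ x, B ≤ u T x - w T x := by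
    obtain ⟨x₀, -, hx₀⟩ := (isCompact_Icc (a := (0 : ℝ)) (b := 1)).exists_isMinOn ⟨0, by simp⟩
      (f := fun x => u T x) (hu.comp (f := fun x => (T, x)) (by fun_prop)
        fun x _ => ⟨by simp only [mem_Ici]; linarith, trivial⟩)
    refine ⟨u T x₀ - (|w T 0| + L), fun x => ?_⟩
    have e1 := Int.floor_le x
    have e2 := Int.lt_floor_add_one x
    have hx : x + (-⌊x⌋ : ℤ) ∈ Icc (0 : ℝ) 1 := by push_cast; constructor <;> linarith
    have h1 := hx₀ hx
    have h2 := hw T T 0 (x + (-⌊x⌋ : ℤ))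
    simp only [mem_ofPred_eq] at h1
    rw [TameHam.per_int (hup T)] at h1
    rw [TameHam.per_int (hwp T), sub_self, abs_zero, zero_add, sub_zero,
      abs_of_nonneg hx.1] at h2
    have h3 := (abs_le.mp h2).2
    have h4 := mul_le_of_le_one_right hL hx.2
    have h5 := le_abs_self (w T 0)
    linarith
  obtain ⟨N, hN1, hN⟩ : ∃ N : ℝ, 0 < N ∧ m₀ + δ < B + δ * Real.exp N := by
    have : Tendsto (fun N => B + δ * Real.exp N) atTop atTop :=
      tendsto_atTop_add_const_left _ _ (Real.tendsto_exp_atTop.const_mul_atTop hδ)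
    exact ((eventually_gt_atTop 0).and (this.eventually_gt_atTop _)).exists
  set g : ℝ → ℝ := fun t => δ * Real.exp (N * (t - t₁)) with hg
  have hgd : ∀ t, HasDerivAt g (N * g t) t := fun t => by
    have := ((((hasDerivAt_id t).sub_const t₁).const_mul N).exp).const_mul δ
    exact this.congr_deriv (by simp only [hg, id]; ring)
  set κ := N * g t₀ with hκ
  have hκ0 : 0 < κ := by simp only [hκ, hg]; positivity
  set P := |c| + 4 * L with hP
  obtain ⟨r, hr, hr'⟩ : ∃ r > 0, ∀ t ∈ Icc t₀ T, ∀ x ∈ Icc (0 : ℝ) 1, ∀ s y p,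
      |t - s| < r → |x - y| < r → |t - s| ≤ 1 → |x - y| ≤ 1 → |p| ≤ P →
      H t x p - H s y p < κ := by
    have hK : IsCompact (Icc (t₀ - 1) (T + 1) ×ˢ (Icc (-1 : ℝ) 2 ×ˢ Icc (-P) P)) :=
      isCompact_Icc.prod (isCompact_Icc.prod isCompact_Icc)
    have := hK.uniformContinuousOn_of_continuous hH.continuousOn
    obtain ⟨r, hr, h⟩ := Metric.uniformContinuousOn_iff.mp this κ hκ0
    refine ⟨r, hr, fun t ht x hx s y p h1 h2 h3 h4 h5 => ?_⟩
    rw [abs_le] at h3 h4 h5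
    have := h (t, x, p) ⟨⟨by linarith [ht.1], by linarith [ht.2]⟩,
      ⟨by linarith [hx.1], by linarith [hx.2]⟩, h5⟩ (s, y, p)
      ⟨⟨by linarith [ht.1], by linarith [ht.2]⟩, ⟨by linarith [hx.1], by linarith [hx.2]⟩, h5⟩
      (by simp [Prod.dist_eq, Real.dist_eq, h1, h2])
    rw [Real.dist_eq] at this
    exact (abs_lt.mp this).2
  obtain ⟨ε, hε, hε1, hε2, hε3⟩ : ∃ ε > 0, 2 * L * ε < 1 ∧ 2 * L * ε < r ∧ L ^ 2 * ε ≤ δ := by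
    set μ := min 1 (min r δ) with hμ
    have hμ0 : 0 < μ := by positivity
    have h1 : μ ≤ 1 := min_le_left _ _
    have h2 : μ ≤ r := (min_le_right _ _).trans (min_le_left _ _)
    have h3 : μ ≤ δ := (min_le_right _ _).trans (min_le_right _ _)
    have he : 2 * (L + 1) ^ 2 * (μ / (2 * (L + 1) ^ 2)) = μ := by field_simp
    set ε := μ / (2 * (L + 1) ^ 2) with hε
    have hε0 : 0 < ε := by positivity
    refine ⟨ε, hε0, ?_, ?_, ?_⟩ <;> nlinarith [mul_nonneg hL hε0.le, mul_nonneg hL (mul_nonneg hL hε0.le)]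
  obtain ⟨t, ht, x, hx, s, y, hd, hmin⟩ := exists_doubling_min (g := g) (T := T) (by linarith) hu
    hup hwp hw (continuous_iff_continuousAt.mpr fun t => (hgd t).continuousAt) hL hε hε1
  have hlow : ∀ t x s y, -δ ≤ w t x - w s y + ((t - s) ^ 2 + (x - y) ^ 2) / ε := by
    intro t x s y
    have h1 := (abs_le.mp (hw s t y x)).1
    have h2 : L * (|t - s| + |x - y|) - δ ≤ ((t - s) ^ 2 + (x - y) ^ 2) / ε := by
      rw [le_div_iff₀ hε, ← sq_abs (t - s), ← sq_abs (x - y)]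
      nlinarith [sq_nonneg (|t - s| - L * ε / 2), sq_nonneg (|x - y| - L * ε / 2)]
    linarith
  have hval := hmin t₁ ⟨ht₁, by linarith⟩ x₁ t₁ x₁
  have hg1 : g t₁ = δ := by simp [hg]
  have hgT : g T = δ * Real.exp N := by simp [hg, hT]
  have hgpos : ∀ t, 0 < g t := fun t => by simp only [hg]; positivity
  simp only [sub_self, ne_eq, OfNat.ofNat_ne_zero, not_false_eq_true, zero_pow, add_zero, zero_div,
    hg1] at hval
  have hlow' := hlow t x s y
  have ht0 : t₀ < t := ht.1.lt_of_ne fun h => by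
    have := hm x
    rw [h] at this
    linarith [hgpos t]
  have htT : t < T := ht.2.lt_of_ne fun h => by
    have := hB x
    rw [← h] at this hgT
    linarith
  have hdt : |t - s| ≤ 2 * L * ε := by linarith [abs_nonneg (x - y)]
  have hdx : |x - y| ≤ 2 * L * ε := by linarith [abs_nonneg (t - s)]
  have hcd : ∀ a b : ℝ, HasDerivAt (fun r => ((r - b) ^ 2) / ε) (2 * (a - b) / ε) a := fun a b => by
    exact ((((hasDerivAt_id a).sub_const b).pow 2).div_const ε).congr_deriv (by simp)
  have hcd' : ∀ a b : ℝ, HasDerivAt (fun r => ((a - r) ^ 2) / ε) (-(2 * (a - b) / ε)) b :=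
    fun a b => by
    exact ((((hasDerivAt_id b).const_sub a).pow 2).div_const ε).congr_deriv (by simp; ring)
  -- the supersolution test
  have h1 := hsup (fun z => -(((z.1 - s) ^ 2) / ε + ((z.2 - y) ^ 2) / ε + g z.1))
    (by simp only [hg]; fun_prop) (t, x) ⟨ht0, trivial⟩ (by
      filter_upwards [prod_mem_nhds (Icc_mem_nhds ht0 htT) (univ_mem (f := 𝓝 x))] with z hz
      have := hmin z.1 hz.1 z.2 s y
      simp only [add_div] at this ⊢
      linarith)
  have hφd : Differentiable ℝ fun z : ℝ × ℝ =>
      -(((z.1 - s) ^ 2) / ε + ((z.2 - y) ^ 2) / ε + g z.1) := by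
    simp only [hg]; fun_prop
  rw [fderiv_apply_fst (hφd _) ((((hcd t s).add_const (((x - y) ^ 2) / ε)).fun_add (hgd t)).fun_neg),
    fderiv_apply_snd (hφd _) ((((hcd x y).const_add (((t - s) ^ 2) / ε)).add_const (g t)).fun_neg)] at h1
  -- the subsolution test
  have h2 := hsub (fun z => ((t - z.1) ^ 2) / ε + ((x - z.2) ^ 2) / ε) (by fun_prop) (s, y)
    trivial (by
      refine Eventually.of_forall fun z => ?_
      have := hmin t ht x z.1 z.2
      simp only [add_div] at this ⊢
      linarith)
  have hψd : Differentiable ℝ fun z : ℝ × ℝ => ((t - z.1) ^ 2) / ε + ((x - z.2) ^ 2) / ε := by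
    fun_prop
  rw [fderiv_apply_fst (hψd _) ((hcd' t s).add_const (((x - y) ^ 2) / ε)),
    fderiv_apply_snd (hψd _) ((hcd' x y).const_add (((t - s) ^ 2) / ε))] at h2
  have hq : |c + -(2 * (x - y) / ε)| ≤ P := by
    refine (abs_add_le _ _).trans ?_
    rw [hP, abs_neg, abs_div, abs_of_pos hε, abs_mul, abs_two]
    gcongr
    rw [div_le_iff₀ hε]
    linarith
  have h3 := hr' t ht x hx s y _ (by linarith) (by linarith) (by linarith) (by linarith) hq
  have h4 : κ ≤ N * g t := by
    simp only [hκ, hg]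
    gcongr
  simp only at h1 h2
  linarith

theorem HasDerivAt.nonneg_of_eventually_le_left {f : ℝ → ℝ} {d t : ℝ} (hf : HasDerivAt f d t)
    (h : ∀ᶠ r in 𝓝[<] t, f r ≤ f t) : 0 ≤ d := by
  have h1 : Tendsto (slope f t) (𝓝[<] t) (𝓝 d) := (hasDerivAt_iff_tendsto_slope.mp hf).mono_left
    (nhdsWithin_mono t fun r (hr : r ∈ Iio t) => ne_of_lt hr)
  refine ge_of_tendsto h1 ?_
  filter_upwards [h, self_mem_nhdsWithin] with r hr hrt
  rw [slope_def_field]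
  exact div_nonneg_of_nonpos (by linarith) (by linarith [mem_Iio.mp hrt])

theorem deriv_le_of_isLocalMax_sub {f g : ℝ → ℝ} {R d x : ℝ}
    (hf : ∀ x y, |f y - f x| ≤ R * |y - x|)
    (hg : HasDerivAt g d x) (hmax : IsLocalMax (fun y => f y - g y) x) : d ≤ R := by
  have h1 := ((hasDerivAt_id x).const_mul R).fun_sub hg
  have := h1.nonneg_of_eventually_le_left (by
    filter_upwards [hmax.filter_mono nhdsWithin_le_nhds, self_mem_nhdsWithin] with y hy hyx
    have h2 := hf x y
    rw [abs_of_neg (sub_neg.mpr (mem_Iio.mp hyx))] at h2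
    have h3 := neg_le_of_abs_le h2
    simp only [id]
    linarith)
  linarith

theorem abs_deriv_le_of_isLocalMax_sub {f g : ℝ → ℝ} {R d x : ℝ}
    (hf : ∀ x y, |f y - f x| ≤ R * |y - x|)
    (hg : HasDerivAt g d x) (hmax : IsLocalMax (fun y => f y - g y) x) : |d| ≤ R := by
  rw [abs_le']
  refine ⟨deriv_le_of_isLocalMax_sub hf hg hmax, ?_⟩
  have h0 : HasDerivAt g d (-(-x)) := by rwa [neg_neg]
  have h1 : HasDerivAt (fun y => g (-y)) (-d) (-x) := by
    exact (h0.comp (-x) (hasDerivAt_neg (-x))).congr_deriv (by ring)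
  refine deriv_le_of_isLocalMax_sub (f := fun y => f (-y)) (fun x y => ?_) h1 ?_
  · have := hf (-x) (-y)
    rwa [neg_sub_neg, abs_sub_comm x y] at this
  · have h2 : Tendsto (fun y : ℝ => -y) (𝓝 (-x)) (𝓝 x) := by
      simpa using (continuous_neg.tendsto (-x))
    have := h2.eventually hmax
    filter_upwards [this] with y hy
    simpa using hy

theorem abs_deriv_le_of_isLocalMin_sub {f g : ℝ → ℝ} {R d x : ℝ}
    (hf : ∀ x y, |f y - f x| ≤ R * |y - x|)
    (hg : HasDerivAt g d x) (hmin : IsLocalMin (fun y => f y - g y) x) : |d| ≤ R := by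
  rw [← abs_neg]
  refine abs_deriv_le_of_isLocalMax_sub (f := fun y => -f y) (fun x y => ?_) hg.fun_neg ?_
  · rw [neg_sub_neg, abs_sub_comm]
    exact hf x y
  · have := hmin.neg
    filter_upwards [this] with y hy
    linarith

theorem ViscSubSol.neg {H : ℝ → ℝ → ℝ → ℝ} {c : ℝ} {D : Set (ℝ × ℝ)} {u : ℝ → ℝ → ℝ}
    (hu : ViscSubSol H c 0 D u) :
    ViscSuperSol (fun t x p => -H t x (-p)) (-c) 0 D (fun t x => -u t x) := by
  intro φ hφ z hz hmin
  beta_reduce at hmin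
  have := hu (fun w => -φ w) hφ.neg z hz (by
    filter_upwards [hmin] with w hw
    linarith)
  have hd : fderiv ℝ (fun w => -φ w) z = -fderiv ℝ φ z := fderiv_fun_neg
  rw [hd] at this
  simp only [neg_apply] at this
  beta_reduce
  rw [show -(-c + fderiv ℝ φ z (0, 1)) = c + -fderiv ℝ φ z (0, 1) by ring]
  linarith

theorem ViscSuperSol.neg {H : ℝ → ℝ → ℝ → ℝ} {c : ℝ} {D : Set (ℝ × ℝ)} {u : ℝ → ℝ → ℝ}
    (hu : ViscSuperSol H c 0 D u) :
    ViscSubSol (fun t x p => -H t x (-p)) (-c) 0 D (fun t x => -u t x) := by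
  intro φ hφ z hz hmin
  beta_reduce at hmin
  have := hu (fun w => -φ w) hφ.neg z hz (by
    filter_upwards [hmin] with w hw
    linarith)
  have hd : fderiv ℝ (fun w => -φ w) z = -fderiv ℝ φ z := fderiv_fun_neg
  rw [hd] at this
  simp only [neg_apply] at this
  beta_reduce
  rw [show -(-c + fderiv ℝ φ z (0, 1)) = c + -fderiv ℝ φ z (0, 1) by ring]
  linarith

namespace TameHam

variable {h : TameHam} {c a : ℝ} {w : ℝ → ℝ → ℝ} {H : ℝ → ℝ → ℝ → ℝ}

theorem IsOrbit.hasDerivAt_test {γ : ℝ → ℝ × ℝ} (hγ : h.IsOrbit γ) {φ : ℝ × ℝ → ℝ} {t : ℝ}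
    (hφ : DifferentiableAt ℝ φ (t, (γ t).1)) (c : ℝ) :
    HasDerivAt (fun r => φ (r, (γ r).1) + c * (γ r).1 - h.act γ t r)
      (fderiv ℝ φ (t, (γ t).1) (1, 0) + (c + fderiv ℝ φ (t, (γ t).1) (0, 1)) *
        h.Gp t (γ t).1 (γ t).2 - h.dens t (γ t)) t := by
  have h1 := hφ.hasFDerivAt.comp_hasDerivAt t ((hasDerivAt_id t).prodMk (hγ.hasDerivAt_fst t))
  have h2 := (h1.fun_add ((hγ.hasDerivAt_fst t).const_mul c)).fun_sub (hγ.hasDerivAt_act t t)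
  refine h2.congr_deriv ?_
  have : ((1 : ℝ), h.Gp t (γ t).1 (γ t).2) =
      (1, 0) + h.Gp t (γ t).1 (γ t).2 • ((0 : ℝ), (1 : ℝ)) := by simp
  rw [this, map_add, map_smul, smul_eq_mul]
  ring

theorem WeakKAM.viscSuperSol (hw : WeakKAM h c a w)
    (hag : ∀ t x p, |p| ≤ h.R₁ → h.G t x p = H t x p) :
    ViscSuperSol H c 0 univ (fun t x => w t x - c * x) := by
  rintro φ hφ ⟨t, x⟩ - hmin
  have hφd : DifferentiableAt ℝ φ (t, x) := hφ.differentiable one_ne_zero _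
  have hx : |c + fderiv ℝ φ (t, x) (0, 1)| ≤ h.R₁ := by
    refine abs_deriv_le_of_isLocalMin_sub (f := fun y => w t y)
      (g := fun y => c * y + φ (t, y)) (x := x) (fun x y => hw.abs_sub_le_snd t x y) ?_ ?_
    · have h1 := hφd.hasFDerivAt.comp_hasDerivAt x ((hasDerivAt_const x t).prodMk (hasDerivAt_id x))
      have h2 := ((hasDerivAt_id x).const_mul c).fun_add h1
      simpa using h2
    · have h3 : Tendsto (fun y : ℝ => (t, y)) (𝓝 x) (𝓝 (t, x)) :=
        (Continuous.prodMk_right t).tendsto x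
      filter_upwards [h3.eventually hmin] with y hy
      linarith
  obtain ⟨γ, hγ, rfl, hcal, -⟩ := hw.exists_cal t x
  have hd := hγ.hasDerivAt_test hφd c
  have hev : Tendsto (fun r => (r, (γ r).1)) (𝓝[<] t) (𝓝 (t, (γ t).1)) :=
    ((continuous_id.prodMk (continuous_fst.comp hγ.continuous)).tendsto t).mono_left
      nhdsWithin_le_nhds
  have h0 := hd.nonneg_of_eventually_le_left (by
    filter_upwards [hev.eventually hmin, self_mem_nhdsWithin] with r hr hrt
    have h1 := hcal r t (le_of_lt hrt) le_rfl
    have h2 := hγ.act_add r t r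
    rw [act_self] at h2
    simp only [Cal, act_self] at h1 hr ⊢
    linarith)
  have h4 := h.convex_le t (γ t).1 (γ t).2 (c + fderiv ℝ φ (t, (γ t).1) (0, 1))
  rw [hag _ _ _ hx] at h4
  simp only [dens] at h0 ⊢
  nlinarith

theorem WeakKAM.viscSubSol (hw : WeakKAM h c a w)
    (hag : ∀ t x p, |p| ≤ h.R₁ → h.G t x p = H t x p) :
    ViscSubSol H c 0 univ (fun t x => w t x - c * x) := by
  rintro φ hφ ⟨t, x⟩ - hmax
  have hφd : DifferentiableAt ℝ φ (t, x) := hφ.differentiable one_ne_zero _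
  have hx : |c + fderiv ℝ φ (t, x) (0, 1)| ≤ h.R₁ := by
    refine abs_deriv_le_of_isLocalMax_sub (f := fun y => w t y)
      (g := fun y => c * y + φ (t, y)) (x := x) (fun x y => hw.abs_sub_le_snd t x y) ?_ ?_
    · have h1 := hφd.hasFDerivAt.comp_hasDerivAt x ((hasDerivAt_const x t).prodMk (hasDerivAt_id x))
      have h2 := ((hasDerivAt_id x).const_mul c).fun_add h1
      simpa using h2
    · have h3 : Tendsto (fun y : ℝ => (t, y)) (𝓝 x) (𝓝 (t, x)) :=
        (Continuous.prodMk_right t).tendsto x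
      filter_upwards [h3.eventually hmax] with y hy
      linarith
  set q := c + fderiv ℝ φ (t, x) (0, 1) with hq
  set γ := h.flow t (x, q) with hγdef
  have hγ : h.IsOrbit γ := h.flow_isOrbit t (x, q)
  have hγt : γ t = (x, q) := h.flow_self t (x, q)
  have hd := (hγ.hasDerivAt_test (t := t) (by rwa [hγt]) c).fun_neg
  have hev : Tendsto (fun r => (r, (γ r).1)) (𝓝[<] t) (𝓝 (t, x)) := by
    have := ((continuous_id.prodMk (continuous_fst.comp hγ.continuous)).tendsto t).mono_left
      (nhdsWithin_le_nhds (s := Iio t))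
    simpa [hγt] using this
  have h0 := hd.nonneg_of_eventually_le_left (by
    filter_upwards [hev.eventually hmax, self_mem_nhdsWithin] with r hr hrt
    have h1 := hw.dom.le_act γ hγ r (mem_univ _) t (le_of_lt hrt)
    have h2 := hγ.act_add r t r
    rw [act_self] at h2
    rw [hγt] at h1 ⊢
    simp only [act_self] at h1 hr ⊢
    linarith)
  rw [hγt] at h0
  simp only [dens, ← hq] at h0 ⊢
  rw [hag _ _ _ hx] at h0
  nlinarith

theorem WeakKAM.exists_bound (hw : WeakKAM h c a w) :
    ∃ B, ∀ t x, |w t x - c * x + t * a| ≤ B := by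
  obtain ⟨L, hL0, hL⟩ := exists_lipschitz h
  obtain ⟨B, hB⟩ := hw.exists_osc
  refine ⟨L + B + |a|, fun t x => ?_⟩
  have h1 := hw.time_int ⌊t⌋ (Int.fract t) x
  rw [Int.fract_add_floor] at h1
  have h2 := hL c a w hw 0 (Int.fract t) x x
  have h3 := hB x
  have h5 : |Int.fract t| ≤ 1 := by
    rw [abs_of_nonneg (Int.fract_nonneg t)]
    exact (Int.fract_lt_one t).le
  have h4 : |Int.fract t * a| ≤ |a| := by
    rw [abs_mul]
    exact mul_le_of_le_one_left (abs_nonneg a) h5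
  rw [sub_self, abs_zero, sub_zero, add_zero] at h2
  have h6 : L * |Int.fract t| ≤ L := mul_le_of_le_one_right hL0 h5
  have h7 : w t x - c * x + t * a =
      (w (Int.fract t) x - w 0 x) + (w 0 x - c * x) + Int.fract t * a := by
    linear_combination h1 - a * Int.fract_add_floor t
  rw [h7]
  refine (abs_add_three _ _ _).trans ?_
  linarith

theorem WeakKAM.exists_lipschitz_sub (hw : WeakKAM h c a w) : ∃ L, 0 ≤ L ∧
    ∀ s t x y, |(w t y - c * y) - (w s x - c * x)| ≤ L * (|t - s| + |y - x|) := by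
  obtain ⟨L, hL0, hL⟩ := exists_lipschitz h
  refine ⟨L + |c|, by positivity, fun s t x y => ?_⟩
  have h1 := hL c a w hw s t x y
  have h2 : |c * (y - x)| = |c| * |y - x| := abs_mul _ _
  have h3 : (w t y - c * y) - (w s x - c * x) = (w t y - w s x) - c * (y - x) := by ring
  rw [h3]
  refine (abs_sub _ _).trans ?_
  nlinarith [mul_nonneg (abs_nonneg c) (abs_nonneg (t - s))]

theorem WeakKAM.per_sub (hw : WeakKAM h c a w) (t x : ℝ) :
    w t (x + 1) - c * (x + 1) = w t x - c * x := by
  rw [hw.dom.per t (mem_univ _) x]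
  ring

theorem exists_bound_of_per {f : ℝ → ℝ} (hf : Continuous f) (hp : ∀ x, f (x + 1) = f x) :
    ∃ B, ∀ x, |f x| ≤ B := by
  obtain ⟨B, hB⟩ := (isCompact_Icc (a := (0:ℝ)) (b := 1)).exists_bound_of_continuousOn
    hf.continuousOn
  refine ⟨B, fun x => ?_⟩
  have h1 := per_int hp (-⌊x⌋) x
  rw [← h1]
  refine hB _ ⟨?_, ?_⟩ <;> push_cast <;> linarith [Int.floor_le x, Int.lt_floor_add_one x]

/-- Any viscosity solution grows like the weak KAM solution of the same cohomology class. -/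
theorem WeakKAM.bounded (hw : WeakKAM h c a w)
    (hag : ∀ t x p, |p| ≤ h.R₁ → h.G t x p = H t x p)
    (hH : Continuous fun q : ℝ × ℝ × ℝ => H q.1 q.2.1 q.2.2) {t₀ : ℝ} {u : ℝ → ℝ → ℝ}
    (hu : IsViscSolOn H c t₀ u) : ∃ M, ∀ t ∈ Ici t₀, ∀ x, |u t x + t * a| ≤ M := by
  obtain ⟨hc, hp, hsub, hsup⟩ := hu
  obtain ⟨L, hL0, hL⟩ := hw.exists_lipschitz_sub
  obtain ⟨B, hB⟩ := hw.exists_bound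
  have hu0 : Continuous (u t₀) := by
    have h1 : Continuous fun x : ℝ => (t₀, x) := Continuous.prodMk_right t₀
    exact hc.comp_continuous h1 fun x => ⟨mem_Ici.mpr le_rfl, mem_univ _⟩
  obtain ⟨B₀, hB₀⟩ := exists_bound_of_per hu0 (hp t₀)
  have hdiff : ∀ x, |u t₀ x - (w t₀ x - c * x)| ≤ B₀ + B + |t₀ * a| := fun x => by
    have h1 := hB t₀ x
    have h2 := hB₀ x
    rw [abs_le] at h1 h2 ⊢
    constructor <;> linarith [neg_abs_le (t₀ * a), le_abs_self (t₀ * a)]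
  have h1 := le_sub_of_viscosity hH hc hp hsup hw.per_sub hL0 hL (hw.viscSubSol hag)
    (fun x => neg_le_of_abs_le (hdiff x))
  have h2 := le_sub_of_viscosity (H := fun t x p => -H t x (-p)) (c := -c) (L := L)
    (u := fun t x => -u t x) (w := fun t x => -(w t x - c * x)) (t₀ := t₀)
    (m₀ := -(B₀ + B + |t₀ * a|))
    (hH.comp (continuous_fst.prodMk ((continuous_fst.comp continuous_snd).prodMk
      (continuous_snd.comp continuous_snd).neg))).neg hc.neg
    (fun t x => by rw [hp]) hsub.neg (fun t x => by rw [hw.per_sub]) hL0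
    (fun s t x y => by
      rw [neg_sub_neg, abs_sub_comm]
      exact hL s t x y) (hw.viscSuperSol hag).neg (fun x => by
      have := (abs_le.mp (hdiff x)).2
      linarith)
  refine ⟨B₀ + B + |t₀ * a| + B, fun t ht x => ?_⟩
  have h3 := h1 t ht x
  have h4 := h2 t ht x
  have h5 := abs_le.mp (hB t x)
  rw [abs_le]
  constructor <;> linarith

theorem nonpos_of_forall_mul_le {x B : ℝ} (hx : ∀ t : ℝ, 0 ≤ t → t * x ≤ B) : x ≤ 0 :=
  nonpos_of_forall_nat_mul_le (B := B) fun n => hx n (Nat.cast_nonneg n)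

theorem WeakKAM.isViscSolOn (hw : WeakKAM h c a w)
    (hag : ∀ t x p, |p| ≤ h.R₁ → h.G t x p = H t x p) :
    IsViscSolOn H c 0 (fun t x => w t x - c * x) := by
  refine ⟨?_, hw.per_sub, fun φ hφ z _ => hw.viscSubSol hag φ hφ z (mem_univ _),
    fun φ hφ z _ => hw.viscSuperSol hag φ hφ z (mem_univ _)⟩
  obtain ⟨L, hL0, hL⟩ := hw.exists_lipschitz_sub
  have : LipschitzWith (2 * L).toNNReal (fun z : ℝ × ℝ => w z.1 z.2 - c * z.2) := by
    refine LipschitzWith.of_dist_le_mul fun z z' => ?_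
    rw [Real.coe_toNNReal _ (by positivity), Real.dist_eq]
    refine (hL _ _ _ _).trans ?_
    have h1 : |z.1 - z'.1| ≤ dist z z' := norm_fst_le (z - z') |>.trans_eq (dist_eq_norm _ _).symm
    have h2 : |z.2 - z'.2| ≤ dist z z' := norm_snd_le (z - z') |>.trans_eq (dist_eq_norm _ _).symm
    nlinarith
  exact this.continuous.continuousOn

theorem WeakKAM.unique (hw : WeakKAM h c a w)
    (hag : ∀ t x p, |p| ≤ h.R₁ → h.G t x p = H t x p)
    (hH : Continuous fun q : ℝ × ℝ × ℝ => H q.1 q.2.1 q.2.2)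
    {h' : TameHam} {a' : ℝ} {w' : ℝ → ℝ → ℝ} (hw' : WeakKAM h' c a' w')
    (hag' : ∀ t x p, |p| ≤ h'.R₁ → h'.G t x p = H t x p) : a = a' := by
  obtain ⟨M, hM⟩ := hw.bounded hag hH (hw'.isViscSolOn hag')
  obtain ⟨M', hM'⟩ := hw'.bounded hag' hH (hw'.isViscSolOn hag')
  apply le_antisymm <;> rw [← sub_nonpos] <;>
    refine nonpos_of_forall_mul_le (B := M + M') fun t ht => ?_ <;>
    have h1 := abs_le.mp (hM t ht 0) <;> have h2 := abs_le.mp (hM' t ht 0) <;> linarith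

theorem WeakKAM.le_of_forall_le (hw : WeakKAM h c a w)
    (hag : ∀ t x p, |p| ≤ h.R₁ → h.G t x p = H t x p)
    (hH : Continuous fun q : ℝ × ℝ × ℝ => H q.1 q.2.1 q.2.2) {μ : ℝ}
    (hμ : ∀ t x, μ ≤ H t x c) : μ ≤ a := by
  obtain ⟨L, hL0, hL⟩ := hw.exists_lipschitz_sub
  obtain ⟨B, hB⟩ := hw.exists_bound
  have h1 := le_sub_of_viscosity (u := fun t _ => -(t * μ)) (t₀ := 0) (m₀ := -B) hH
    (by fun_prop) (fun _ _ => rfl)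
    (by
      intro φ hφ z _ hmin
      have hφd : HasFDerivAt φ (fderiv ℝ φ z) z := (hφ.differentiable one_ne_zero z).hasFDerivAt
      have hd : HasFDerivAt (fun w : ℝ × ℝ => -(w.1 * μ))
          (-(μ • ContinuousLinearMap.fst ℝ ℝ ℝ)) z :=
        (hasFDerivAt_fst.mul_const μ).fun_neg
      have h0 := hmin.hasFDerivAt_eq_zero (hd.fun_sub hφd)
      rw [sub_eq_zero] at h0
      rw [← h0]
      simpa using hμ z.1 z.2)
    hw.per_sub hL0 hL (hw.viscSubSol hag) (fun x => by
      have := (abs_le.mp (hB 0 x)).2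
      linarith)
  rw [← sub_nonpos]
  refine nonpos_of_forall_mul_le (B := B + B) fun t ht => ?_
  have h2 := h1 t ht 0
  have h3 := abs_le.mp (hB t 0)
  linarith

end TameHam

theorem exists_lipschitz_of_periodic {F : Type*} [NormedAddCommGroup F] [NormedSpace ℝ F]
    {f : ℝ × ℝ × ℝ → F} {R : ℝ} (hf : ContDiff ℝ 1 f)
    (ht : ∀ t x p, f (t + 1, x, p) = f (t, x, p)) (hx : ∀ t x p, f (t, x + 1, p) = f (t, x, p))
    (hz : ∀ t x p, R < |p| → f (t, x, p) = 0) :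
    ∃ C, 0 ≤ C ∧ ∀ q q', ‖f q - f q'‖ ≤ C * ‖q - q'‖ := by
  have hT : ∀ t x p, fderiv ℝ f (t + 1, x, p) = fderiv ℝ f (t, x, p) := fun t x p => by
    have h1 := fderiv_comp_add_right (𝕜 := ℝ) (f := f) (x := (t, x, p)) (1, 0, 0)
    have h2 : (fun q : ℝ × ℝ × ℝ => f (q + (1, 0, 0))) = f := by
      ext ⟨t, x, p⟩
      simpa using ht t x p
    rw [h2] at h1
    simpa using h1.symm
  have hX : ∀ t x p, fderiv ℝ f (t, x + 1, p) = fderiv ℝ f (t, x, p) := fun t x p => by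
    have h1 := fderiv_comp_add_right (𝕜 := ℝ) (f := f) (x := (t, x, p)) (0, 1, 0)
    have h2 : (fun q : ℝ × ℝ × ℝ => f (q + (0, 1, 0))) = f := by
      ext ⟨t, x, p⟩
      simpa using hx t x p
    rw [h2] at h1
    simpa using h1.symm
  obtain ⟨B, hB⟩ := TameHam.exists_bound_of_periodic (f := fun q => ‖fderiv ℝ f q‖)
    (hf.continuous_fderiv one_ne_zero).norm (fun t x p => by rw [hT]) (fun t x p => by rw [hX]) R
  refine ⟨max B 0, le_max_right _ _, fun q q' => ?_⟩
  have hL : LipschitzWith (max B 0).toNNReal f := by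
    refine lipschitzWith_of_nnnorm_fderiv_le (hf.differentiable one_ne_zero) fun q => ?_
    rw [← NNReal.coe_le_coe, coe_nnnorm, Real.coe_toNNReal _ (le_max_right _ _)]
    rcases le_or_gt |q.2.2| R with h | h
    · have := hB q.1 q.2.1 q.2.2 h
      rw [abs_norm] at this
      exact this.trans (le_max_left _ _)
    · have h1 : f =ᶠ[𝓝 q] fun _ => 0 := by
        have : ∀ᶠ q' : ℝ × ℝ × ℝ in 𝓝 q, R < |q'.2.2| :=
          (continuous_abs.comp (continuous_snd.comp continuous_snd)).continuousAt.eventually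
            (lt_mem_nhds h)
        filter_upwards [this] with q' hq'
        exact hz _ _ _ hq'
      rw [h1.fderiv_eq]
      simp
  have := hL.dist_le_mul q q'
  rwa [dist_eq_norm, dist_eq_norm, Real.coe_toNNReal _ (le_max_right _ _)] at this

section Partial

variable {F : ℝ × ℝ × ℝ → ℝ} {t x p : ℝ}

theorem hasDerivAt_partial_fst (hF : DifferentiableAt ℝ F (t, x, p)) :
    HasDerivAt (fun y => F (t, y, p)) (fderiv ℝ F (t, x, p) (0, 1, 0)) x :=
  hF.hasFDerivAt.comp_hasDerivAt x
    ((hasDerivAt_const x t).prodMk ((hasDerivAt_id x).prodMk (hasDerivAt_const x p)))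

theorem hasDerivAt_partial_snd (hF : DifferentiableAt ℝ F (t, x, p)) :
    HasDerivAt (fun q => F (t, x, q)) (fderiv ℝ F (t, x, p) (0, 0, 1)) p :=
  hF.hasFDerivAt.comp_hasDerivAt p
    ((hasDerivAt_const p t).prodMk ((hasDerivAt_const p x).prodMk (hasDerivAt_id p)))

end Partial

/-- The derivative of a Hamiltonian with respect to the momentum. -/
noncomputable def momDeriv (H : ℝ → ℝ → ℝ → ℝ) (q : ℝ × ℝ × ℝ) : ℝ :=
  fderiv ℝ (fun q : ℝ × ℝ × ℝ => H q.1 q.2.1 q.2.2) q (0, 0, 1)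

/-- The derivative of a Hamiltonian with respect to the position. -/
noncomputable def posDeriv (H : ℝ → ℝ → ℝ → ℝ) (q : ℝ × ℝ × ℝ) : ℝ :=
  fderiv ℝ (fun q : ℝ × ℝ × ℝ => H q.1 q.2.1 q.2.2) q (0, 1, 0)

namespace BurgersHyp

variable {H : ℝ → ℝ → ℝ → ℝ}

theorem continuous (hH : BurgersHyp H) : Continuous fun q : ℝ × ℝ × ℝ => H q.1 q.2.1 q.2.2 :=
  hH.smooth.continuous

theorem hasDerivAt_mom (hH : BurgersHyp H) (t x p : ℝ) :
    HasDerivAt (fun q => H t x q) (momDeriv H (t, x, p)) p :=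
  hasDerivAt_partial_snd (hH.smooth.differentiable two_ne_zero (t, x, p))

theorem hasDerivAt_pos (hH : BurgersHyp H) (t x p : ℝ) :
    HasDerivAt (fun y => H t y p) (posDeriv H (t, x, p)) x :=
  hasDerivAt_partial_fst (hH.smooth.differentiable two_ne_zero (t, x, p))

theorem hamVF_eq (hH : BurgersHyp H) (t : ℝ) (z : ℝ × ℝ) :
    HamVF H t z = (momDeriv H (t, z), -posDeriv H (t, z)) := by
  rw [HamVF, (hH.hasDerivAt_mom t z.1 z.2).deriv, (hH.hasDerivAt_pos t z.1 z.2).deriv]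

theorem contDiff_momDeriv (hH : BurgersHyp H) : ContDiff ℝ 1 (momDeriv H) :=
  (hH.smooth.fderiv_right (m := 1) (by norm_num)).clm_apply contDiff_const

theorem momDeriv_add_one_t (hH : BurgersHyp H) (t x p : ℝ) :
    momDeriv H (t + 1, x, p) = momDeriv H (t, x, p) := by
  have h1 := hH.hasDerivAt_mom (t + 1) x p
  simp only [hH.per_t] at h1
  exact h1.unique (hH.hasDerivAt_mom t x p)

theorem momDeriv_add_one_x (hH : BurgersHyp H) (t x p : ℝ) :
    momDeriv H (t, x + 1, p) = momDeriv H (t, x, p) := by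
  have h1 := hH.hasDerivAt_mom t (x + 1) p
  simp only [hH.per_x] at h1
  exact h1.unique (hH.hasDerivAt_mom t x p)

theorem exists_mono (hH : BurgersHyp H) (R : ℝ) : ∃ m, 0 < m ∧ ∀ t x p q, p ∈ Icc (-R) R →
    q ∈ Icc (-R) R → p ≤ q → m * (q - p) ≤ momDeriv H (t, x, q) - momDeriv H (t, x, p) := by
  set D : ℝ × ℝ × ℝ → ℝ := fun q => fderiv ℝ (momDeriv H) q (0, 0, 1) with hD
  have hder : ∀ t x p, HasDerivAt (fun q => momDeriv H (t, x, q)) (D (t, x, p)) p := fun t x p =>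
    hasDerivAt_partial_snd (hH.contDiff_momDeriv.differentiable one_ne_zero (t, x, p))
  have hpos : ∀ t x p, 0 < D (t, x, p) := fun t x p => by
    have h1 := hH.convexp t x p
    rw [iteratedDeriv_succ, iteratedDeriv_one] at h1
    have h2 : deriv (fun q => H t x q) = fun q => momDeriv H (t, x, q) := by
      ext q
      exact (hH.hasDerivAt_mom t x q).deriv
    rwa [h2, (hder t x p).deriv] at h1
  have hcont : Continuous D :=
    (hH.contDiff_momDeriv.continuous_fderiv one_ne_zero).clm_apply continuous_const
  have hTt : ∀ t x p, D (t + 1, x, p) = D (t, x, p) := fun t x p => by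
    have h1 := hder (t + 1) x p
    simp only [hH.momDeriv_add_one_t] at h1
    exact h1.unique (hder t x p)
  have hTx : ∀ t x p, D (t, x + 1, p) = D (t, x, p) := fun t x p => by
    have h1 := hder t (x + 1) p
    simp only [hH.momDeriv_add_one_x] at h1
    exact h1.unique (hder t x p)
  obtain ⟨B, hB⟩ := TameHam.exists_bound_of_periodic (f := fun q => (D q)⁻¹)
    (hcont.inv₀ fun q => (hpos q.1 q.2.1 q.2.2).ne')
    (fun t x p => by rw [hTt]) (fun t x p => by rw [hTx]) R
  have hB1 : 0 < |B| + 1 := by positivity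
  refine ⟨(|B| + 1)⁻¹, by positivity, fun t x p q hp hq hpq => ?_⟩
  rcases hpq.eq_or_lt with rfl | hlt
  · simp
  obtain ⟨z, hz, h1⟩ := exists_hasDerivAt_eq_slope (fun q => momDeriv H (t, x, q))
    (fun q => D (t, x, q)) hlt (fun z _ => (hder t x z).continuousAt.continuousWithinAt)
    (fun z _ => hder t x z)
  rw [eq_div_iff (sub_pos.mpr hlt).ne'] at h1
  rw [← h1]
  refine mul_le_mul_of_nonneg_right ?_ (sub_pos.mpr hlt).le
  have h2 := hB t x z (abs_le.mpr ⟨hp.1.trans hz.1.le, hz.2.le.trans hq.2⟩)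
  rw [abs_of_pos (inv_pos.mpr (hpos t x z))] at h2
  exact inv_le_of_inv_le₀ (hpos t x z) (h2.trans (by linarith [le_abs_self B]))

theorem momDeriv_mono (hH : BurgersHyp H) (t x : ℝ) : Monotone fun p => momDeriv H (t, x, p) := by
  intro p q hpq
  obtain ⟨m, hm, h1⟩ := hH.exists_mono (max |p| |q|)
  have h2 := h1 t x p q (abs_le.mp (le_max_left _ _)) (abs_le.mp (le_max_right _ _)) hpq
  have := mul_nonneg hm.le (sub_nonneg.mpr hpq)
  simp only
  linarith

end BurgersHyp

/-- A globally Lipschitz, uniformly convex modification of `H` outside of `|p| ≤ R`. -/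
structure Cutoff (H : ℝ → ℝ → ℝ → ℝ) (R : ℝ) where
  G : ℝ → ℝ → ℝ → ℝ
  Gx : ℝ → ℝ → ℝ → ℝ
  Gp : ℝ → ℝ → ℝ → ℝ
  C : ℝ
  m : ℝ
  one_le_C : 1 ≤ C
  m_pos : 0 < m
  hasDerivAt_x : ∀ t x p, HasDerivAt (fun y => G t y p) (Gx t x p) x
  hasDerivAt_p : ∀ t x p, HasDerivAt (fun q => G t x q) (Gp t x p) p
  cont_G : Continuous fun q : ℝ × ℝ × ℝ => G q.1 q.2.1 q.2.2
  cont_Gx : Continuous fun q : ℝ × ℝ × ℝ => Gx q.1 q.2.1 q.2.2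
  cont_Gp : Continuous fun q : ℝ × ℝ × ℝ => Gp q.1 q.2.1 q.2.2
  lip_x : ∀ t x y p q, |Gx t y q - Gx t x p| ≤ C * (|y - x| + |q - p|)
  lip_p : ∀ t x y p q, |Gp t y q - Gp t x p| ≤ C * (|y - x| + |q - p|)
  mono : ∀ t x p q, p ≤ q → m * (q - p) ≤ Gp t x q - Gp t x p
  per_t : ∀ t x p, G (t + 1) x p = G t x p
  per_x : ∀ t x p, G t (x + 1) p = G t x p
  agree : ∀ t x p, |p| ≤ R → G t x p = H t x p
  agree_x : ∀ t x p, |p| ≤ R → Gx t x p = posDeriv H (t, x, p)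
  agree_p : ∀ t x p, |p| ≤ R → Gp t x p = momDeriv H (t, x, p)

/-- The derivative of the convex penalization used outside of `|p| ≤ R`. -/
def penal (R p : ℝ) : ℝ := max 0 (p - R) - max 0 (-p - R)

theorem continuous_penal (R : ℝ) : Continuous (penal R) := by
  unfold penal
  fun_prop

theorem penal_eq_zero {R p : ℝ} (hp : |p| ≤ R) : penal R p = 0 := by
  have := abs_le.mp hp
  rw [penal, max_eq_left (by linarith), max_eq_left (by linarith), sub_zero]

theorem abs_penal_sub_le (R p q : ℝ) : |penal R q - penal R p| ≤ 2 * |q - p| := by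
  have h1 := abs_max_sub_max_le_abs (q - R) (p - R) 0
  have h2 := abs_max_sub_max_le_abs (-q - R) (-p - R) 0
  rw [max_comm _ 0, max_comm _ 0] at h1 h2
  rw [show q - R - (p - R) = q - p by ring] at h1
  rw [show -q - R - (-p - R) = -(q - p) by ring, abs_neg] at h2
  have : penal R q - penal R p = (max 0 (q - R) - max 0 (p - R)) -
      (max 0 (-q - R) - max 0 (-p - R)) := by
    unfold penal
    ring
  rw [this]
  refine (abs_sub _ _).trans ?_
  linarith

theorem penal_sub_of_ge {R p q : ℝ} (hR : 0 ≤ R) (hp : R ≤ p) (hq : R ≤ q) :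
    penal R q - penal R p = q - p := by
  rw [penal, penal, max_eq_right (by linarith), max_eq_left (by linarith),
    max_eq_right (by linarith), max_eq_left (by linarith)]
  ring

theorem penal_sub_of_le {R p q : ℝ} (hR : 0 ≤ R) (hp : p ≤ -R) (hq : q ≤ -R) :
    penal R q - penal R p = q - p := by
  rw [penal, penal, max_eq_left (by linarith), max_eq_right (by linarith),
    max_eq_left (by linarith), max_eq_right (by linarith)]
  ring

theorem BurgersHyp.exists_cutoff {H : ℝ → ℝ → ℝ → ℝ} (hH : BurgersHyp H) {R : ℝ} (hR : 0 ≤ R) :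
    Nonempty (Cutoff H R) := by
  let χ : ContDiffBump (0 : ℝ) := ⟨R + 1, R + 2, by linarith, by linarith⟩
  set E : ℝ × ℝ × ℝ → ℝ := fun q => χ q.2.2 * H q.1 q.2.1 q.2.2 with hE
  have hEs : ContDiff ℝ 2 E :=
    (χ.contDiff.comp (contDiff_snd.comp contDiff_snd)).mul hH.smooth
  have hEd : Differentiable ℝ E := hEs.differentiable two_ne_zero
  have hEz : ∀ t x p, R + 2 ≤ |p| → E (t, x, p) = 0 := fun t x p hp => by
    have : χ p = 0 := χ.zero_of_le_dist (by simpa using hp)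
    simp [hE, this]
  have hEH : ∀ t x p, |p| ≤ R + 1 → E (t, x, p) = H t x p := fun t x p hp => by
    have : χ p = 1 := χ.one_of_mem_closedBall (by simpa using hp)
    simp [hE, this]
  have hEt : ∀ t x p, E (t + 1, x, p) = E (t, x, p) := fun t x p => by simp [hE, hH.per_t]
  have hEx : ∀ t x p, E (t, x + 1, p) = E (t, x, p) := fun t x p => by simp [hE, hH.per_x]
  have hfd : ContDiff ℝ 1 (fderiv ℝ E) := hEs.fderiv_right (m := 1) (by norm_num)
  obtain ⟨C, hC0, hC⟩ := exists_lipschitz_of_periodic (R := R + 2) hfd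
    (fun t x p => by
      have h1 := fderiv_comp_add_right (𝕜 := ℝ) (f := E) (x := (t, x, p)) (1, 0, 0)
      have h2 : (fun q : ℝ × ℝ × ℝ => E (q + (1, 0, 0))) = E := by
        ext ⟨t, x, p⟩
        simpa using hEt t x p
      rw [h2] at h1
      simpa using h1.symm)
    (fun t x p => by
      have h1 := fderiv_comp_add_right (𝕜 := ℝ) (f := E) (x := (t, x, p)) (0, 1, 0)
      have h2 : (fun q : ℝ × ℝ × ℝ => E (q + (0, 1, 0))) = E := by
        ext ⟨t, x, p⟩
        simpa using hEx t x p
      rw [h2] at h1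
      simpa using h1.symm)
    (fun t x p hp => by
      have h1 : E =ᶠ[𝓝 (t, x, p)] fun _ => 0 := by
        have : ∀ᶠ q' : ℝ × ℝ × ℝ in 𝓝 (t, x, p), R + 2 < |q'.2.2| :=
          (continuous_abs.comp (continuous_snd.comp continuous_snd)).continuousAt.eventually
            (lt_mem_nhds hp)
        filter_upwards [this] with q' hq'
        exact hEz _ _ _ hq'.le
      rw [h1.fderiv_eq]
      simp)
  have hev : ∀ t x p, |p| ≤ R →
      E =ᶠ[𝓝 (t, x, p)] fun q : ℝ × ℝ × ℝ => H q.1 q.2.1 q.2.2 := fun t x p hp => by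
    have : ∀ᶠ q' : ℝ × ℝ × ℝ in 𝓝 (t, x, p), |q'.2.2| < R + 1 :=
      (continuous_abs.comp (continuous_snd.comp continuous_snd)).continuousAt.eventually
        (gt_mem_nhds (by simpa using hp.trans_lt (lt_add_one R)))
    filter_upwards [this] with q' hq'
    exact hEH _ _ _ hq'.le
  have hap : ∀ v : ℝ × ℝ × ℝ, ‖v‖ ≤ 1 → ∀ t x y p q,
      |fderiv ℝ E (t, y, q) v - fderiv ℝ E (t, x, p) v| ≤ C * (|y - x| + |q - p|) := by
    intro v hv t x y p q
    have h1 := hC (t, y, q) (t, x, p)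
    have h2 := (fderiv ℝ E (t, y, q) - fderiv ℝ E (t, x, p)).le_opNorm v
    have h3 : ‖(t, y, q) - (t, x, p)‖ ≤ |y - x| + |q - p| := by
      simp only [Prod.mk_sub_mk, Prod.norm_def, sub_self, norm_zero, Real.norm_eq_abs]
      refine max_le (by positivity) (max_le ?_ ?_) <;>
        linarith [abs_nonneg (y - x), abs_nonneg (q - p)]
    calc |fderiv ℝ E (t, y, q) v - fderiv ℝ E (t, x, p) v|
        ≤ ‖fderiv ℝ E (t, y, q) - fderiv ℝ E (t, x, p)‖ * ‖v‖ := h2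
      _ ≤ ‖fderiv ℝ E (t, y, q) - fderiv ℝ E (t, x, p)‖ * 1 := by gcongr
      _ ≤ C * (|y - x| + |q - p|) := by
        rw [mul_one]
        exact h1.trans (mul_le_mul_of_nonneg_left h3 hC0)
  have hn1 : ‖((0 : ℝ), (1 : ℝ), (0 : ℝ))‖ ≤ 1 := by simp [Prod.norm_def]
  have hn2 : ‖((0 : ℝ), (0 : ℝ), (1 : ℝ))‖ ≤ 1 := by simp [Prod.norm_def]
  obtain ⟨m, hm, hmono⟩ := hH.exists_mono R
  have hcf : Continuous (fderiv ℝ E) := hEs.continuous_fderiv two_ne_zero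
  have hagp : ∀ t x p, |p| ≤ R → fderiv ℝ E (t, x, p) (0, 0, 1) = momDeriv H (t, x, p) :=
    fun t x p hp => by rw [(hev t x p hp).fderiv_eq, momDeriv]
  have hint : ∀ p, HasDerivAt (fun q => ∫ s in (0:ℝ)..q, penal R s) (penal R p) p := fun p =>
    ((continuous_penal R).integral_hasStrictDerivAt 0 p).hasDerivAt
  refine ⟨{
    G := fun t x p => E (t, x, p) + (C + 1) * ∫ s in (0:ℝ)..p, penal R s
    Gx := fun t x p => fderiv ℝ E (t, x, p) (0, 1, 0)
    Gp := fun t x p => fderiv ℝ E (t, x, p) (0, 0, 1) + (C + 1) * penal R p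
    C := C + (C + 1) * 2
    m := min m 1
    one_le_C := by linarith
    m_pos := lt_min hm one_pos
    hasDerivAt_x := fun t x p => (hasDerivAt_partial_fst (hEd _)).add_const _
    hasDerivAt_p := fun t x p => (hasDerivAt_partial_snd (hEd _)).add ((hint p).const_mul _)
    cont_G := hEs.continuous.add (continuous_const.mul
      ((continuous_iff_continuousAt.mpr fun p => (hint p).continuousAt).comp
        (continuous_snd.comp continuous_snd)))
    cont_Gx := hcf.clm_apply continuous_const
    cont_Gp := (hcf.clm_apply continuous_const).add (continuous_const.mul
      ((continuous_penal R).comp (continuous_snd.comp continuous_snd)))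
    lip_x := fun t x y p q => (hap _ hn1 t x y p q).trans
      (mul_le_mul_of_nonneg_right (by linarith) (by positivity))
    lip_p := fun t x y p q => ?_
    mono := fun t x => ?_
    per_t := fun t x p => by rw [hEt]
    per_x := fun t x p => by rw [hEx]
    agree := fun t x p hp => ?_
    agree_x := fun t x p hp => by rw [(hev t x p hp).fderiv_eq, posDeriv]
    agree_p := fun t x p hp => by rw [hagp t x p hp, penal_eq_zero hp, mul_zero, add_zero] }⟩
  · have h1 := hap _ hn2 t x y p q
    have h2 := abs_penal_sub_le R p q
    have h3 : fderiv ℝ E (t, y, q) (0, 0, 1) + (C + 1) * penal R q -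
      (fderiv ℝ E (t, x, p) (0, 0, 1) + (C + 1) * penal R p) =
      (fderiv ℝ E (t, y, q) (0, 0, 1) - fderiv ℝ E (t, x, p) (0, 0, 1)) +
      (C + 1) * (penal R q - penal R p) := by ring
    rw [h3]
    refine (abs_add_le _ _).trans ?_
    rw [abs_mul, abs_of_nonneg (by linarith : 0 ≤ C + 1)]
    nlinarith [mul_le_mul_of_nonneg_left h2 (by linarith : 0 ≤ C + 1), abs_nonneg (y - x)]
  · have hout : ∀ p q, p ≤ q → penal R q - penal R p = q - p → min m 1 * (q - p) ≤
        fderiv ℝ E (t, x, q) (0, 0, 1) + (C + 1) * penal R q -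
        (fderiv ℝ E (t, x, p) (0, 0, 1) + (C + 1) * penal R p) := by
      intro p q hpq hpen
      have h1 := neg_le_of_abs_le (hap _ hn2 t x x p q)
      rw [sub_self, abs_zero, zero_add, abs_of_nonneg (sub_nonneg.mpr hpq)] at h1
      have h2 := mul_le_mul_of_nonneg_right (min_le_right m 1) (sub_nonneg.mpr hpq)
      have h3 : (C + 1) * penal R q - (C + 1) * penal R p = (C + 1) * (q - p) := by
        rw [← hpen]
        ring
      linarith
    have hin : ∀ p ∈ Icc (-R) R, ∀ q ∈ Icc (-R) R, p ≤ q → min m 1 * (q - p) ≤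
        fderiv ℝ E (t, x, q) (0, 0, 1) + (C + 1) * penal R q -
        (fderiv ℝ E (t, x, p) (0, 0, 1) + (C + 1) * penal R p) := by
      intro p hp q hq hpq
      have hp' := abs_le.mpr hp
      have hq' := abs_le.mpr hq
      rw [penal_eq_zero hp', penal_eq_zero hq', hagp t x p hp', hagp t x q hq']
      have h1 := hmono t x p q hp hq hpq
      have h2 := mul_le_mul_of_nonneg_right (min_le_left m 1) (sub_nonneg.mpr hpq)
      linarith
    have hmon : Monotone fun p =>
        fderiv ℝ E (t, x, p) (0, 0, 1) + (C + 1) * penal R p - min m 1 * p := by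
      refine MonotoneOn.Iic_union_Ici (a := R) ?_ ?_
      · rw [← Iic_union_Icc_eq_Iic (show -R ≤ R by linarith)]
        refine MonotoneOn.union_right (c := -R) ?_ ?_ isGreatest_Iic
          (isLeast_Icc (by linarith))
        · intro p hp q hq hpq
          have := hout p q hpq (penal_sub_of_le hR hp hq)
          simp only
          linarith
        · intro p hp q hq hpq
          have := hin p hp q hq hpq
          simp only
          linarith
      · intro p hp q hq hpq
        have := hout p q hpq (penal_sub_of_ge hR hp hq)
        simp only
        linarith
    intro p q hpq
    have := hmon hpq
    simp only at this
    linarith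
  · have h1 : ∫ s in (0:ℝ)..p, penal R s = 0 := by
      refine intervalIntegral.integral_zero_ae (ae_of_all _ fun s hs => penal_eq_zero ?_)
      have h2 := abs_sub_left_of_mem_uIcc (uIoc_subset_uIcc hs)
      rw [sub_zero, sub_zero] at h2
      exact h2.trans hp
    rw [h1, mul_zero, add_zero, hEH t x p (by linarith)]

theorem add_deriv_mul_le_of_monotone {f f' : ℝ → ℝ} (hf : ∀ p, HasDerivAt f (f' p) p)
    (hm : Monotone f') (p q : ℝ) : f p + f' p * (q - p) ≤ f q := by
  rcases lt_trichotomy p q with hpq | rfl | hpq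
  · obtain ⟨z, hz, h1⟩ := exists_hasDerivAt_eq_slope f f' hpq
      (fun z _ => (hf z).continuousAt.continuousWithinAt) (fun z _ => hf z)
    rw [eq_div_iff (sub_pos.mpr hpq).ne'] at h1
    nlinarith [hm hz.1.le]
  · simp
  · obtain ⟨z, hz, h1⟩ := exists_hasDerivAt_eq_slope f f' hpq
      (fun z _ => (hf z).continuousAt.continuousWithinAt) (fun z _ => hf z)
    rw [eq_div_iff (sub_pos.mpr hpq).ne'] at h1
    nlinarith [hm hz.2.le]

theorem mul_sub_le_of_monotone {f f' : ℝ → ℝ} (hf : ∀ p, HasDerivAt f (f' p) p)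
    (hm : Monotone f') {P V B : ℝ} (hP : V ≤ f' P) (hP' : f' (-P) ≤ -V)
    (hB : ∀ p, |p| ≤ P → |f p| ≤ B) (hP0 : 0 ≤ P) {v : ℝ} (hv : |v| ≤ V) (q : ℝ) :
    q * v - f q ≤ P * V + B := by
  have hv' := abs_le.mp hv
  rcases le_or_gt |q| P with hq | hq
  · have h1 := neg_le_of_abs_le (hB q hq)
    have h2 : q * v ≤ |q| * |v| := by
      rw [← abs_mul]
      exact le_abs_self _
    have h3 : |q| * |v| ≤ P * V := mul_le_mul hq hv (abs_nonneg _) hP0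
    linarith
  · rcases lt_abs.mp hq with hq | hq
    · have h1 := add_deriv_mul_le_of_monotone hf hm P q
      have h2 := neg_le_of_abs_le (hB P (abs_of_nonneg hP0).le)
      have h3 : v * (q - P) ≤ f' P * (q - P) :=
        mul_le_mul_of_nonneg_right (hv'.2.trans hP) (by linarith)
      have h4 : P * v ≤ P * V := mul_le_mul_of_nonneg_left hv'.2 hP0
      linarith
    · have h1 := add_deriv_mul_le_of_monotone hf hm (-P) q
      have h2 := neg_le_of_abs_le (hB (-P) (by rw [abs_neg, abs_of_nonneg hP0]))
      have h3 : v * (q - -P) ≤ f' (-P) * (q - -P) :=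
        mul_le_mul_of_nonpos_right (hP'.trans hv'.1) (by linarith)
      have h4 : P * (-v) ≤ P * V := mul_le_mul_of_nonneg_left (by linarith) hP0
      linarith

theorem eq_of_hasDerivAt_of_lipschitz {E : Type*} [NormedAddCommGroup E] [NormedSpace ℝ E]
    {v : ℝ → E → E} {K : ℝ} (hK : 0 ≤ K)
    (hlip : ∀ t z w, ‖v t z - v t w‖ ≤ K * ‖z - w‖) {f g f' : ℝ → E} {t : ℝ}
    (hf : ∀ s, HasDerivAt f (v s (f s)) s) (hg : ∀ s, HasDerivAt g (f' s) s) {a b : ℝ}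
    (hv : ∀ s ∈ Icc a b, f' s = v s (g s))
    (ht : t ∈ Ioo a b) (heq : f t = g t) : EqOn f g (Icc a b) := by
  refine ODE_solution_unique_of_mem_Icc (v := v) (s := fun _ => univ) (K := K.toNNReal)
    (fun s _ => LipschitzOnWith.of_dist_le_mul fun z _ w _ => ?_) ht
    (fun s _ => (hf s).continuousAt.continuousWithinAt) (fun s _ => hf s) (fun _ _ => mem_univ _)
    (fun s _ => (hg s).continuousAt.continuousWithinAt)
    (fun s hs => (hg s).congr_deriv (hv s (Ioo_subset_Icc_self hs))) (fun _ _ => mem_univ _) heq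
  rw [Real.coe_toNNReal _ hK, dist_eq_norm, dist_eq_norm]
  exact hlip s z w

namespace Cutoff

variable {H : ℝ → ℝ → ℝ → ℝ} {R : ℝ} (g : Cutoff H R)

/-- The Hamiltonian vector field of a cut-off Hamiltonian. -/
def VF (t : ℝ) (z : ℝ × ℝ) : ℝ × ℝ := (g.Gp t z.1 z.2, -g.Gx t z.1 z.2)

theorem C_pos : 0 < g.C := zero_lt_one.trans_le g.one_le_C

theorem VF_lip (t : ℝ) (z w : ℝ × ℝ) : ‖g.VF t z - g.VF t w‖ ≤ 2 * g.C * ‖z - w‖ := by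
  have h1 := g.lip_p t w.1 z.1 w.2 z.2
  have h2 := g.lip_x t w.1 z.1 w.2 z.2
  have h3 : |z.1 - w.1| ≤ ‖z - w‖ := norm_fst_le (z - w)
  have h4 : |z.2 - w.2| ≤ ‖z - w‖ := norm_snd_le (z - w)
  have h5 : g.C * (|z.1 - w.1| + |z.2 - w.2|) ≤ 2 * g.C * ‖z - w‖ := by
    have := g.C_pos
    nlinarith
  rw [Prod.norm_def, max_le_iff]
  constructor
  · exact h1.trans h5
  · rw [Real.norm_eq_abs]
    simp only [VF, Prod.snd_sub]
    rw [neg_sub_neg, abs_sub_comm]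
    exact h2.trans h5

theorem Gx_add_one_t (t x p : ℝ) : g.Gx (t + 1) x p = g.Gx t x p := by
  have h1 := g.hasDerivAt_x (t + 1) x p
  simp only [g.per_t] at h1
  exact h1.unique (g.hasDerivAt_x t x p)

theorem Gp_add_one_t (t x p : ℝ) : g.Gp (t + 1) x p = g.Gp t x p := by
  have h1 := g.hasDerivAt_p (t + 1) x p
  simp only [g.per_t] at h1
  exact h1.unique (g.hasDerivAt_p t x p)

theorem Gp_mono (t x : ℝ) : Monotone (g.Gp t x) := fun p q hpq => by
  have h1 := g.mono t x p q hpq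
  have := mul_nonneg g.m_pos.le (sub_nonneg.mpr hpq)
  linarith

theorem exists_orbit (t₀ : ℝ) (z₀ : ℝ × ℝ) :
    ∃ γ : ℝ → ℝ × ℝ, γ t₀ = z₀ ∧ ∀ t, HasDerivAt γ (g.VF t (γ t)) t := by
  have hc : Continuous fun q : ℝ × ℝ × ℝ => g.VF q.1 q.2 := g.cont_Gp.prodMk g.cont_Gx.neg
  have hp : ∀ t, ‖g.VF (t + 1) 0‖ = ‖g.VF t 0‖ := fun t => by
    simp only [VF, g.Gp_add_one_t, g.Gx_add_one_t]
  obtain ⟨V, hV⟩ := TameHam.exists_bound_of_per (f := fun t => ‖g.VF t 0‖)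
    (hc.comp (Continuous.prodMk_left (0 : ℝ × ℝ))).norm hp
  exact exists_global_solution (v := g.VF) (by linarith [g.C_pos]) hc g.VF_lip
    (fun t => by simpa using hV t) t₀ z₀

theorem hamVF_eq (hH : BurgersHyp H) {t : ℝ} {z : ℝ × ℝ} (hz : |z.2| ≤ R) :
    HamVF H t z = g.VF t z := by
  rw [hH.hamVF_eq, VF, g.agree_p _ _ _ hz, g.agree_x _ _ _ hz]

theorem eqOn_of_abs_snd_le (hH : BurgersHyp H) {γ η : ℝ → ℝ × ℝ}
    (hγ : ∀ s, HasDerivAt γ (g.VF s (γ s)) s) (hη : ∀ s, HasDerivAt η (HamVF H s (η s)) s)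
    {a b t : ℝ} (ht : t ∈ Ioo a b) (heq : γ t = η t) (hR : ∀ s ∈ Icc a b, |(η s).2| ≤ R) :
    EqOn γ η (Icc a b) :=
  eq_of_hasDerivAt_of_lipschitz (by linarith [g.C_pos]) g.VF_lip hγ hη
    (fun s hs => g.hamVF_eq hH (hR s hs)) ht heq

end Cutoff

namespace BurgersHyp

variable {H : ℝ → ℝ → ℝ → ℝ}

theorem add_momDeriv_mul_le (hH : BurgersHyp H) (t x p q : ℝ) :
    H t x p + momDeriv H (t, x, p) * (q - p) ≤ H t x q :=
  add_deriv_mul_le_of_monotone (hH.hasDerivAt_mom t x) (hH.momDeriv_mono t x) p q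

theorem eventually_lt_momDeriv (hH : BurgersHyp H) (V t x : ℝ) :
    ∀ᶠ n : ℕ in atTop, V < momDeriv H (t, x, n) ∧ momDeriv H (t, x, -n) < -V := by
  have hs := hH.superlinear t x
  have h1 : Tendsto (fun n : ℕ => (n : ℝ)) atTop (Bornology.cobounded ℝ) :=
    tendsto_natCast_atTop_cobounded
  have h2 : Tendsto (fun n : ℕ => -(n : ℝ)) atTop (Bornology.cobounded ℝ) :=
    tendsto_neg_cobounded.comp h1
  filter_upwards [(hs.comp h1).eventually_gt_atTop (V + |H t x 0|),
    (hs.comp h2).eventually_gt_atTop (V + |H t x 0|), eventually_ge_atTop 1] with n hn1 hn2 hn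
  have hn' : (1 : ℝ) ≤ n := by exact_mod_cast hn
  have hn0 : (0 : ℝ) < n := by linarith
  simp only [Function.comp, abs_neg, Nat.abs_cast] at hn1 hn2
  rw [lt_div_iff₀ hn0] at hn1 hn2
  have h3 := hH.add_momDeriv_mul_le t x n 0
  have h4 := hH.add_momDeriv_mul_le t x (-n) 0
  have h5 := le_abs_self (H t x 0)
  have h6 : |H t x 0| ≤ |H t x 0| * n := le_mul_of_one_le_right (abs_nonneg _) hn'
  constructor
  · refine lt_of_mul_lt_mul_right (a := (n : ℝ)) ?_ hn0.le
    linarith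
  · refine lt_of_mul_lt_mul_right (a := (n : ℝ)) ?_ hn0.le
    linarith

theorem exists_le_momDeriv (hH : BurgersHyp H) (V : ℝ) :
    ∃ P, 0 ≤ P ∧ ∀ t x, V < momDeriv H (t, x, P) ∧ momDeriv H (t, x, -P) < -V := by
  have hc := hH.contDiff_momDeriv.continuous
  obtain ⟨n, hn⟩ := ((isCompact_Icc (a := (0:ℝ)) (b := 1)).prod
    (isCompact_Icc (a := (0:ℝ)) (b := 1))).elim_directed_cover
    (fun n : ℕ => {z : ℝ × ℝ | V < momDeriv H (z.1, z.2, n) ∧ momDeriv H (z.1, z.2, -n) < -V})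
    (fun n => by
      have h1 : Continuous fun z : ℝ × ℝ => momDeriv H (z.1, z.2, n) := hc.comp (by fun_prop)
      have h2 : Continuous fun z : ℝ × ℝ => momDeriv H (z.1, z.2, -n) := hc.comp (by fun_prop)
      exact (isOpen_lt continuous_const h1).inter (isOpen_lt h2 continuous_const))
    (fun z _ => mem_iUnion.mpr (hH.eventually_lt_momDeriv V z.1 z.2).exists)
    (directed_of_isDirected_le fun n k hnk z hz => by
      have hnk' : (n : ℝ) ≤ k := by exact_mod_cast hnk
      exact ⟨hz.1.trans_le (hH.momDeriv_mono _ _ hnk'),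
        (hH.momDeriv_mono z.1 z.2 (neg_le_neg hnk')).trans_lt hz.2⟩)
  refine ⟨n, Nat.cast_nonneg n, fun t x => ?_⟩
  have key : ∀ p, momDeriv H (t, x, p) = momDeriv H (Int.fract t, Int.fract x, p) := fun p => by
    have h1 := TameHam.per_int (f := fun s => momDeriv H (s, x, p))
      (fun s => hH.momDeriv_add_one_t _ _ _) ⌊t⌋ (Int.fract t)
    have h2 := TameHam.per_int (f := fun s => momDeriv H (Int.fract t, s, p))
      (fun s => hH.momDeriv_add_one_x _ _ _) ⌊x⌋ (Int.fract x)
    rw [Int.fract_add_floor] at h1 h2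
    rw [h1, h2]
  rw [key, key]
  exact hn (a := (Int.fract t, Int.fract x))
    ⟨⟨Int.fract_nonneg _, (Int.fract_lt_one _).le⟩, ⟨Int.fract_nonneg _, (Int.fract_lt_one _).le⟩⟩

theorem exists_bound (hH : BurgersHyp H) (R : ℝ) :
    ∃ B, 0 ≤ B ∧ ∀ t x p, |p| ≤ R → |H t x p| ≤ B := by
  obtain ⟨B, hB⟩ := TameHam.exists_bound_of_periodic hH.continuous hH.per_t hH.per_x R
  exact ⟨max B 0, le_max_right _ _, fun t x p hp => (hB t x p hp).trans (le_max_left _ _)⟩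

/-- The Legendre transform of `H` is locally bounded, uniformly in time and position. -/
theorem exists_mul_sub_le (hH : BurgersHyp H) (V : ℝ) :
    ∃ B, ∀ t x q v, |v| ≤ V → q * v - H t x q ≤ B := by
  obtain ⟨P, hP0, hP⟩ := hH.exists_le_momDeriv V
  obtain ⟨B, -, hB⟩ := hH.exists_bound P
  exact ⟨P * V + B, fun t x q v hv => mul_sub_le_of_monotone (hH.hasDerivAt_mom t x)
    (hH.momDeriv_mono t x) (hP t x).1.le (hP t x).2.le (hB t x) hP0 hv q⟩

theorem exists_local_bound (hH : BurgersHyp H) (t₀ : ℝ) (z₀ : ℝ × ℝ) :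
    ∃ U ∈ 𝓝 (t₀, z₀), ∃ R, ∀ t z, (t, z) ∈ U → ∀ η : ℝ → ℝ × ℝ,
      (∀ s, HasDerivAt η (HamVF H s (η s)) s) → η t = z →
      ∀ s ∈ Icc (t - 1) (t + 1), |(η s).2| ≤ R := by
  have hbd : ∀ η : ℝ → ℝ × ℝ, (∀ s, HasDerivAt η (HamVF H s (η s)) s) → ∀ a b,
      ∃ ρ, 0 ≤ ρ ∧ ∀ s ∈ Icc a b, |(η s).2| ≤ ρ := fun η hη a b => by
    have hc : Continuous η := continuous_iff_continuousAt.mpr fun s => (hη s).continuousAt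
    obtain ⟨ρ, hρ⟩ := (isCompact_Icc (a := a) (b := b)).exists_bound_of_continuousOn
      (continuous_snd.comp hc).continuousOn
    exact ⟨max ρ 0, le_max_right _ _, fun s hs => (hρ s hs).trans (le_max_left _ _)⟩
  obtain ⟨η₀, hη₀, hη₀'⟩ := hH.complete t₀ z₀
  obtain ⟨ρ, hρ0, hρ⟩ := hbd η₀ hη₀' (t₀ - 2) (t₀ + 2)
  obtain ⟨g⟩ := hH.exists_cutoff (R := ρ + 1) (by linarith)
  obtain ⟨γ₀, hγ₀, hγ₀'⟩ := g.exists_orbit t₀ z₀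
  have hC := g.C_pos
  have hE := g.eqOn_of_abs_snd_le hH hγ₀' hη₀' (t := t₀) ⟨by linarith, by linarith⟩
    (hγ₀.trans hη₀.symm) (fun s hs => (hρ s hs).trans (by linarith))
  have hγc : Continuous γ₀ := continuous_iff_continuousAt.mpr fun s => (hγ₀' s).continuousAt
  refine ⟨{q | |q.1 - t₀| < 1 ∧ ‖q.2 - γ₀ q.1‖ * Real.exp (2 * g.C) < 1}, ?_, ρ + 1, ?_⟩
  · refine IsOpen.mem_nhds ?_ ?_
    · have h1 : Continuous fun q : ℝ × ℝ × ℝ => |q.1 - t₀| := by fun_prop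
      have h2 : Continuous fun q : ℝ × ℝ × ℝ => ‖q.2 - γ₀ q.1‖ * Real.exp (2 * g.C) := by
        fun_prop
      exact (isOpen_lt h1 continuous_const).inter (isOpen_lt h2 continuous_const)
    · simp [hγ₀]
  · rintro t z ⟨ht, hz⟩ η hη rfl
    simp only at ht hz
    obtain ⟨γ, hγt, hγ⟩ := g.exists_orbit t (η t)
    have hγb : ∀ s ∈ Icc (t - 1) (t + 1), |(γ s).2| ≤ ρ + 1 := fun s hs => by
      have h1 := dist_solutions_le (by linarith) g.VF_lip hγ hγ₀' t s
      rw [hγt] at h1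
      have h2 : |s - t| ≤ 1 := by
        rw [abs_le]
        constructor <;> linarith [hs.1, hs.2]
      have h3 : Real.exp (2 * g.C * |s - t|) ≤ Real.exp (2 * g.C) :=
        Real.exp_le_exp.mpr (mul_le_of_le_one_right (by linarith) h2)
      have h4 := h1.trans (mul_le_mul_of_nonneg_left h3 (norm_nonneg _))
      have h5 : |(γ s).2 - (γ₀ s).2| ≤ ‖γ s - γ₀ s‖ := norm_snd_le (γ s - γ₀ s)
      have ht' := abs_lt.mp ht
      have hs' : s ∈ Icc (t₀ - 2) (t₀ + 2) :=
        ⟨by linarith [hs.1], by linarith [hs.2]⟩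
      have h6 := hρ s hs'
      rw [← hE hs'] at h6
      have h7 := abs_sub_abs_le_abs_sub (γ s).2 (γ₀ s).2
      linarith
    obtain ⟨ρ', hρ'0, hρ'⟩ := hbd η hη (t - 1) (t + 1)
    obtain ⟨g'⟩ := hH.exists_cutoff (R := max ρ' (ρ + 1)) (hρ'0.trans (le_max_left _ _))
    obtain ⟨γ', hγ't, hγ'⟩ := g'.exists_orbit t (η t)
    have ht : t ∈ Ioo (t - 1) (t + 1) := ⟨by linarith, by linarith⟩
    have h1 := g'.eqOn_of_abs_snd_le hH hγ' hη ht hγ't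
      (fun s hs => (hρ' s hs).trans (le_max_left _ _))
    have h2 : EqOn γ' γ (Icc (t - 1) (t + 1)) :=
      eq_of_hasDerivAt_of_lipschitz (by linarith [g'.C_pos]) g'.VF_lip hγ' hγ
        (fun s hs => by
          rw [← g'.hamVF_eq hH ((hγb s hs).trans (le_max_right _ _)), g.hamVF_eq hH (hγb s hs)])
        ht (hγ't.trans hγt.symm)
    intro s hs
    rw [← h1 hs, h2 hs]
    exact hγb s hs

theorem hamVF_add_int (hH : BurgersHyp H) (k l : ℤ) (t : ℝ) (z : ℝ × ℝ) :
    HamVF H (t + k) (z.1 + l, z.2) = HamVF H t z := by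
  have key : ∀ x p, H (t + k) (x + l) p = H t x p := fun x p => by
    have h1 := TameHam.per_int (f := fun s => H s (x + l) p) (fun s => hH.per_t _ _ _) k t
    have h2 := TameHam.per_int (f := fun s => H t s p) (fun s => hH.per_x _ _ _) l x
    exact h1.trans h2
  have h1 := deriv_comp_add_const (fun x => H (t + k) x z.2) (l : ℝ) z.1
  simp only [HamVF, key] at h1 ⊢
  rw [h1]

theorem exists_orbit_bound (hH : BurgersHyp H) (P : ℝ) : ∃ R, ∀ η : ℝ → ℝ × ℝ,
    (∀ s, HasDerivAt η (HamVF H s (η s)) s) → ∀ t, |(η t).2| ≤ P →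
      ∀ s ∈ Icc (t - 1) (t + 1), |(η s).2| ≤ R := by
  have hK := (isCompact_Icc (a := (0:ℝ)) (b := 1)).prod
    ((isCompact_Icc (a := (0:ℝ)) (b := 1)).prod (isCompact_Icc (a := -P) (b := P)))
  obtain ⟨R, hR⟩ := hK.induction_on
    (p := fun S => ∃ R, ∀ t z, (t, z) ∈ S → ∀ η : ℝ → ℝ × ℝ,
      (∀ s, HasDerivAt η (HamVF H s (η s)) s) → η t = z →
      ∀ s ∈ Icc (t - 1) (t + 1), |(η s).2| ≤ R)
    ⟨0, fun _ _ h => h.elim⟩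
    (fun S T hST ⟨R, hR⟩ => ⟨R, fun t z hz => hR t z (hST hz)⟩)
    (fun S T ⟨R, hR⟩ ⟨R', hR'⟩ => ⟨max R R', fun t z hz η hη hηt s hs => by
      rcases hz with hz | hz
      · exact (hR t z hz η hη hηt s hs).trans (le_max_left _ _)
      · exact (hR' t z hz η hη hηt s hs).trans (le_max_right _ _)⟩)
    (fun q _ => by
      obtain ⟨U, hU, hR⟩ := hH.exists_local_bound q.1 q.2
      exact ⟨U, mem_nhdsWithin_of_mem_nhds hU, hR⟩)
  refine ⟨R, fun η hη t ht s hs => ?_⟩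
  have h1 : ∀ r, HasDerivAt (fun s => ((η (s + ⌊t⌋)).1 + ((-⌊(η t).1⌋ : ℤ) : ℝ), (η (s + ⌊t⌋)).2))
      (HamVF H r ((η (r + ⌊t⌋)).1 + ((-⌊(η t).1⌋ : ℤ) : ℝ), (η (r + ⌊t⌋)).2)) r := fun r => by
    have h2 := (hη (r + ⌊t⌋)).comp_add_const r (⌊t⌋ : ℝ)
    have h3 := h2.add_const (((-⌊(η t).1⌋ : ℤ) : ℝ), (0 : ℝ))
    have h4 := hH.hamVF_add_int 0 (-⌊(η t).1⌋) r (η (r + ⌊t⌋))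
    have h5 := hH.hamVF_add_int ⌊t⌋ 0 r (η (r + ⌊t⌋))
    rw [Int.cast_zero, add_zero] at h4 h5
    rw [h4, ← h5]
    have h6 : (fun s => ((η (s + ⌊t⌋)).1 + ((-⌊(η t).1⌋ : ℤ) : ℝ), (η (s + ⌊t⌋)).2)) =
        fun s => η (s + ⌊t⌋) + (((-⌊(η t).1⌋ : ℤ) : ℝ), (0 : ℝ)) := by
      ext s <;> simp
    rw [h6]
    exact h3
  have h2 := hR (Int.fract t) _ (?_ : (Int.fract t, (_ : ℝ × ℝ)) ∈ _) _ h1 rfl (s - ⌊t⌋) ?_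
  · simpa using h2
  · simp only [Int.fract_add_floor]
    refine ⟨⟨Int.fract_nonneg _, (Int.fract_lt_one _).le⟩, ⟨?_, ?_⟩, abs_le.mp ht⟩ <;> push_cast
    · linarith [Int.floor_le (η t).1]
    · linarith [Int.lt_floor_add_one (η t).1]
  · have := Int.fract_add_floor t
    constructor <;> linarith [hs.1, hs.2]

/-- `H` coincides, in the relevant region of momenta, with a globally controlled Hamiltonian. -/
theorem exists_tameHam (hH : BurgersHyp H) {K : ℝ} (hK : 0 ≤ K) :
    ∃ h : TameHam, h.K = K ∧ ∀ t x p, |p| ≤ h.R₁ → h.G t x p = H t x p := by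
  obtain ⟨P₁, hP₁0, hP₁⟩ := hH.exists_le_momDeriv 1
  obtain ⟨B₁, hB₁0, hB₁⟩ := hH.exists_bound P₁
  obtain ⟨C₁, hC₁0, hC₁⟩ := hH.exists_bound (K + 1)
  set C₀ := P₁ * 1 + B₁ with hC₀
  have hC₀0 : 0 ≤ C₀ := by positivity
  obtain ⟨P, hP0, hP⟩ := hH.exists_le_momDeriv (C₀ + C₁ + K)
  obtain ⟨R₁, hR₁⟩ := hH.exists_orbit_bound P
  set R := max (max P₁ P) (max (K + 1) R₁) with hR
  have hRP₁ : P₁ ≤ R := (le_max_left _ _).trans (le_max_left _ _)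
  have hRP : P ≤ R := (le_max_right _ _).trans (le_max_left _ _)
  have hRK : K + 1 ≤ R := (le_max_left _ _).trans (le_max_right _ _)
  have hRR : R₁ ≤ R := (le_max_right _ _).trans (le_max_right _ _)
  obtain ⟨g⟩ := hH.exists_cutoff (R := R) (by linarith)
  refine ⟨{
    G := g.G
    Gx := g.Gx
    Gp := g.Gp
    C := g.C
    m := g.m
    K := K
    C₀ := C₀
    C₁ := C₁
    R₁ := R₁
    one_le_C := g.one_le_C
    m_pos := g.m_pos
    hasDerivAt_x := g.hasDerivAt_x
    hasDerivAt_p := g.hasDerivAt_p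
    cont_G := g.cont_G
    cont_Gx := g.cont_Gx
    cont_Gp := g.cont_Gp
    lip_x := g.lip_x
    lip_p := g.lip_p
    mono := g.mono
    per_t := g.per_t
    per_x := g.per_x
    K_nonneg := hK
    C₀_nonneg := hC₀0
    C₁_nonneg := hC₁0
    mul_sub_le := fun v hv t x q => ?_
    G_le := fun e he t x => ?_
    snd_le := fun γ hγ t ht s hs => ?_ }, rfl, fun t x p hp => g.agree t x p (hp.trans hRR)⟩
  · have hab : |P₁| ≤ R := by rwa [abs_of_nonneg hP₁0]
    refine mul_sub_le_of_monotone (g.hasDerivAt_p t x) (g.Gp_mono t x) (P := P₁) ?_ ?_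
      (fun p hp => ?_) hP₁0 hv q
    · rw [g.agree_p _ _ _ hab]
      exact (hP₁ t x).1.le
    · rw [g.agree_p _ _ _ (by rwa [abs_neg])]
      exact (hP₁ t x).2.le
    · rw [g.agree _ _ _ (hp.trans hRP₁)]
      exact hB₁ t x p hp
  · rw [g.agree _ _ _ (he.trans hRK)]
    exact (le_abs_self _).trans (hC₁ t x e he)
  · have hab : |P| ≤ R := by rwa [abs_of_nonneg hP0]
    have ht' := abs_le.mp ht
    have hγP : |(γ t).2| ≤ P := by
      rw [abs_le]
      constructor <;> by_contra! hlt
      · have h1 := g.Gp_mono t (γ t).1 hlt.le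
        rw [g.agree_p _ _ (-P) (by rwa [abs_neg])] at h1
        linarith [(hP t (γ t).1).2]
      · have h1 := g.Gp_mono t (γ t).1 hlt.le
        rw [g.agree_p _ _ P hab] at h1
        linarith [(hP t (γ t).1).1]
    obtain ⟨η, hηt, hη⟩ := hH.complete t (γ t)
    have h1 := hR₁ η hη t (by rwa [hηt])
    have h2 := g.eqOn_of_abs_snd_le hH hγ hη (t := t) ⟨by linarith, by linarith⟩ hηt.symm
      (fun s hs => (h1 s hs).trans hRR)
    have hs' : s ∈ Icc (t - 1) (t + 1) := ⟨by linarith [hs.1], hs.2⟩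
    rw [h2 hs']
    exact h1 s hs'

end BurgersHyp

theorem hasDerivAt_of_supporting_lines {f ρ : ℝ → ℝ} {s : Set ℝ} {c : ℝ} (hs : s ∈ 𝓝 c)
    (hρ : ContinuousAt ρ c)
    (hf : ∀ x ∈ s, ∀ y ∈ s, f y + (x - y) * ρ y ≤ f x) : HasDerivAt f (ρ c) c := by
  rw [hasDerivAt_iff_isLittleO]
  rw [Asymptotics.isLittleO_iff]
  intro ε hε
  filter_upwards [hs, Metric.continuousAt_iff'.mp hρ ε hε] with x hx hxε
  have h1 := hf x hx c (mem_of_mem_nhds hs)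
  have h2 := hf c (mem_of_mem_nhds hs) x hx
  rw [Real.dist_eq] at hxε
  have h3 : (x - c) * (ρ x - ρ c) ≤ ε * |x - c| := by
    refine (le_abs_self _).trans ?_
    rw [abs_mul, mul_comm]
    exact mul_le_mul_of_nonneg_right hxε.le (abs_nonneg _)
  rw [Real.norm_eq_abs, Real.norm_eq_abs, smul_eq_mul, abs_of_nonneg (by linarith)]
  linarith

theorem convexOn_univ_of_supporting_lines {f ρ : ℝ → ℝ}
    (hf : ∀ x y, f y + (x - y) * ρ y ≤ f x) : ConvexOn ℝ univ f := by
  refine ⟨convex_univ, fun x _ y _ a b ha hb hab => ?_⟩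
  have h1 := mul_le_mul_of_nonneg_left (hf x (a • x + b • y)) ha
  have h2 := mul_le_mul_of_nonneg_left (hf y (a • x + b • y)) hb
  simp only [smul_eq_mul] at *
  obtain rfl : b = 1 - a := by linarith
  linarith

/-- `a` is the critical value of `H` at cohomology `c`. -/
def IsCriticalValue (H : ℝ → ℝ → ℝ → ℝ) (c a : ℝ) : Prop :=
  ∃ h : TameHam, (∀ t x p, |p| ≤ h.R₁ → h.G t x p = H t x p) ∧ ∃ w, h.WeakKAM c a w

section Alpha

variable {H : ℝ → ℝ → ℝ → ℝ}

theorem BurgersHyp.exists_isCriticalValue (hH : BurgersHyp H) {K : ℝ} (hK : 0 ≤ K) :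
    ∃ A ρ : ℝ → ℝ, (∀ c, |c| ≤ K → IsCriticalValue H c (A c)) ∧
      ContinuousOn ρ {c | |c| ≤ K} ∧
      ∀ c c', |c| ≤ K → |c'| ≤ K → A c' + (c - c') * ρ c' ≤ A c := by
  obtain ⟨h, rfl, hag⟩ := hH.exists_tameHam hK
  obtain ⟨A, ρ, hA, hρ, hs⟩ := h.exists_critical
  exact ⟨A, ρ, fun c hc => ⟨h, hag, hA c hc⟩, hρ, hs⟩

theorem IsCriticalValue.unique (hH : BurgersHyp H) {c a a' : ℝ} (h : IsCriticalValue H c a)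
    (h' : IsCriticalValue H c a') : a = a' := by
  obtain ⟨g, hg, w, hw⟩ := h
  obtain ⟨k, hk, v, hv⟩ := h'
  exact hw.unique hg hH.continuous hv hk

/-- Mather's alpha function, with its supporting slopes. -/
theorem BurgersHyp.exists_alpha (hH : BurgersHyp H) :
    ∃ α ρ : ℝ → ℝ, (∀ c, IsCriticalValue H c (α c)) ∧ Continuous ρ ∧
      ∀ c, HasDerivAt α (ρ c) c ∧ ∀ c', α c + (c' - c) * ρ c ≤ α c' := by
  choose! A ρ hA hρ hs using fun K hK => hH.exists_isCriticalValue (K := K) hK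
  have hα : ∀ K, ∀ c, |c| ≤ K → A |c| c = A K c := fun K c hc =>
    (hA _ (abs_nonneg c) c le_rfl).unique hH (hA K ((abs_nonneg c).trans hc) c hc)
  have hd : ∀ K, ∀ c, |c| < K → HasDerivAt (fun c => A |c| c) (ρ K c) c := fun K c hc => by
    have hK : 0 ≤ K := (abs_nonneg c).trans hc.le
    have hn : {c | |c| ≤ K} ∈ 𝓝 c :=
      mem_of_superset ((isOpen_lt continuous_abs continuous_const).mem_nhds hc)
        fun x (h : |x| < K) => h.le
    refine hasDerivAt_of_supporting_lines hn ((hρ K hK).continuousAt hn) fun x hx y hy => ?_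
    simp only [hα K x hx, hα K y hy]
    exact hs K hK x y hx hy
  have hρe : ∀ K, ∀ c, |c| < K → ρ (|c| + 1) c = ρ K c := fun K c hc =>
    (hd _ c (lt_add_one _)).unique (hd K c hc)
  refine ⟨fun c => A |c| c, fun c => ρ (|c| + 1) c, fun c => hA _ (abs_nonneg c) c le_rfl,
    continuous_iff_continuousAt.mpr fun c => ?_, fun c => ⟨hd _ c (lt_add_one _), fun c' => ?_⟩⟩
  · have hn : {x | |x| < |c| + 1} ∈ 𝓝 c :=
      (isOpen_lt continuous_abs continuous_const).mem_nhds (lt_add_one |c|)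
    have h1 := (hρ (|c| + 1) (by positivity)).continuousAt
      (mem_of_superset hn fun x (h : |x| < |c| + 1) => h.le)
    refine h1.congr ?_
    filter_upwards [hn] with x hx
    exact (hρe _ x hx).symm
  · have h1 : |c| < |c| + |c'| + 1 := by linarith [abs_nonneg c']
    have h2 : |c'| ≤ |c| + |c'| + 1 := by linarith [abs_nonneg c]
    simp only [hρe _ c h1, hα _ c h1.le, hα _ c' h2]
    exact hs _ (by positivity) c' c h2 h1.le

theorem BurgersHyp.tendsto_div_abs_of_isCriticalValue (hH : BurgersHyp H) {α : ℝ → ℝ}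
    (hα : ∀ c, IsCriticalValue H c (α c)) :
    Tendsto (fun c => α c / |c|) (Bornology.cobounded ℝ) atTop := by
  refine tendsto_atTop.mpr fun V => ?_
  obtain ⟨B, hB⟩ := hH.exists_mul_sub_le (|V| + 1)
  have hc : Tendsto (fun c : ℝ => |c|) (Bornology.cobounded ℝ) atTop :=
    tendsto_norm_cobounded_atTop
  filter_upwards [hc.eventually_ge_atTop (|B| + 1)] with c hc
  have hc0 : 0 < |c| := by linarith [abs_nonneg B]
  obtain ⟨g, hg, w, hw⟩ := hα c
  have h1 : (|V| + 1) * |c| - B ≤ α c := by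
    refine hw.le_of_forall_le hg hH.continuous fun t x => ?_
    have hV : 0 ≤ |V| + 1 := by positivity
    rcases abs_cases c with ⟨h, _⟩ | ⟨h, _⟩ <;> rw [h]
    · linarith [hB t x c (|V| + 1) (abs_of_nonneg hV).le]
    · linarith [hB t x c (-(|V| + 1)) (by rw [abs_neg, abs_of_nonneg hV])]
  rw [le_div_iff₀ hc0]
  have h2 : V * |c| ≤ |V| * |c| := mul_le_mul_of_nonneg_right (le_abs_self V) hc0.le
  linarith [le_abs_self B]

end Alpha

/-- existence of Mather's alpha function: a `C¹`, convex and superlinear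
function `α : ℝ → ℝ` such that every viscosity solution `u` of `(HJc)` on `[t₀,∞) × 𝕋`
has `u(t,x) + tα(c)` bounded. -/
theorem stmt_7 (H : ℝ → ℝ → ℝ → ℝ) (hH : BurgersHyp H) :
    ∃ α : ℝ → ℝ, ContDiff ℝ 1 α ∧ ConvexOn ℝ univ α ∧
      Tendsto (fun c => α c / |c|) (Bornology.cobounded ℝ) atTop ∧
      ∀ c t₀ : ℝ, ∀ u : ℝ → ℝ → ℝ, IsViscSolOn H c t₀ u →
        ∃ M, ∀ t ∈ Ici t₀, ∀ x, |u t x + t * α c| ≤ M := by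
  obtain ⟨α, ρ, hα, hρ, hd⟩ := hH.exists_alpha
  refine ⟨α, contDiff_one_iff_deriv.mpr ⟨fun c => (hd c).1.differentiableAt, ?_⟩,
    convexOn_univ_of_supporting_lines fun x y => (hd y).2 x,
    hH.tendsto_div_abs_of_isCriticalValue hα, fun c t₀ u hu => ?_⟩
  · rwa [show deriv α = ρ from funext fun c => (hd c).1.deriv]
  · obtain ⟨g, hg, w, hw⟩ := hα c
    exact hw.bounded hg hH.continuous hu
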